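/- There exists n₀ ∈ ℕ such that the following holds for all n ≥ n₀: if G is a simple graph on n vertices with at least ⌊n²/4⌋ + 1 edges whose number of edges occurring in C₅ equals F(n), then the vertex set of G can be partitioned into four sets A, B, C, D such that: the quadruple (|A|, |B|, |C|, |D|) is n-extremal; A, B and C are independent sets of G; {u,v} ∈ E(G) for every u ∈ A and v ∈ B; {u,v} ∉ E(G) for every u ∈ A and v ∈ C ∪ D; and {u,v} ∉ E(G) for every u ∈ B and v ∈ D. -/

import Mathlib

open SimpleGraph

/-- An edge `e` of `G` occurs in `C_m`: `G` contains a cycle of length `m`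
whose edge set contains `e`. -/
def occursInC {V : Type*} (G : SimpleGraph V) (m : ℕ) (e : Sym2 V) : Prop :=
  ∃ (u : V) (w : G.Walk u u), w.IsCycle ∧ w.length = m ∧ e ∈ w.edges

/-- The number of edges of `G` that occur in a cycle of length `m`. -/
noncomputable def countEdgesInC {V : Type*} (G : SimpleGraph V) (m : ℕ) : ℕ :=
  {e | e ∈ G.edgeSet ∧ occursInC G m e}.ncard

/-- `F(n)`: the minimum over all graphs on `n` vertices with exactly
`⌊n²/4⌋ + 1` edges of the number of edges occurring in `C₅`. -/
noncomputable def F5 (n : ℕ) : ℕ :=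
  sInf {m : ℕ | ∃ G : SimpleGraph (Fin n),
    G.edgeSet.ncard = n ^ 2 / 4 + 1 ∧ countEdgesInC G 5 = m}

/-- `F̃(n) = ⌊n²/4⌋ + 1 - F(n)`. -/
noncomputable def F5tilde (n : ℕ) : ℕ := n ^ 2 / 4 + 1 - F5 n

/-- A quadruple `(a, b, c, d)` of non-negative integers is `n`-extremal. -/
noncomputable def nExtremal (n a b c d : ℕ) : Prop :=
  a + b + c + d = n ∧ a * b = F5tilde n ∧
  n ^ 2 / 4 < a * b + b * c + c * d + d.choose 2

namespace EC5
open Finset Classical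

/-- number of `G`-neighbours of `x` in `Y` -/
noncomputable def dg {V : Type*} (G : SimpleGraph V) (x : V) (Y : Finset V) : ℝ :=
  ((Y.filter (fun y => G.Adj x y)).card : ℝ)

/-- number of ordered adjacent pairs in `X × Y` -/
noncomputable def E {V : Type*} (G : SimpleGraph V) (X Y : Finset V) : ℝ :=
  ∑ x ∈ X, dg G x Y

section basics
variable {V : Type*} (G : SimpleGraph V)

lemma dg_eq_sum (x : V) (Y : Finset V) :
    dg G x Y = ∑ y ∈ Y, (if G.Adj x y then (1 : ℝ) else 0) := by
  unfold dg; rw [Finset.sum_boole]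

lemma dg_nonneg (x : V) (Y : Finset V) : 0 ≤ dg G x Y := by unfold dg; positivity

lemma dg_le_card (x : V) (Y : Finset V) : dg G x Y ≤ (Y.card : ℝ) := by
  unfold dg; exact_mod_cast Finset.card_filter_le _ _

lemma dg_union (x : V) {Y Z : Finset V} (h : Disjoint Y Z) :
    dg G x (Y ∪ Z) = dg G x Y + dg G x Z := by
  simp only [dg_eq_sum]; exact Finset.sum_union h

lemma dg_subset (x : V) {Y Z : Finset V} (h : Y ⊆ Z) : dg G x Y ≤ dg G x Z := by
  unfold dg; exact_mod_cast Finset.card_le_card (Finset.filter_subset_filter _ h)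

lemma dg_mono {G H : SimpleGraph V} (x : V) (Y : Finset V) (h : ∀ y ∈ Y, G.Adj x y → H.Adj x y) :
    dg G x Y ≤ dg H x Y := by
  unfold dg
  have : (Y.filter (fun y => G.Adj x y)) ⊆ (Y.filter (fun y => H.Adj x y)) := by
    intro y hy
    simp only [Finset.mem_filter] at hy ⊢
    exact ⟨hy.1, h y hy.1 hy.2⟩
  exact_mod_cast Finset.card_le_card this

lemma dg_eq_zero {x : V} {Y : Finset V} (h : ∀ y ∈ Y, ¬ G.Adj x y) : dg G x Y = 0 := by
  unfold dg
  rw [Finset.filter_false_of_mem h]; simp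

lemma dg_pos {x : V} {Y : Finset V} (h : 0 < dg G x Y) : ∃ y ∈ Y, G.Adj x y := by
  by_contra hc
  push Not at hc
  rw [dg_eq_zero G hc] at h
  exact lt_irrefl _ h

lemma E_eq_sum (X Y : Finset V) :
    E G X Y = ∑ x ∈ X, ∑ y ∈ Y, (if G.Adj x y then (1 : ℝ) else 0) := by
  unfold E; simp only [dg_eq_sum]

lemma E_comm (X Y : Finset V) : E G X Y = E G Y X := by
  rw [E_eq_sum, E_eq_sum, Finset.sum_comm]
  simp only [G.adj_comm]

lemma E_nonneg (X Y : Finset V) : 0 ≤ E G X Y := Finset.sum_nonneg fun _ _ => dg_nonneg _ _ _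

lemma E_le (X Y : Finset V) : E G X Y ≤ (X.card : ℝ) * Y.card := by
  unfold E
  calc _ ≤ ∑ x ∈ X, (Y.card : ℝ) := Finset.sum_le_sum fun _ _ => dg_le_card _ _ _
    _ = _ := by simp

lemma E_union_left {X Y : Finset V} (Z : Finset V) (h : Disjoint X Y) :
    E G (X ∪ Y) Z = E G X Z + E G Y Z := Finset.sum_union h

lemma E_union_right {Y Z : Finset V} (X : Finset V) (h : Disjoint Y Z) :
    E G X (Y ∪ Z) = E G X Y + E G X Z := by
  rw [E_comm, E_union_left G X h, E_comm G Y, E_comm G Z]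

lemma E_subset_left {X Y : Finset V} (Z : Finset V) (h : X ⊆ Y) : E G X Z ≤ E G Y Z :=
  Finset.sum_le_sum_of_subset_of_nonneg h fun _ _ _ => dg_nonneg _ _ _

lemma E_subset_right {Y Z : Finset V} (X : Finset V) (h : Y ⊆ Z) : E G X Y ≤ E G X Z :=
  Finset.sum_le_sum fun x _ => dg_subset G x h

lemma E_mono {G H : SimpleGraph V} (X Y : Finset V)
    (h : ∀ x ∈ X, ∀ y ∈ Y, G.Adj x y → H.Adj x y) : E G X Y ≤ E H X Y :=
  Finset.sum_le_sum fun x hx => dg_mono x Y (h x hx)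

lemma E_eq_zero {X Y : Finset V} (h : ∀ x ∈ X, ∀ y ∈ Y, ¬ G.Adj x y) : E G X Y = 0 :=
  Finset.sum_eq_zero fun x hx => dg_eq_zero G (h x hx)

lemma E_union_self {X Y : Finset V} (h : Disjoint X Y) :
    E G (X ∪ Y) (X ∪ Y) = E G X X + 2 * E G X Y + E G Y Y := by
  rw [E_union_left G _ h, E_union_right G _ h, E_union_right G _ h, E_comm G Y X]; ring

lemma E_compl_right [Fintype V] (X Y : Finset V) :
    E G X Finset.univ = E G X Y + E G X Yᶜ := by
  rw [← E_union_right G X disjoint_compl_right]; rw [Finset.union_compl]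

lemma E_split [Fintype V] (X : Finset V) :
    E G univ univ = E G X X + 2 * E G X Xᶜ + E G Xᶜ Xᶜ := by
  rw [← E_union_self G disjoint_compl_right]; rw [Finset.union_compl]

lemma E_univ [Fintype V] : E G univ univ = 2 * (G.edgeSet.ncard : ℝ) := by
  have h := G.sum_degrees_eq_twice_card_edges
  have h2 : G.edgeSet.ncard = #G.edgeFinset := by
    rw [Set.ncard_eq_toFinset_card']; rfl
  rw [h2]
  have h3 : E G univ univ = ((∑ v, G.degree v : ℕ) : ℝ) := by
    unfold E dg
    push_cast
    refine Finset.sum_congr rfl fun x _ => ?_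
    rw [← G.card_neighborFinset_eq_degree, G.neighborFinset_eq_filter]
  rw [h3, h]; push_cast; ring

/-- If `X` contains two disjoint independent sets, few edges. -/
lemma E_two_indep {X C D : Finset V} (hC : C ⊆ X) (hD : D ⊆ X) (hCD : Disjoint C D)
    (iC : ∀ x ∈ C, ∀ y ∈ C, ¬ G.Adj x y) (iD : ∀ x ∈ D, ∀ y ∈ D, ¬ G.Adj x y) :
    E G X X + (C.card : ℝ) ^ 2 + (D.card : ℝ) ^ 2 ≤ (X.card : ℝ) ^ 2 := by
  set Z := X \ (C ∪ D) with hZ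
  have hX : X = (C ∪ D) ∪ Z := by
    rw [hZ, Finset.union_sdiff_of_subset (Finset.union_subset hC hD)]
  have hd : Disjoint (C ∪ D) Z := Finset.disjoint_sdiff
  have hcard : (X.card : ℝ) = C.card + D.card + Z.card := by
    rw [hX, Finset.card_union_of_disjoint hd, Finset.card_union_of_disjoint hCD]; push_cast; ring
  rw [hcard]
  rw [hX, E_union_self G hd, E_union_self G hCD, E_eq_zero G iC, E_eq_zero G iD]
  have h1 := E_le G C D
  have h2 := E_le G (C ∪ D) Z
  have h3 := E_le G Z Z
  rw [Finset.card_union_of_disjoint hCD] at h2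
  push_cast at h2
  nlinarith

lemma E_triangle_free_indep {X C : Finset V} (hC : C ⊆ X)
    (iC : ∀ x ∈ C, ∀ y ∈ C, ¬ G.Adj x y) :
    E G X X + (C.card : ℝ) ^ 2 ≤ (X.card : ℝ) ^ 2 := by
  have := E_two_indep G hC (Finset.empty_subset X) (Finset.disjoint_empty_right C) iC (by simp)
  simpa using this

end basics
end EC5

namespace EC5
open Finset Classical

/-- the pair `u v` closes up to an (explicit) 5-cycle `u v x y z` -/
def Cyc {V : Type*} (G : SimpleGraph V) (u v : V) : Prop :=
  ∃ x y z, G.Adj v x ∧ G.Adj x y ∧ G.Adj y z ∧ G.Adj z u ∧ x ≠ u ∧ y ≠ u ∧ y ≠ v ∧ z ≠ v ∧ x ≠ z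

lemma Cyc.symm {V : Type*} {G : SimpleGraph V} {u v : V} (h : Cyc G u v) : Cyc G v u := by
  obtain ⟨x, y, z, h1, h2, h3, h4, h5, h6, h7, h8, h9⟩ := h
  exact ⟨z, y, x, h4.symm, h3.symm, h2.symm, h1.symm, h8, h7, h6, h5, h9.symm⟩

/-- the graph of edges not in a 5-cycle -/
def Red {V : Type*} (G : SimpleGraph V) : SimpleGraph V where
  Adj u v := G.Adj u v ∧ ¬ Cyc G u v
  symm := ⟨fun _ _ h => ⟨h.1.symm, fun hc => h.2 hc.symm⟩⟩
  loopless := ⟨fun _ h => G.loopless.irrefl _ h.1⟩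

lemma red_adj {V : Type*} {G : SimpleGraph V} {u v : V} :
    (Red G).Adj u v ↔ G.Adj u v ∧ ¬ Cyc G u v := Iff.rfl

lemma occurs_iff {V : Type*} (G : SimpleGraph V) {u v : V} (huv : G.Adj u v) :
    occursInC G 5 s(u, v) ↔ Cyc G u v := by
  constructor
  · rintro ⟨x, w, hw, hl, he⟩
    match w, hw, hl, he with
    | .cons (v := a) h1 (.cons (v := b) h2 (.cons (v := c) h3 (.cons (v := d) h4
        (.cons h5 .nil)))), hw, hl, he =>
      have hn := hw.support_nodup
      simp only [Walk.support_cons, Walk.support_nil, List.tail_cons, List.nodup_cons,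
        List.mem_cons, List.not_mem_nil, not_or, or_false, not_false_eq_true, List.nodup_nil,
        and_true] at hn
      obtain ⟨⟨n1, n2, n3, n4⟩, ⟨n5, n6, n7⟩, ⟨n8, n9⟩, n10⟩ := hn
      simp only [Walk.edges_cons, Walk.edges_nil, List.mem_cons, List.not_mem_nil, or_false,
        Sym2.eq_iff] at he
      rcases he with he | he | he | he | he <;> rcases he with ⟨rfl, rfl⟩ | ⟨rfl, rfl⟩
      · exact ⟨_, _, _, h2, h3, h4, h5, n7, n9, Ne.symm n2, Ne.symm n3, n6⟩
      · exact Cyc.symm ⟨_, _, _, h2, h3, h4, h5, n7, n9, Ne.symm n2, Ne.symm n3, n6⟩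
      · exact ⟨_, _, _, h3, h4, h5, h1, Ne.symm n2, Ne.symm n3, Ne.symm n6, Ne.symm n7, n9⟩
      · exact Cyc.symm ⟨_, _, _, h3, h4, h5, h1, Ne.symm n2, Ne.symm n3, Ne.symm n6, Ne.symm n7, n9⟩
      · exact ⟨_, _, _, h4, h5, h1, h2, Ne.symm n6, Ne.symm n7, Ne.symm n9, n2, Ne.symm n3⟩
      · exact Cyc.symm ⟨_, _, _, h4, h5, h1, h2, Ne.symm n6, Ne.symm n7, Ne.symm n9, n2, Ne.symm n3⟩
      · exact ⟨_, _, _, h5, h1, h2, h3, Ne.symm n9, n2, n3, n6, Ne.symm n7⟩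
      · exact Cyc.symm ⟨_, _, _, h5, h1, h2, h3, Ne.symm n9, n2, n3, n6, Ne.symm n7⟩
      · exact ⟨_, _, _, h1, h2, h3, h4, n3, n6, n7, n9, n2⟩
      · exact Cyc.symm ⟨_, _, _, h1, h2, h3, h4, n3, n6, n7, n9, n2⟩
  · rintro ⟨x, y, z, h1, h2, h3, h4, h5, h6, h7, h8, h9⟩
    refine ⟨u, .cons huv (.cons h1 (.cons h2 (.cons h3 (.cons h4 .nil)))), ?_, by simp, by simp⟩
    rw [Walk.cons_isCycle_iff]
    have := huv.ne
    have := h1.ne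
    have := h2.ne
    have := h3.ne
    have := h4.ne
    simp only [Walk.isPath_def, Walk.support_cons, Walk.support_nil, Walk.edges_cons,
      Walk.edges_nil, Sym2.eq_iff, List.nodup_cons, List.mem_cons, List.not_mem_nil]
    grind

lemma count_add_red {V : Type*} [Fintype V] (G : SimpleGraph V) :
    countEdgesInC G 5 + (Red G).edgeSet.ncard = G.edgeSet.ncard := by
  unfold countEdgesInC
  rw [← Set.ncard_union_eq]
  · congr 1
    ext e
    induction e with | _ u v
    simp only [Set.mem_union, Set.mem_ofPred_eq, mem_edgeSet, red_adj]
    by_cases h : G.Adj u v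
    · simp only [occurs_iff G h, h, true_and]
      exact iff_true_intro (Classical.em _)
    · simp [h]
  · rw [Set.disjoint_left]
    intro e
    induction e with | _ u v
    simp only [Set.mem_ofPred_eq, mem_edgeSet, red_adj]
    rintro ⟨h1, h2⟩ ⟨h3, h4⟩
    exact h4 ((occurs_iff G h1).1 h2)

end EC5

namespace EC5
open Finset Classical

/-- the complete blow-up pattern on classes `A B C D` -/
def Mx {V : Type*} (A B C D : Finset V) : SimpleGraph V where
  Adj u v := u ≠ v ∧ ((u ∈ A ∧ v ∈ B) ∨ (v ∈ A ∧ u ∈ B) ∨ (u ∈ B ∧ v ∈ C) ∨ (v ∈ B ∧ u ∈ C) ∨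
    (u ∈ C ∧ v ∈ D) ∨ (v ∈ C ∧ u ∈ D) ∨ (u ∈ D ∧ v ∈ D))
  symm := ⟨fun _ _ h => by tauto⟩
  loopless := ⟨fun _ h => h.1 rfl⟩

lemma E_full {V : Type*} (G : SimpleGraph V) {X Y : Finset V}
    (h : ∀ x ∈ X, ∀ y ∈ Y, G.Adj x y) : E G X Y = (X.card : ℝ) * Y.card := by
  unfold E dg
  rw [Finset.sum_congr rfl (g := fun _ => (Y.card : ℝ))]
  · simp
  · intro x hx
    rw [Finset.filter_true_of_mem (h x hx)]

lemma choose_two_real (d : ℕ) : ((d.choose 2 : ℕ) : ℝ) = (d : ℝ) * (d - 1) / 2 :=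
  Nat.cast_choose_two ℝ d

lemma E_clique {V : Type*} (G : SimpleGraph V) {X : Finset V}
    (h : ∀ x ∈ X, ∀ y ∈ X, x ≠ y → G.Adj x y) : E G X X = (X.card : ℝ) * (X.card - 1) := by
  unfold E dg
  rw [Finset.sum_congr rfl (g := fun _ => (X.card - 1 : ℝ))]
  · simp; ring
  · intro x hx
    have : X.filter (fun y => G.Adj x y) = X.erase x := by
      ext y
      simp only [Finset.mem_filter, Finset.mem_erase]
      constructor
      · rintro ⟨h1, h2⟩; exact ⟨h2.ne', h1⟩
      · rintro ⟨h1, h2⟩; exact ⟨h2, h x hx y h2 (Ne.symm h1)⟩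
    rw [this, Finset.card_erase_of_mem hx]
    have : 1 ≤ X.card := Finset.card_pos.2 ⟨x, hx⟩
    push_cast [this]; ring

lemma E_self_le {V : Type*} (G : SimpleGraph V) (X : Finset V) :
    E G X X ≤ (X.card : ℝ) * (X.card - 1) := by
  rw [← E_clique (⊤ : SimpleGraph V) (X := X) (by simp)]
  exact E_mono _ _ fun x _ y _ h => h.ne

lemma E_univ_four {V : Type*} [Fintype V] (G : SimpleGraph V) {A B C D : Finset V}
    (hu : A ∪ B ∪ C ∪ D = univ) (h1 : Disjoint A B) (h2 : Disjoint (A ∪ B) C)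
    (h3 : Disjoint (A ∪ B ∪ C) D) :
    E G univ univ = E G A A + E G B B + E G C C + E G D D + 2 * (E G A B + E G A C + E G A D
      + E G B C + E G B D + E G C D) := by
  rw [← hu, E_union_self G h3, E_union_self G h2, E_union_self G h1, E_union_left G _ h2,
    E_union_left G _ h1, E_union_left G _ h1]
  ring

lemma exists_four {V : Type*} [Fintype V] (n a b c d : ℕ) (hV : Fintype.card V = n)
    (h : a + b + c + d = n) :
    ∃ A B C D : Finset V, A.card = a ∧ B.card = b ∧ C.card = c ∧ D.card = d ∧
      A ∪ B ∪ C ∪ D = univ ∧ Disjoint A B ∧ Disjoint (A ∪ B) C ∧ Disjoint (A ∪ B ∪ C) D := by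
  obtain ⟨A, -, hA⟩ := Finset.exists_subset_card_eq (s := (univ : Finset V)) (n := a)
    (by rw [Finset.card_univ]; omega)
  obtain ⟨B, hB', hB⟩ := Finset.exists_subset_card_eq (s := Aᶜ) (n := b)
    (by rw [Finset.card_compl]; omega)
  have dAB : Disjoint A B := by
    rw [Finset.disjoint_right]; intro x hx; simpa using hB' hx
  have cAB : (A ∪ B).card = a + b := by rw [Finset.card_union_of_disjoint dAB, hA, hB]
  obtain ⟨C, hC', hC⟩ := Finset.exists_subset_card_eq (s := (A ∪ B)ᶜ) (n := c)
    (by rw [Finset.card_compl]; omega)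
  have dABC : Disjoint (A ∪ B) C := by
    rw [Finset.disjoint_right]; intro x hx; simpa using hC' hx
  refine ⟨A, B, C, (A ∪ B ∪ C)ᶜ, hA, hB, hC, ?_, ?_, dAB, dABC, disjoint_compl_right⟩
  · rw [Finset.card_compl, Finset.card_union_of_disjoint dABC, cAB, hC]; omega
  · rw [Finset.union_compl]

lemma F1_aux {V : Type*} [Fintype V] (n a b c d : ℕ) (hV : Fintype.card V = n)
    (h : a + b + c + d = n)
    (hv : n ^ 2 / 4 < a * b + b * c + c * d + d.choose 2) :
    ∃ G : SimpleGraph V, G.edgeSet.ncard = n ^ 2 / 4 + 1 ∧ a * b ≤ (Red G).edgeSet.ncard := by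
  obtain ⟨A, B, C, D, hA, hB, hC, hD, hu, d1, d2, d3⟩ := exists_four (V := V) n a b c d hV h
  have dAC : Disjoint A C := Finset.disjoint_of_subset_left (by intro x; simp; tauto) d2
  have dBC : Disjoint B C := Finset.disjoint_of_subset_left (by intro x; simp; tauto) d2
  have dAD : Disjoint A D := Finset.disjoint_of_subset_left (by intro x; simp; tauto) d3
  have dBD : Disjoint B D := Finset.disjoint_of_subset_left (by intro x; simp; tauto) d3
  have dCD : Disjoint C D := Finset.disjoint_of_subset_left (by intro x; simp; tauto) d3
  rw [Finset.disjoint_left] at dAC dBC dAD dBD dCD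
  have dAB := Finset.disjoint_left.1 d1
  -- size of the full pattern
  have eM : (Mx A B C D).edgeSet.ncard = a * b + b * c + c * d + d.choose 2 := by
    have e1 := E_univ (Mx A B C D)
    rw [E_univ_four _ hu d1 d2 d3] at e1
    rw [E_eq_zero (X := A) (Y := A) _ (by simp only [Mx]; grind),
      E_eq_zero (X := B) (Y := B) _ (by simp only [Mx]; grind),
      E_eq_zero (X := C) (Y := C) _ (by simp only [Mx]; grind),
      E_eq_zero (X := A) (Y := C) _ (by simp only [Mx]; grind),
      E_eq_zero (X := A) (Y := D) _ (by simp only [Mx]; grind),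
      E_eq_zero (X := B) (Y := D) _ (by simp only [Mx]; grind),
      E_full (X := A) (Y := B) _ (by simp only [Mx]; grind),
      E_full (X := B) (Y := C) _ (by simp only [Mx]; grind),
      E_full (X := C) (Y := D) _ (by simp only [Mx]; grind),
      E_clique (X := D) _ (by simp only [Mx]; grind), hA, hB, hC, hD] at e1
    have e2 : ((Mx A B C D).edgeSet.ncard : ℝ) = ((a * b + b * c + c * d + d.choose 2 : ℕ) : ℝ) := by
      push_cast [choose_two_real]; linarith
    exact_mod_cast e2
  let P : SimpleGraph V := Mx A B ∅ ∅
  have hPM : P ≤ Mx A B C D := by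
    intro u v h; simp only [P, Mx, Finset.notMem_empty] at h ⊢; tauto
  have eP : P.edgeSet.ncard = a * b := by
    have e1 := E_univ P
    rw [E_univ_four _ hu d1 d2 d3] at e1
    rw [E_eq_zero (X := A) (Y := A) _ (by simp only [P, Mx]; grind),
      E_eq_zero (X := B) (Y := B) _ (by simp only [P, Mx]; grind),
      E_eq_zero (X := C) (Y := C) _ (by simp only [P, Mx]; grind),
      E_eq_zero (X := D) (Y := D) _ (by simp only [P, Mx]; grind),
      E_eq_zero (X := A) (Y := C) _ (by simp only [P, Mx]; grind),
      E_eq_zero (X := A) (Y := D) _ (by simp only [P, Mx]; grind),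
      E_eq_zero (X := B) (Y := D) _ (by simp only [P, Mx]; grind),
      E_eq_zero (X := B) (Y := C) _ (by simp only [P, Mx]; grind),
      E_eq_zero (X := C) (Y := D) _ (by simp only [P, Mx]; grind),
      E_full (X := A) (Y := B) _ (by simp only [P, Mx]; grind), hA, hB] at e1
    have e2 : (P.edgeSet.ncard : ℝ) = ((a * b : ℕ) : ℝ) := by
      push_cast; linarith
    exact_mod_cast e2
  have hab : a * b ≤ n ^ 2 / 4 := by
    rw [Nat.le_div_iff_mul_le (by norm_num)]
    have : a + b ≤ n := by omega
    zify at this ⊢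
    nlinarith [sq_nonneg ((a : ℤ) - b)]
  obtain ⟨s, hs1, hs2, hs3⟩ := Finset.exists_subsuperset_card_eq (s := P.edgeFinset)
    (t := (Mx A B C D).edgeFinset) (n := n ^ 2 / 4 + 1) (by simpa using hPM)
    (by
      have : P.edgeSet.ncard = #P.edgeFinset := by rw [Set.ncard_eq_toFinset_card']; rfl
      omega)
    (by
      have : (Mx A B C D).edgeSet.ncard = #(Mx A B C D).edgeFinset := by
        rw [Set.ncard_eq_toFinset_card']; rfl
      omega)
  let G := SimpleGraph.fromEdgeSet (s : Set (Sym2 V))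
  have hGe : G.edgeSet = s := by
    rw [SimpleGraph.edgeSet_fromEdgeSet]
    ext e
    simp only [Set.mem_sdiff, Finset.mem_coe]
    constructor
    · exact fun h => h.1
    · intro h
      exact ⟨h, SimpleGraph.not_isDiag_of_mem_edgeFinset (hs2 h)⟩
  have hGM : G ≤ Mx A B C D := by
    rw [← SimpleGraph.edgeSet_subset_edgeSet, hGe]
    intro e he
    exact SimpleGraph.mem_edgeFinset.1 (hs2 he)
  have hPG : P ≤ G := by
    rw [← SimpleGraph.edgeSet_subset_edgeSet, hGe]
    intro e he
    exact hs1 (SimpleGraph.mem_edgeFinset.2 he)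
  have hcard : G.edgeSet.ncard = n ^ 2 / 4 + 1 := by
    rw [hGe, Set.ncard_coe_finset, hs3]
  have hPR : P ≤ Red G := by
    intro u v huv
    refine ⟨hPG huv, ?_⟩
    wlog hA : u ∈ A ∧ v ∈ B generalizing u v
    · intro hc
      refine this huv.symm ?_ hc.symm
      simp only [P, Mx, Finset.notMem_empty] at huv
      tauto
    · rintro ⟨x, y, z, h1, h2, h3, h4, -⟩
      have := hGM h1
      have := hGM h2
      have := hGM h3
      have := hGM h4
      simp only [Mx] at *
      grind
  have hle : a * b ≤ (Red G).edgeSet.ncard := by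
    rw [← eP]
    exact Set.ncard_le_ncard (SimpleGraph.edgeSet_subset_edgeSet.2 hPR) (Set.toFinite _)
  exact ⟨G, hcard, hle⟩

lemma F1 (n a b c d : ℕ) (h : a + b + c + d = n)
    (hv : n ^ 2 / 4 < a * b + b * c + c * d + d.choose 2) : a * b ≤ F5tilde n := by
  obtain ⟨G, hcard, hle⟩ := F1_aux (V := Fin n) n a b c d (by simp) h hv
  have h1 := count_add_red G
  have h2 : F5 n ≤ countEdgesInC G 5 := Nat.sInf_le ⟨G, hcard, rfl⟩
  unfold F5tilde
  omega

lemma F2 (n : ℕ) (G : SimpleGraph (Fin n)) (he : n ^ 2 / 4 + 1 ≤ G.edgeSet.ncard)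
    (hc : countEdgesInC G 5 = F5 n) : F5tilde n ≤ (Red G).edgeSet.ncard := by
  have := count_add_red G
  unfold F5tilde
  omega

lemma F3 (δ : ℝ) (hδ : 0 < δ) : ∃ N : ℕ, ∀ n : ℕ, N ≤ n →
    ((2 - √2) / 16 - δ) * (n : ℝ) ^ 2 ≤ (F5tilde n : ℝ) := by
  have s0 : (√2) ^ 2 = 2 := Real.sq_sqrt (by norm_num)
  have s1 : (1.4 : ℝ) < √2 := by rw [Real.lt_sqrt] <;> norm_num
  have s2 : √2 < 1.42 := by rw [Real.sqrt_lt'] <;> norm_num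
  set s := √2
  obtain ⟨η, hη, hη1, hη2⟩ : ∃ η : ℝ, 0 < η ∧ η ≤ δ ∧ η ≤ 0.1 :=
    ⟨min δ 0.1, by positivity, min_le_left _ _, min_le_right _ _⟩
  obtain ⟨N, hN⟩ := exists_nat_gt (100 / η)
  refine ⟨N + 1000, fun n hn => ?_⟩
  have hn1 : (100 : ℝ) < η * n := by
    have : (N : ℝ) ≤ n := by exact_mod_cast (by omega : N ≤ n)
    have : 100 / η < n := by linarith
    rw [div_lt_iff₀ hη] at this; linarith
  have hn2 : (1000 : ℝ) ≤ n := by exact_mod_cast (by omega : 1000 ≤ n)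
  set a := ⌊((2 - s) / 4 - η) * n⌋₊
  set b := ⌊(n : ℝ) / 4⌋₊
  have ha1 : (a : ℝ) ≤ ((2 - s) / 4 - η) * n := Nat.floor_le (by
    apply mul_nonneg <;> nlinarith)
  have ha2 : ((2 - s) / 4 - η) * n - 1 ≤ a := by
    have := Nat.lt_floor_add_one (((2 - s) / 4 - η) * n); linarith
  have hb1 : (b : ℝ) ≤ n / 4 := Nat.floor_le (by positivity)
  have hb2 : (n : ℝ) / 4 - 1 ≤ b := by
    have := Nat.lt_floor_add_one ((n : ℝ) / 4); linarith
  have habn : a + b + b ≤ n := by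
    have : ((a + b + b : ℕ) : ℝ) ≤ n := by push_cast; nlinarith
    exact_mod_cast this
  obtain ⟨d, hd⟩ := Nat.exists_eq_add_of_le habn
  have hdR : (n : ℝ) = a + b + b + d := by exact_mod_cast hd
  have hd1 : (s / 4 + η) * n ≤ d := by nlinarith
  have ha0 : 0 ≤ ((2 - s) / 4 - η) * n - 1 := by nlinarith
  have hb0 : 0 ≤ (n : ℝ) / 4 - 1 := by nlinarith
  have hab : (((2 - s) / 4 - η) * n - 1) * ((n : ℝ) / 4 - 1) ≤ a * b :=
    mul_le_mul ha2 hb2 hb0 (by positivity)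
  have hbb : ((n : ℝ) / 4 - 1) * ((n : ℝ) / 4 - 1) ≤ (b : ℝ) * b :=
    mul_le_mul hb2 hb2 hb0 (by positivity)
  have hd0 : 0 ≤ (s / 4 + η) * n := by positivity
  have hbd : ((n : ℝ) / 4 - 1) * ((s / 4 + η) * n) ≤ (b : ℝ) * d :=
    mul_le_mul hb2 hd1 hd0 (by positivity)
  have hdn : (d : ℝ) ≤ n := by
    have : (0 : ℝ) ≤ a := by positivity
    have : (0 : ℝ) ≤ b := by positivity
    linarith
  have hdd : ((s / 4 + η) * n) * ((s / 4 + η) * n) ≤ (d : ℝ) * d :=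
    mul_le_mul hd1 hd1 hd0 (by positivity)
  have hval : n ^ 2 / 4 < a * b + b * b + b * d + d.choose 2 := by
    rw [Nat.div_lt_iff_lt_mul (by norm_num)]
    have : ((n ^ 2 : ℕ) : ℝ) < (((a * b + b * b + b * d + d.choose 2) * 4 : ℕ) : ℝ) := by
      push_cast [choose_two_real]
      have key : (n : ℝ) ^ 2 / 4 + η * s / 4 * n ^ 2 + η ^ 2 / 2 * n ^ 2 - 4 * n ≤
          (a * b + b * b + b * d + d * (d - 1) / 2 : ℝ) := by
        have s3 : s ^ 2 * n ^ 2 = 2 * (n : ℝ) ^ 2 := by rw [s0]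
        ring_nf at hab hbb hbd hdd s3 ⊢
        linarith
      have h20 : 20 ≤ η * n * (s / 4) := by nlinarith
      have : 20 * (n : ℝ) ≤ η * n * (s / 4) * n := mul_le_mul_of_nonneg_right h20 (by positivity)
      have := sq_nonneg (η * n)
      ring_nf at *
      linarith
    exact_mod_cast this
  have := F1 n a b b d hd.symm hval
  have h3 : ((a * b : ℕ) : ℝ) ≤ F5tilde n := by exact_mod_cast this
  push_cast at h3
  have h4 : 100 * (n : ℝ) ≤ η * n * n := mul_le_mul_of_nonneg_right hn1.le (by positivity)
  have h5 : η * (n : ℝ) ^ 2 ≤ δ * n ^ 2 := mul_le_mul_of_nonneg_right hη1 (by positivity)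
  have h6 : 0 ≤ s * n := by positivity
  have h7 : 0 ≤ η * n := by positivity
  ring_nf at *
  linarith

end EC5

namespace EC5
open Finset Classical

/-- the hypotheses satisfied by a cleaned pair of graphs -/
structure HP {V : Type*} (G H : SimpleGraph V) (S : Finset V) : Prop where
  tri : ∀ v ∈ S, ∀ x y, G.Adj v x → G.Adj x y → G.Adj y v → False
  mem : ∀ u v, H.Adj u v → u ∈ S
  le : H ≤ G
  walk : ∀ u v, H.Adj u v → ∀ x y z, G.Adj u x → G.Adj x y → G.Adj y z → G.Adj z v → False

section cleaning
variable {V : Type*} [Fintype V] (G : SimpleGraph V)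

/-- two vertices with three common red neighbours -/
def sim (v w : V) : Prop :=
  v ≠ w ∧ 3 ≤ (univ.filter (fun u => (Red G).Adj v u ∧ (Red G).Adj w u)).card

variable {G} in
lemma sim.symm {v w : V} (h : sim G v w) : sim G w v := by
  refine ⟨h.1.symm, ?_⟩
  have := h.2
  simp only [and_comm] at this ⊢
  exact this

lemma claim1 {v w x y : V} (h : sim G v w) (h1 : G.Adj v y) (h2 : G.Adj w x) (h3 : G.Adj x y)
    (h4 : x ≠ v) (h5 : y ≠ w) : False := by
  obtain ⟨u, hu, hu'⟩ := Finset.exists_mem_notMem_of_card_lt_card (s := {x, y})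
    (lt_of_le_of_lt (Finset.card_le_two) h.2)
  simp only [Finset.mem_filter, Finset.mem_univ, true_and, Finset.mem_insert,
    Finset.mem_singleton, not_or] at hu hu'
  refine hu.1.symm.2 ⟨y, x, w, h1, h3.symm, h2.symm, hu.2.1, Ne.symm hu'.2, Ne.symm hu'.1, h4,
    h.1.symm, h5⟩

lemma pigeon (R : SimpleGraph V) (W : Finset V) (k : ℕ) (δ : ℝ) (hk : 2 ≤ k * δ)
    (hn : (k : ℝ) ^ 2 < Fintype.card V)
    (h1 : ∀ v ∈ W, δ * Fintype.card V ≤ dg R v univ)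
    (h2 : ∀ v ∈ W, ∀ w ∈ W, v ≠ w →
      (univ.filter (fun u => R.Adj v u ∧ R.Adj w u)).card ≤ 2) : W.card ≤ k := by
  by_contra hc
  push Not at hc
  obtain ⟨U, hUW, hU⟩ := Finset.exists_subset_card_eq hc.le
  set n : ℝ := (Fintype.card V : ℝ)
  have hF : E R U univ = E R univ U := E_comm _ _ _
  have hF1 : 2 * n ≤ E R U univ := by
    calc 2 * n ≤ (k * δ) * n := by
            apply mul_le_mul_of_nonneg_right hk; positivity
      _ = ∑ v ∈ U, δ * n := by simp [hU]; ring
      _ ≤ _ := Finset.sum_le_sum fun v hv => h1 v (hUW hv)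
  have hpt : ∀ x : V, 3 * dg R x U - dg R x U ^ 2 ≤ 2 := by
    intro x
    unfold dg
    set f := (U.filter (fun y => R.Adj x y)).card
    rcases le_or_gt f 1 with h | h
    · have : (f : ℝ) ≤ 1 := by exact_mod_cast h
      nlinarith
    · have : (2 : ℝ) ≤ f := by exact_mod_cast h
      nlinarith
  have hsq : ∑ x : V, dg R x U ^ 2 ≤ E R U univ + 2 * (k : ℝ) ^ 2 := by
    have e1 : ∑ x : V, dg R x U ^ 2 = ∑ v ∈ U, ∑ w ∈ U,
        ((univ.filter (fun u => R.Adj v u ∧ R.Adj w u)).card : ℝ) := by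
      calc _ = ∑ x : V, ∑ v ∈ U, ∑ w ∈ U, (if R.Adj v x ∧ R.Adj w x then (1 : ℝ) else 0) := by
            refine Finset.sum_congr rfl fun x _ => ?_
            rw [sq, dg_eq_sum, Finset.sum_mul_sum]
            refine Finset.sum_congr rfl fun v _ => Finset.sum_congr rfl fun w _ => ?_
            rw [R.adj_comm x v, R.adj_comm x w]
            by_cases a : R.Adj v x <;> by_cases b : R.Adj w x <;> simp [a, b]
        _ = _ := by
            rw [Finset.sum_comm]
            refine Finset.sum_congr rfl fun v _ => ?_
            rw [Finset.sum_comm]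
            refine Finset.sum_congr rfl fun w _ => ?_
            rw [Finset.sum_boole]
    rw [e1]
    have : ∀ v ∈ U, ∑ w ∈ U, ((univ.filter (fun u => R.Adj v u ∧ R.Adj w u)).card : ℝ) ≤
        dg R v univ + 2 * k := by
      intro v hv
      rw [← Finset.add_sum_erase _ _ hv]
      refine add_le_add (by simp [dg]) ?_
      calc _ ≤ ∑ w ∈ U.erase v, (2 : ℝ) := Finset.sum_le_sum fun w hw => by
              rw [Finset.mem_erase] at hw
              exact_mod_cast h2 v (hUW hv) w (hUW hw.2) (Ne.symm hw.1)
        _ ≤ 2 * k := by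
              simp only [Finset.sum_const, nsmul_eq_mul]
              have : ((U.erase v).card : ℝ) ≤ k := by
                rw [← hU]; exact_mod_cast Finset.card_erase_le
              linarith
    calc _ ≤ ∑ v ∈ U, (dg R v univ + 2 * (k : ℝ)) := Finset.sum_le_sum this
      _ = _ := by
        rw [Finset.sum_add_distrib]; unfold E; simp [hU]; ring
  have htot : ∑ x : V, (3 * dg R x U - dg R x U ^ 2) ≤ 2 * n := by
    calc _ ≤ ∑ x : V, (2 : ℝ) := Finset.sum_le_sum fun x _ => hpt x
      _ = _ := by simp [n]; ring
  rw [Finset.sum_sub_distrib, ← Finset.mul_sum] at htot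
  have : ∑ x : V, dg R x U = E R U univ := hF.symm
  rw [this] at htot
  linarith

lemma ind_le4 {p a b c d : Prop} [Decidable p] [Decidable a] [Decidable b] [Decidable c]
    [Decidable d] (h : p → a ∨ b ∨ c ∨ d) : (if p then (1 : ℝ) else 0) ≤
    (if a then (1 : ℝ) else 0) + (if b then (1 : ℝ) else 0) + (if c then (1 : ℝ) else 0)
     + (if d then (1 : ℝ) else 0) := by
  have ha : (0 : ℝ) ≤ if a then (1 : ℝ) else 0 := by positivity
  have hb : (0 : ℝ) ≤ if b then (1 : ℝ) else 0 := by positivity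
  have hc : (0 : ℝ) ≤ if c then (1 : ℝ) else 0 := by positivity
  have hd : (0 : ℝ) ≤ if d then (1 : ℝ) else 0 := by positivity
  by_cases hp : p
  · rw [if_pos hp]
    rcases h hp with h | h | h | h <;> rw [if_pos h] at * <;> linarith
  · rw [if_neg hp]; linarith

lemma ind_le5 {p a b c g g' : Prop} [Decidable p] [Decidable a] [Decidable b] [Decidable c]
    [Decidable g] [Decidable g'] (h : p → a ∨ b ∨ c ∨ (g ∧ ¬ g')) (hg : g' → g) :
    (if p then (1 : ℝ) else 0) ≤
    (if a then (1 : ℝ) else 0) + (if b then (1 : ℝ) else 0) + (if c then (1 : ℝ) else 0)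
     + ((if g then (1 : ℝ) else 0) - (if g' then (1 : ℝ) else 0)) := by
  refine (ind_le4 h).trans (le_of_eq ?_)
  congr 1
  by_cases h1 : g <;> by_cases h2 : g'
  · simp [h1, h2]
  · simp [h1, h2]
  · exact absurd (hg h2) h1
  · simp [h1, h2]

lemma cleaning (δ : ℝ) (k : ℕ) (hk : 2 ≤ k * δ) (hδ : 0 < δ)
    (hn : (k : ℝ) ^ 2 < Fintype.card V) :
    ∃ (S : Finset V) (G' H : SimpleGraph V), HP G' H S ∧ G' ≤ G ∧ H ≤ Red G ∧
      E G univ univ ≤ E G' univ univ + 3 * k * Fintype.card V ∧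
      E (Red G) univ univ ≤ E H univ univ + 2 * δ * (Fintype.card V : ℝ) ^ 2
        + 3 * k * Fintype.card V := by
  set n : ℝ := (Fintype.card V : ℝ) with hndef
  set S : Finset V := univ.filter (fun v => δ * n ≤ dg (Red G) v univ) with hS
  let sh : V → V → Prop := fun v x => ∃ w ∈ S, sim G v w ∧ G.Adj w x
  obtain ⟨G', hG'⟩ : ∃ G' : SimpleGraph V, ∀ x y, G'.Adj x y ↔ G.Adj x y ∧ (x ∈ S → sh x y) ∧
      (y ∈ S → sh y x) ∧ ¬ (x ∈ S ∧ y ∈ S ∧ sim G x y) := ⟨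
    { Adj := fun x y => G.Adj x y ∧ (x ∈ S → sh x y) ∧ (y ∈ S → sh y x) ∧
        ¬ (x ∈ S ∧ y ∈ S ∧ sim G x y)
      symm := ⟨fun x y h => ⟨h.1.symm, h.2.2.1, h.2.1, fun h' => h.2.2.2
        ⟨h'.2.1, h'.1, h'.2.2.symm⟩⟩⟩
      loopless := ⟨fun x h => G.loopless.irrefl _ h.1⟩ }, fun _ _ => Iff.rfl⟩
  obtain ⟨H, hH⟩ : ∃ H : SimpleGraph V, ∀ x y, H.Adj x y ↔ (Red G).Adj x y ∧ G'.Adj x y ∧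
      x ∈ S ∧ y ∈ S := ⟨
    { Adj := fun x y => (Red G).Adj x y ∧ G'.Adj x y ∧ x ∈ S ∧ y ∈ S
      symm := ⟨fun x y h => ⟨h.1.symm, h.2.1.symm, h.2.2.2, h.2.2.1⟩⟩
      loopless := ⟨fun x h => G.loopless.irrefl _ h.1.1⟩ }, fun _ _ => Iff.rfl⟩
  have hle : ∀ {x y}, G'.Adj x y → G.Adj x y := fun h => ((hG' _ _).1 h).1
  have htri : ∀ v ∈ S, ∀ x y, G'.Adj v x → G'.Adj x y → G'.Adj y v → False := by
    intro v hv x y h1 h2 h3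
    obtain ⟨w, hw, hs, hwx⟩ := ((hG' _ _).1 h1).2.1 hv
    refine claim1 G hs (hle h3).symm hwx (hle h2) h1.ne' ?_
    rintro rfl
    exact ((hG' _ _).1 h3).2.2.2 ⟨hw, hv, hs.symm⟩
  have hHP : HP G' H S := by
    refine ⟨htri, fun u v h => ((hH _ _).1 h).2.2.1, fun u v h => ((hH _ _).1 h).2.1, ?_⟩
    intro u v h x y z h1 h2 h3 h4
    rw [hH] at h
    have hu := h.2.2.1
    have hv := h.2.2.2
    have huv := h.2.1
    refine h.1.2 ⟨z, y, x, (hle h4).symm, (hle h3).symm, (hle h2).symm, (hle h1).symm, ?_, ?_, ?_, ?_, ?_⟩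
    · rintro rfl; exact htri _ hu _ _ h1 h2 h3
    · rintro rfl; exact htri _ hu _ _ h3 h4 huv.symm
    · rintro rfl; exact htri _ hu _ _ h1 h2 huv.symm
    · rintro rfl; exact htri _ hv _ _ h2 h3 h4
    · rintro rfl; exact htri _ hu _ _ h1 h4 huv.symm
  have hSd : ∀ v ∈ S, δ * n ≤ dg (Red G) v univ := fun v hv => by
    rw [hS, Finset.mem_filter] at hv; exact hv.2
  have b1 : ∀ x : V, ((S.filter (fun v => G.Adj v x ∧ ¬ sh v x)).card : ℝ) ≤ k := by
    intro x
    exact_mod_cast pigeon (Red G) _ k δ hk hn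
      (fun v hv => hSd v (Finset.mem_filter.1 hv).1) (by
        intro v hv w hw hvw
        by_contra hc
        push Not at hc
        rw [Finset.mem_filter] at hv hw
        exact hv.2.2 ⟨w, hw.1, ⟨hvw, hc⟩, hw.2.1⟩)
  have b2 : ∀ x : V, ((S.filter (fun v => G.Adj x v ∧ sim G x v)).card : ℝ) ≤ k := by
    intro x
    exact_mod_cast pigeon (Red G) _ k δ hk hn
      (fun v hv => hSd v (Finset.mem_filter.1 hv).1) (by
        intro v hv w hw hvw
        rw [Finset.mem_filter] at hv hw
        have : (univ.filter (fun u => (Red G).Adj v u ∧ (Red G).Adj w u)) ⊆ {x} := by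
          intro u hu
          simp only [Finset.mem_filter, Finset.mem_univ, true_and] at hu
          rw [Finset.mem_singleton]
          by_contra hux
          exact claim1 G hv.2.2 hw.2.1 hu.1.1 hu.2.1.symm hux hvw.symm
        exact (Finset.card_le_card this).trans (by simp))
  have hdiff : E G univ univ ≤ E G' univ univ + 3 * k * n := by
    have hpt : ∀ x y : V, (if G.Adj x y then (1 : ℝ) else 0) ≤ (if G'.Adj x y then (1 : ℝ) else 0)
        + (if x ∈ S ∧ (G.Adj x y ∧ ¬ sh x y) then (1 : ℝ) else 0)
        + (if y ∈ S ∧ (G.Adj y x ∧ ¬ sh y x) then (1 : ℝ) else 0)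
        + (if y ∈ S ∧ (G.Adj x y ∧ sim G x y) then (1 : ℝ) else 0) := by
      intro x y
      apply ind_le4
      rw [hG', G.adj_comm y x]
      clear b1 b2 hHP htri hSd hle
      generalize sh x y = p1
      generalize sh y x = p2
      tauto
    have hk1 : ∑ x : V, ∑ y : V, (if x ∈ S ∧ (G.Adj x y ∧ ¬ sh x y) then (1 : ℝ) else 0) ≤ k * n := by
      rw [Finset.sum_comm]
      calc _ ≤ ∑ y : V, (k : ℝ) := Finset.sum_le_sum fun y _ => by
            refine le_trans (le_of_eq ?_) (b1 y)
            rw [Finset.sum_boole]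
            congr 2
            ext v; simp
        _ = _ := by simp [n]; ring
    have hk2 : ∑ x : V, ∑ y : V, (if y ∈ S ∧ (G.Adj y x ∧ ¬ sh y x) then (1 : ℝ) else 0) ≤ k * n := by
      rw [Finset.sum_comm]; exact hk1
    have hk3 : ∑ x : V, ∑ y : V, (if y ∈ S ∧ (G.Adj x y ∧ sim G x y) then (1 : ℝ) else 0)
        ≤ k * n := by
      calc _ ≤ ∑ y : V, (k : ℝ) := Finset.sum_le_sum fun x _ => by
            refine le_trans (le_of_eq ?_) (b2 x)
            rw [Finset.sum_boole]
            congr 2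
            ext v; simp
        _ = _ := by simp [n]; ring
    rw [E_eq_sum, E_eq_sum]
    have := Finset.sum_le_sum (s := univ) fun x (_ : x ∈ (univ : Finset V)) =>
      Finset.sum_le_sum (s := univ) fun y (_ : y ∈ (univ : Finset V)) => hpt x y
    simp only [Finset.sum_add_distrib] at this
    linarith
  refine ⟨S, G', H, hHP, fun x y h => hle h, fun x y h => ((hH _ _).1 h).1, hdiff, ?_⟩
  have hpt : ∀ x y : V, (if (Red G).Adj x y then (1 : ℝ) else 0) ≤ (if H.Adj x y then (1 : ℝ) else 0)
      + (if x ∉ S ∧ (Red G).Adj x y then (1 : ℝ) else 0)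
      + (if y ∉ S ∧ (Red G).Adj y x then (1 : ℝ) else 0)
      + ((if G.Adj x y then (1 : ℝ) else 0) - (if G'.Adj x y then (1 : ℝ) else 0)) := by
    intro x y
    refine ind_le5 ?_ (fun h => hle h)
    intro h0
    have := h0.1
    have := h0.symm
    rw [hH]
    clear hH hdiff b1 b2 hHP htri hSd
    tauto
  have hk1 : ∑ x : V, ∑ y : V, (if x ∉ S ∧ (Red G).Adj x y then (1 : ℝ) else 0) ≤ δ * n ^ 2 := by
    calc _ ≤ ∑ x : V, δ * n := Finset.sum_le_sum fun x _ => by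
          by_cases h : x ∈ S
          · simp only [h, not_true, false_and, if_false, Finset.sum_const_zero]; positivity
          · simp only [h, not_false_eq_true, true_and]
            rw [← dg_eq_sum]
            rw [hS, Finset.mem_filter] at h
            simp only [Finset.mem_univ, true_and, not_le] at h
            exact h.le
      _ = _ := by simp [n]; ring
  have hk2 : ∑ x : V, ∑ y : V, (if y ∉ S ∧ (Red G).Adj y x then (1 : ℝ) else 0) ≤ δ * n ^ 2 := by
    rw [Finset.sum_comm]; exact hk1
  have := Finset.sum_le_sum (s := univ) fun x (_ : x ∈ (univ : Finset V)) =>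
      Finset.sum_le_sum (s := univ) fun y (_ : y ∈ (univ : Finset V)) => hpt x y
  simp only [Finset.sum_add_distrib, Finset.sum_sub_distrib, ← E_eq_sum] at this
  linarith

end cleaning
end EC5

namespace EC5
open Finset Classical

lemma half_le {V : Type*} (K : SimpleGraph V) {S A : Finset V} (hA : A ⊆ S)
    (hi : ∀ x ∈ A, ∀ y ∈ A, ¬ K.Adj x y) : E K S S ≤ 2 * E K (S \ A) S := by
  have hd : Disjoint A (S \ A) := Finset.disjoint_sdiff
  have hX : A ∪ (S \ A) = S := Finset.union_sdiff_of_subset hA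
  have e1 := E_union_self K hd
  have e2 := E_union_right K (S \ A) hd
  rw [hX] at e1 e2
  rw [e1, e2, E_eq_zero K hi, E_comm K A]
  have := E_nonneg K (S \ A) (S \ A)
  linarith

/-- Mantel-type statement via a maximum independent set. -/
lemma TF {V : Type*} (K : SimpleGraph V) (X : Finset V)
    (htri : ∀ v ∈ X, ∀ x ∈ X, ∀ y ∈ X, K.Adj v x → K.Adj x y → K.Adj y v → False) :
    ∃ A ⊆ X, (∀ x ∈ A, ∀ y ∈ A, ¬ K.Adj x y) ∧
      (∀ I ⊆ X, (∀ x ∈ I, ∀ y ∈ I, ¬ K.Adj x y) → I.card ≤ A.card) ∧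
      E K X X ≤ 2 * A.card * (X.card - A.card) := by
  obtain ⟨A, hA, hmax⟩ := Finset.exists_max_image
    (X.powerset.filter (fun I => ∀ x ∈ I, ∀ y ∈ I, ¬ K.Adj x y)) (fun I => I.card)
    ⟨∅, by simp⟩
  simp only [Finset.mem_filter, Finset.mem_powerset] at hA hmax
  refine ⟨A, hA.1, hA.2, fun I h1 h2 => hmax I ⟨h1, h2⟩, ?_⟩
  have hdeg : ∀ x ∈ X, dg K x X ≤ A.card := by
    intro x hx
    unfold dg
    have := hmax (X.filter (fun y => K.Adj x y)) ⟨Finset.filter_subset _ _, by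
      intro y hy z hz hyz
      rw [Finset.mem_filter] at hy hz
      exact htri x hx y hy.1 z hz.1 hy.2 hyz hz.2.symm⟩
    exact_mod_cast this
  have h1 := half_le K hA.1 hA.2
  have h2 : E K (X \ A) X ≤ (X.card - A.card) * A.card := by
    calc _ ≤ ∑ x ∈ X \ A, (A.card : ℝ) :=
          Finset.sum_le_sum fun x hx => hdeg x (Finset.mem_sdiff.1 hx).1
      _ = _ := by
        rw [Finset.sum_const, nsmul_eq_mul, Finset.card_sdiff_of_subset hA.1,
          Nat.cast_sub (Finset.card_le_card hA.1)]
  nlinarith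

section lemL
variable {V : Type*} [Fintype V] {G H : SimpleGraph V} {S : Finset V}

lemma HP.mem' {V : Type*} {G H : SimpleGraph V} {S : Finset V} (hp : HP G H S) {u v : V} (h : H.Adj u v) : v ∈ S := hp.mem v u h.symm

lemma HP.E_H (hp : HP G H S) : E H univ univ = E H S S := by
  rw [E_split H S, E_eq_zero H (X := S) (Y := Sᶜ), E_eq_zero H (X := Sᶜ) (Y := Sᶜ)]
  · ring
  · intro x hx y _ h; exact (Finset.mem_compl.1 hx) (hp.mem _ _ h)
  · intro x _ y hy h; exact (Finset.mem_compl.1 hy) (hp.mem' h)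

lemma HP.H_le (hp : HP G H S) : E H univ univ ≤ (S.card : ℝ) ^ 2 / 2 := by
  rw [hp.E_H]
  obtain ⟨A, -, -, -, h⟩ := TF H S (fun v hv x _ y _ h1 h2 h3 =>
    hp.tri v hv x y (hp.le h1) (hp.le h2) (hp.le h3))
  nlinarith [sq_nonneg ((S.card : ℝ) - 2 * A.card)]

lemma lemL (hp : HP G H S) (hS : S.Nonempty) (μ ν : ℝ) (hμ : 0 ≤ μ) (hν : 0 ≤ ν) :
    ∃ v ∈ S, (dg G v S = 0 ∧ μ * E G univ univ + ν * E H univ univ ≤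
        2 * μ * (S.card * dg G v Sᶜ) + μ * E G Sᶜ Sᶜ) ∨
      ∃ y ∈ S, G.Adj v y ∧ ∃ a b : ℝ, 0 ≤ a ∧ 0 ≤ b ∧ a + b = S.card ∧
        μ * E G univ univ + ν * E H univ univ ≤
          2 * μ * (b * dg G v Sᶜ + a * b + a * dg G y Sᶜ) + μ * E G Sᶜ Sᶜ
            + (if H.Adj v y then 2 * ν * (a * b) else 0) := by
  obtain ⟨v, hv, hmax⟩ := Finset.exists_max_image S
    (fun x => μ * dg G x S + ν * dg H x S + μ * dg G x Sᶜ) hS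
  refine ⟨v, hv, ?_⟩
  set A := S.filter (fun y => G.Adj v y) with hA
  have hAS : A ⊆ S := Finset.filter_subset _ _
  have ha : dg G v S = A.card := rfl
  have iA : ∀ x ∈ A, ∀ y ∈ A, ¬ G.Adj x y := by
    intro x hx y hy hxy
    rw [hA, Finset.mem_filter] at hx hy
    exact hp.tri v hv x y hx.2 hxy hy.2.symm
  have iA' : ∀ x ∈ A, ∀ y ∈ A, ¬ H.Adj x y := fun x hx y hy h => iA x hx y hy (hp.le h)
  have h1 := half_le G hAS iA
  have h2 := half_le H hAS iA'
  set B := S \ A with hB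
  have hBc : (B.card : ℝ) = S.card - A.card := by
    rw [hB, Finset.card_sdiff_of_subset hAS, Nat.cast_sub (Finset.card_le_card hAS)]
  have hST : E G S Sᶜ = E G A Sᶜ + E G B Sᶜ := by
    rw [← E_union_left G _ Finset.disjoint_sdiff, Finset.union_sdiff_of_subset hAS]
  have h3 : μ * E G B S + ν * E H B S + μ * E G B Sᶜ ≤
      B.card * (μ * dg G v S + ν * dg H v S + μ * dg G v Sᶜ) := by
    unfold E
    rw [Finset.mul_sum, Finset.mul_sum, Finset.mul_sum, ← Finset.sum_add_distrib,
      ← Finset.sum_add_distrib]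
    calc _ ≤ ∑ x ∈ B, (μ * dg G v S + ν * dg H v S + μ * dg G v Sᶜ) :=
          Finset.sum_le_sum fun x hx => hmax x (Finset.mem_sdiff.1 hx).1
      _ = _ := by rw [Finset.sum_const, nsmul_eq_mul]
  have hmain : μ * E G univ univ + ν * E H univ univ ≤
      2 * (B.card * (μ * dg G v S + ν * dg H v S + μ * dg G v Sᶜ)) + 2 * (μ * E G A Sᶜ)
        + μ * E G Sᶜ Sᶜ := by
    rw [E_split G S, hp.E_H, hST]
    have m1 := mul_le_mul_of_nonneg_left h1 hμ
    have m2 := mul_le_mul_of_nonneg_left h2 hν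
    nlinarith
  have hh : dg H v S = ∑ y ∈ A, (if H.Adj v y then (1 : ℝ) else 0) := by
    rw [dg_eq_sum, hA, Finset.sum_filter]
    refine Finset.sum_congr rfl fun y _ => ?_
    by_cases h : H.Adj v y
    · simp [h, hp.le h]
    · simp [h]
  rcases A.eq_empty_or_nonempty with hAe | hAne
  · left
    have e0 : dg G v S = 0 := by rw [ha, hAe]; simp
    have e1 : dg H v S = 0 := by rw [hh, hAe]; simp
    have e2 : E G A Sᶜ = 0 := by rw [hAe]; simp [E]
    refine ⟨e0, ?_⟩
    rw [e0, e1, e2] at hmain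
    rw [hAe] at hBc
    simp only [Finset.card_empty, Nat.cast_zero, sub_zero] at hBc
    rw [hBc] at hmain
    nlinarith
  · right
    obtain ⟨y, hy, hym⟩ := Finset.exists_max_image A
      (fun y => ν * B.card * (if H.Adj v y then (1 : ℝ) else 0) + μ * dg G y Sᶜ) hAne
    refine ⟨y, hAS hy, (Finset.mem_filter.1 hy).2, A.card, B.card, by positivity, by positivity,
      by rw [hBc]; ring, ?_⟩
    have hs : ν * B.card * dg H v S + μ * E G A Sᶜ ≤
        A.card * (ν * B.card * (if H.Adj v y then (1 : ℝ) else 0) + μ * dg G y Sᶜ) := by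
      rw [hh]
      unfold E
      rw [Finset.mul_sum, Finset.mul_sum, ← Finset.sum_add_distrib]
      calc _ ≤ ∑ x ∈ A, (ν * B.card * (if H.Adj v y then (1 : ℝ) else 0) + μ * dg G y Sᶜ) :=
            Finset.sum_le_sum fun x hx => hym x hx
        _ = _ := by rw [Finset.sum_const, nsmul_eq_mul]
    rw [ha] at hmain
    have : (if H.Adj v y then 2 * ν * ((A.card : ℝ) * B.card) else 0) =
        2 * ν * ((A.card : ℝ) * B.card) * (if H.Adj v y then (1 : ℝ) else 0) := by
      split_ifs <;> ring
    rw [this]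
    nlinarith

/-- the neighbourhoods in the complement are independent -/
lemma HP.nbr_indep {V : Type*} {G H : SimpleGraph V} {S : Finset V} (hp : HP G H S) {v : V} (hv : v ∈ S) (Y : Finset V) :
    ∀ x ∈ Y.filter (fun y => G.Adj v y), ∀ y ∈ Y.filter (fun y => G.Adj v y), ¬ G.Adj x y := by
  intro x hx y hy h
  rw [Finset.mem_filter] at hx hy
  exact hp.tri v hv x y hx.2 h hy.2.symm

lemma HP.nbr_disj {V : Type*} {G H : SimpleGraph V} {S : Finset V} (hp : HP G H S) {v w : V} (hv : v ∈ S) (h : G.Adj v w) (Y : Finset V) :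
    Disjoint (Y.filter (fun y => G.Adj v y)) (Y.filter (fun y => G.Adj w y)) := by
  rw [Finset.disjoint_left]
  intro x hx hy
  rw [Finset.mem_filter] at hx hy
  exact hp.tri v hv w x h hy.2 hx.2.symm

lemma lemM (hp : HP G H S) (hS : S.Nonempty) :
    ∃ C₁ C₂ : Finset V, C₁ ⊆ Sᶜ ∧ C₂ ⊆ Sᶜ ∧ Disjoint C₁ C₂ ∧
      (∀ x ∈ C₁, ∀ y ∈ C₁, ¬ G.Adj x y) ∧ (∀ x ∈ C₂, ∀ y ∈ C₂, ¬ G.Adj x y) ∧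
      ∀ d : ℝ, d = (Sᶜ.card : ℝ) - C₁.card - C₂.card →
      E G univ univ ≤ (S.card + Sᶜ.card : ℝ) ^ 2 / 2 + d * (Sᶜ.card - S.card) - d ^ 2 / 2 := by
  obtain ⟨v, hv, h | h⟩ := lemL hp hS 1 0 zero_le_one le_rfl
  · refine ⟨Sᶜ.filter (fun y => G.Adj v y), ∅, Finset.filter_subset _ _, by simp, by simp,
      hp.nbr_indep hv _, by simp, ?_⟩
    rintro d rfl
    have h1 := E_triangle_free_indep G (Finset.filter_subset _ _) (hp.nbr_indep hv Sᶜ)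
    have h2 := h.2
    unfold dg at h2
    simp only [Finset.card_empty, Nat.cast_zero]
    set c : ℝ := ((Sᶜ.filter (fun y => G.Adj v y)).card : ℝ)
    nlinarith [sq_nonneg ((S.card : ℝ) - c)]
  · obtain ⟨y, hy, hvy, a, b, ha, hb, hab, h⟩ := h
    refine ⟨Sᶜ.filter (fun z => G.Adj v z), Sᶜ.filter (fun z => G.Adj y z),
      Finset.filter_subset _ _, Finset.filter_subset _ _, hp.nbr_disj hv hvy _,
      hp.nbr_indep hv _, hp.nbr_indep hy _, ?_⟩
    rintro d rfl
    have h1 := E_two_indep G (Finset.filter_subset _ _) (Finset.filter_subset _ _)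
      (hp.nbr_disj hv hvy Sᶜ) (hp.nbr_indep hv Sᶜ) (hp.nbr_indep hy Sᶜ)
    unfold dg at h
    set c : ℝ := ((Sᶜ.filter (fun z => G.Adj v z)).card : ℝ)
    set c' : ℝ := ((Sᶜ.filter (fun z => G.Adj y z)).card : ℝ)
    rw [← hab]
    simp only [one_mul, mul_one, zero_mul, mul_zero, ite_self, add_zero] at h
    nlinarith [sq_nonneg (a - b + c - c')]

lemma cor3 (hp : HP G H S) (hS : S.Nonempty)
    (h3 : ∀ u v, H.Adj u v → (∀ z ∈ Sᶜ, ¬ G.Adj u z) ∨ (∀ z ∈ Sᶜ, ¬ G.Adj v z))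
    (μ ν : ℝ) (hμ : 0 ≤ μ) (hν : 0 ≤ ν) :
    (μ * E G univ univ + ν * E H univ univ ≤ μ * ((S.card : ℝ) ^ 2 + (Sᶜ.card : ℝ) ^ 2)) ∨
    ∃ C ⊆ Sᶜ, (∀ x ∈ C, ∀ y ∈ C, ¬ G.Adj x y) ∧ ∃ a b : ℝ, 0 ≤ a ∧ 0 ≤ b ∧ a + b = S.card ∧
      μ * E G univ univ + ν * E H univ univ ≤
        2 * μ * (b * C.card + a * b) + μ * E G Sᶜ Sᶜ + 2 * ν * (a * b) := by
  obtain ⟨v, hv, h | h⟩ := lemL hp hS μ ν hμ hν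
  · left
    have h1 := E_triangle_free_indep G (Finset.filter_subset _ _) (hp.nbr_indep hv Sᶜ)
    have h2 := h.2
    unfold dg at h2
    set c : ℝ := ((Sᶜ.filter (fun y => G.Adj v y)).card : ℝ)
    refine h2.trans ?_
    have : 2 * (S.card * c) + E G Sᶜ Sᶜ ≤ (S.card : ℝ) ^ 2 + (Sᶜ.card : ℝ) ^ 2 := by
      nlinarith [sq_nonneg ((S.card : ℝ) - c)]
    nlinarith [mul_le_mul_of_nonneg_left this hμ]
  · obtain ⟨y, hy, hvy, a, b, ha, hb, hab, h⟩ := h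
    by_cases hH : H.Adj v y
    · right
      rw [if_pos hH] at h
      rcases h3 v y hH with h0 | h0
      · refine ⟨Sᶜ.filter (fun z => G.Adj y z), Finset.filter_subset _ _, hp.nbr_indep hy _,
          b, a, hb, ha, by linarith, ?_⟩
        rw [dg_eq_zero G h0] at h
        unfold dg at h
        nlinarith
      · refine ⟨Sᶜ.filter (fun z => G.Adj v z), Finset.filter_subset _ _, hp.nbr_indep hv _,
          a, b, ha, hb, by linarith, ?_⟩
        rw [dg_eq_zero G h0] at h
        unfold dg at h
        nlinarith
    · left
      rw [if_neg hH] at h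
      have h1 := E_two_indep G (Finset.filter_subset _ _) (Finset.filter_subset _ _)
        (hp.nbr_disj hv hvy Sᶜ) (hp.nbr_indep hv Sᶜ) (hp.nbr_indep hy Sᶜ)
      unfold dg at h
      set c : ℝ := ((Sᶜ.filter (fun z => G.Adj v z)).card : ℝ)
      set c' : ℝ := ((Sᶜ.filter (fun z => G.Adj y z)).card : ℝ)
      have : 2 * (b * c + a * b + a * c') + E G Sᶜ Sᶜ ≤ (S.card : ℝ) ^ 2 + (Sᶜ.card : ℝ) ^ 2 := by
        rw [← hab]
        nlinarith [sq_nonneg (b - c), sq_nonneg (a - c')]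
      nlinarith [mul_le_mul_of_nonneg_left this hμ]

end lemL
end EC5

namespace EC5
open Finset Classical

section thmA
variable {V : Type*} [Fintype V] {G H : SimpleGraph V} {S : Finset V}

lemma card_S_add : (S.card : ℝ) + (Sᶜ.card : ℝ) = Fintype.card V := by
  exact_mod_cast Finset.card_add_card_compl S

lemma pq_eq (n σ : ℝ) : √2 * (n / 2 - σ) * (σ - √2 * (n / 2 - σ)) =
    (2 - √2) / 16 * n ^ 2 - (2 + √2) * (σ - (3 - √2) / 4 * n) ^ 2 := by
  have s0 : (√2) ^ 2 = 2 := Real.sq_sqrt (by norm_num)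
  have s3 : (√2) ^ 3 = 2 * √2 := by rw [pow_succ, s0]
  ring_nf
  rw [s3, s0]
  ring

lemma core (hp : HP G H S) (hS : S.Nonempty)
    (h3 : ∀ u v, H.Adj u v → (∀ z ∈ Sᶜ, ¬ G.Adj u z) ∨ (∀ z ∈ Sᶜ, ¬ G.Adj v z))
    (n σ τ p q : ℝ) (hn : n = Fintype.card V) (hσ : σ = S.card) (hτ : τ = Sᶜ.card)
    (hpd : p = √2 * (n / 2 - σ)) (hqd : q = σ - p) (hp0 : 0 ≤ p) (hpq : p ≤ q) :
    ((q - p) * E G univ univ + p * E H univ univ + σ * p ^ 2 ≤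
        (q - p) * (n ^ 2 / 2) + 2 * p * (p * q)) ∨
    ∃ C ⊆ Sᶜ, (∀ x ∈ C, ∀ y ∈ C, ¬ G.Adj x y) ∧ ∃ b : ℝ, 0 ≤ b ∧ b ≤ σ ∧
      (q - p) * E G univ univ + p * E H univ univ + σ * (b - q) ^ 2 + (q - p) * (b - C.card) ^ 2 +
        (q - p) * (τ ^ 2 - (C.card : ℝ) ^ 2 - E G Sᶜ Sᶜ) ≤
        (q - p) * (n ^ 2 / 2) + 2 * p * (p * q) := by
  have s0 : (√2) ^ 2 = 2 := Real.sq_sqrt (by norm_num)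
  have hst : σ + τ = n := by rw [hσ, hτ, hn]; exact card_S_add
  have e1 : σ ^ 2 + τ ^ 2 = n ^ 2 / 2 + p ^ 2 := by
    rw [hpd, mul_pow, s0, ← hst]; ring
  rcases cor3 hp hS h3 (q - p) p (by linarith) hp0 with h | h
  · left
    rw [← hσ, ← hτ, e1] at h
    have : σ = p + q := by linarith
    rw [this]
    linarith
  · right
    obtain ⟨C, hC, hCi, a, b, ha, hb, hab, h⟩ := h
    refine ⟨C, hC, hCi, b, hb, by rw [hσ]; linarith, ?_⟩
    have e2 : a = σ - b := by rw [hσ]; linarith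
    have e3 : σ = p + q := by linarith
    rw [e2] at h
    refine le_trans (add_le_add_left (add_le_add_left (add_le_add_left h _) _) _) (le_of_eq ?_)
    have e4 : τ ^ 2 = n ^ 2 / 2 + p ^ 2 - σ ^ 2 := by linarith
    rw [e4, e3]
    ring

lemma thmA_h3 (hp : HP G H S)
    (h3 : ∀ u v, H.Adj u v → (∀ z ∈ Sᶜ, ¬ G.Adj u z) ∨ (∀ z ∈ Sᶜ, ¬ G.Adj v z))
    (n ζ : ℝ) (hn : n = Fintype.card V) (hn0 : 0 < n) (hζ : 0 < ζ)
    (hE : (1 / 2 + 2 * ζ) * n ^ 2 ≤ E G univ univ) :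
    E H univ univ ≤ ((2 - √2) / 8 - 0.002 * ζ) * n ^ 2 := by
  have s0 : (√2) ^ 2 = 2 := Real.sq_sqrt (by norm_num)
  have s1 : (1.4142 : ℝ) < √2 := by rw [Real.lt_sqrt] <;> norm_num
  have s2 : √2 < 1.4143 := by rw [Real.sqrt_lt'] <;> norm_num
  have hζ1 : ζ ≤ 1 / 4 := by
    have := E_le G univ univ
    rw [Finset.card_univ, ← hn] at this
    by_contra hc
    push Not at hc
    nlinarith [mul_pos hn0 hn0]
  obtain ⟨σ, hσ⟩ : ∃ σ : ℝ, σ = S.card := ⟨_, rfl⟩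
  obtain ⟨τ, hτ⟩ : ∃ τ : ℝ, τ = Sᶜ.card := ⟨_, rfl⟩
  have hst : σ + τ = n := by rw [hσ, hτ, hn]; exact card_S_add
  have hσ0 : 0 ≤ σ := by rw [hσ]; positivity
  rcases le_or_gt σ (0.38 * n) with hlow | hlow
  · have h1 := hp.H_le
    rw [← hσ] at h1
    nlinarith [mul_pos hn0 hn0]
  have hS : S.Nonempty := by
    rw [← Finset.card_pos]
    have : (0 : ℝ) < S.card := by rw [← hσ]; nlinarith
    exact_mod_cast this
  rcases le_or_gt (n / 2) σ with hhi | hhi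
  · exfalso
    obtain ⟨C₁, C₂, k1, k2, k3, -, -, h⟩ := lemM hp hS
    have := h _ rfl
    rw [← hσ, ← hτ, hst] at this
    have hd : 0 ≤ τ - C₁.card - C₂.card := by
      have : (C₁ ∪ C₂).card ≤ Sᶜ.card := Finset.card_le_card (Finset.union_subset k1 k2)
      rw [Finset.card_union_of_disjoint k3] at this
      have : (C₁.card : ℝ) + C₂.card ≤ Sᶜ.card := by exact_mod_cast this
      rw [hτ]; linarith
    have h5 : (τ - C₁.card - C₂.card) * (τ - σ) ≤ 0 :=
      mul_nonpos_of_nonneg_of_nonpos hd (by linarith)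
    have h6 : 0 < 2 * ζ * n ^ 2 := by positivity
    nlinarith [sq_nonneg (τ - C₁.card - C₂.card)]
  obtain ⟨p, hpd⟩ : ∃ p : ℝ, p = √2 * (n / 2 - σ) := ⟨_, rfl⟩
  obtain ⟨q, hqd⟩ : ∃ q : ℝ, q = σ - p := ⟨_, rfl⟩
  have hp0 : 0 < p := by rw [hpd]; apply mul_pos <;> linarith
  have hpu : p ≤ 1.4143 * (n / 2 - σ) := by
    rw [hpd]; apply mul_le_mul_of_nonneg_right s2.le; linarith
  have hqp : 0.001 * p ≤ q - p := by linarith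
  have hpqe : p * q = (2 - √2) / 16 * n ^ 2 - (2 + √2) * (σ - (3 - √2) / 4 * n) ^ 2 := by
    rw [hqd, hpd]; exact pq_eq n σ
  have hpql : p * q ≤ (2 - √2) / 16 * n ^ 2 := by
    rw [hpqe]
    have : 0 ≤ (2 + √2) * (σ - (3 - √2) / 4 * n) ^ 2 := by positivity
    linarith
  have main : (q - p) * E G univ univ + p * E H univ univ ≤
        (q - p) * (n ^ 2 / 2) + 2 * p * (p * q) := by
    rcases core hp hS h3 n σ τ p q hn hσ hτ hpd hqd hp0.le (by linarith) with h | h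
    · have : 0 ≤ σ * p ^ 2 := by positivity
      linarith
    · obtain ⟨C, hC, hCi, b, hb, hbσ, h⟩ := h
      have t1 : 0 ≤ σ * (b - q) ^ 2 := by positivity
      have hqp0 : 0 ≤ q - p := by linarith
      have t2 : 0 ≤ (q - p) * (b - C.card) ^ 2 := by positivity
      have := E_triangle_free_indep G hC hCi
      rw [← hτ] at this
      have t3 : 0 ≤ (q - p) * (τ ^ 2 - (C.card : ℝ) ^ 2 - E G Sᶜ Sᶜ) :=
        mul_nonneg hqp0 (by linarith)
      linarith
  have hqp0 : 0 ≤ q - p := by linarith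
  have m1 := mul_le_mul_of_nonneg_left hE hqp0
  have m2 : 0.001 * p * (2 * ζ * n ^ 2) ≤ (q - p) * (2 * ζ * n ^ 2) :=
    mul_le_mul_of_nonneg_right hqp (by positivity)
  have m3 : p * E H univ univ ≤ p * (2 * (p * q) - 0.002 * ζ * n ^ 2) := by
    nlinarith
  have m4 := le_of_mul_le_mul_left m3 hp0
  linarith

/-- cloning -/
lemma clone_E (G : SimpleGraph V) (L : Finset V) (w : V) :
    E G univ univ + 2 * ∑ z ∈ L, (dg G w univ - L.card - dg G z univ) ≤
      E (G.comap (fun x => if x ∈ L then w else x)) univ univ := by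
  set G' := G.comap (fun x => if x ∈ L then w else x) with hG'
  have e1 := E_split G L
  have e2 := E_split G' L
  have e3 : E G' Lᶜ Lᶜ = E G Lᶜ Lᶜ := by
    rw [E_eq_sum, E_eq_sum]
    refine Finset.sum_congr rfl fun x hx => Finset.sum_congr rfl fun y hy => ?_
    rw [Finset.mem_compl] at hx hy
    simp [hG', hx, hy]
  have e4 : E G' L Lᶜ = L.card * dg G w Lᶜ := by
    rw [E_eq_sum, dg_eq_sum]
    calc _ = ∑ x ∈ L, ∑ y ∈ Lᶜ, (if G.Adj w y then (1 : ℝ) else 0) := by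
          refine Finset.sum_congr rfl fun x hx => Finset.sum_congr rfl fun y hy => ?_
          rw [Finset.mem_compl] at hy
          simp [hG', hx, hy]
      _ = _ := by rw [Finset.sum_const, nsmul_eq_mul]
  have e5 : dg G w univ = dg G w L + dg G w Lᶜ := by
    rw [← dg_union G w disjoint_compl_right, Finset.union_compl]
  have e6 := dg_le_card G w L
  have e7 : E G L univ = E G L L + E G L Lᶜ := E_compl_right G L L
  have e8 : ∑ z ∈ L, (dg G w univ - L.card - dg G z univ) =
      L.card * (dg G w univ - L.card) - E G L univ := by
    rw [Finset.sum_sub_distrib, Finset.sum_const, nsmul_eq_mul]; rfl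
  rw [e8, e1, e2, e3, e4, e7]
  have e9 := E_nonneg G L L
  have e10 := E_nonneg G' L L
  have e11 : (L.card : ℝ) * (dg G w univ - L.card) ≤ L.card * dg G w Lᶜ :=
    mul_le_mul_of_nonneg_left (by linarith) (by positivity)
  linarith

lemma HP.comap {V : Type*} {G H : SimpleGraph V} {S : Finset V} (hp : HP G H S) (φ : V → V)
    (hφ : ∀ x ∈ S, φ x = x) : HP (G.comap φ) H S := by
  refine ⟨?_, hp.mem, ?_, ?_⟩
  · intro v hv x y h1 h2 h3
    simp only [comap_adj, hφ v hv] at h1 h2 h3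
    exact hp.tri v hv _ _ h1 h2 h3
  · intro u v h
    simp only [comap_adj, hφ u (hp.mem _ _ h), hφ v (hp.mem' h)]
    exact hp.le h
  · intro u v h x y z h1 h2 h3 h4
    simp only [comap_adj, hφ u (hp.mem _ _ h), hφ v (hp.mem' h)] at h1 h2 h3 h4
    exact hp.walk u v h _ _ _ h1 h2 h3 h4

lemma common_nbr (G : SimpleGraph V) (z w : V)
    (h : (Fintype.card V : ℝ) < dg G z univ + dg G w univ) : ∃ y, G.Adj z y ∧ G.Adj w y := by
  by_contra hc
  push Not at hc
  have hd : Disjoint (univ.filter (fun y => G.Adj z y)) (univ.filter (fun y => G.Adj w y)) := by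
    rw [Finset.disjoint_left]
    intro y h1 h2
    rw [Finset.mem_filter] at h1 h2
    exact hc y h1.2 h2.2
  have h1 := Finset.card_le_univ ((univ.filter (fun y => G.Adj z y)) ∪
    (univ.filter (fun y => G.Adj w y)))
  rw [Finset.card_union_of_disjoint hd] at h1
  unfold dg at h
  have h2 : ((univ.filter (fun y => G.Adj z y)).card : ℝ) + (univ.filter (fun y => G.Adj w y)).card
    ≤ Fintype.card V := by exact_mod_cast h1
  linarith

lemma HP.h3_of_deg (hp : HP G H S)
    {u v z w : V} (h : H.Adj u v) (h1 : G.Adj u z) (h2 : G.Adj v w)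
    (hz : (Fintype.card V : ℝ) / 2 < dg G z univ) (hw : (Fintype.card V : ℝ) / 2 < dg G w univ) :
    False := by
  obtain ⟨y, hy1, hy2⟩ := common_nbr G z w (by linarith)
  exact hp.walk u v h _ _ _ h1 hy1 hy2.symm h2.symm

lemma exists_deg (G : SimpleGraph V) (c : ℝ) (hn0 : 0 < Fintype.card V)
    (hE : c * (Fintype.card V : ℝ) ^ 2 ≤ E G univ univ) :
    ∃ w, c * Fintype.card V ≤ dg G w univ := by
  by_contra hc
  push Not at hc
  have hne : (univ : Finset V).Nonempty := by
    rw [← Finset.card_pos, Finset.card_univ]; exact hn0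
  have : E G univ univ < ∑ x : V, c * (Fintype.card V : ℝ) :=
    Finset.sum_lt_sum_of_nonempty hne fun x _ => hc x
  rw [Finset.sum_const, nsmul_eq_mul, Finset.card_univ] at this
  nlinarith

lemma thmA (hp : HP G H S) (n ζ : ℝ) (hn : n = Fintype.card V) (hn0 : 0 < n) (hζ : 0 < ζ)
    (hnζ : 1 < 2 * ζ * n) (hE : (1 / 2 + 2 * ζ) * n ^ 2 ≤ E G univ univ) :
    E H univ univ ≤ ((2 - √2) / 8 - 0.002 * ζ) * n ^ 2 := by
  obtain ⟨φ, hφ, hmax⟩ := Finset.exists_max_image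
    ((univ : Finset (V → V)).filter (fun φ => ∀ x ∈ S, φ x = x))
    (fun φ => E (G.comap φ) univ univ) ⟨id, by simp⟩
  simp only [Finset.mem_filter, Finset.mem_univ, true_and] at hφ hmax
  set G₁ := G.comap φ with hG₁
  have hp₁ := hp.comap φ hφ
  have hE₁ : (1 / 2 + 2 * ζ) * n ^ 2 ≤ E G₁ univ univ := by
    refine hE.trans ?_
    have := hmax id (by simp)
    rwa [show G.comap id = G from SimpleGraph.comap_id] at this
  obtain ⟨w, hw⟩ := exists_deg G₁ (1 / 2 + 2 * ζ) (by rw [hn] at hn0; exact_mod_cast hn0)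
    (by rw [← hn]; exact hE₁)
  rw [← hn] at hw
  have hdeg : ∀ z ∈ Sᶜ, n / 2 < dg G₁ z univ := by
    intro z hz
    rw [Finset.mem_compl] at hz
    have h1 := clone_E G₁ {z} w
    have h2 := hmax (φ ∘ (fun x => if x ∈ ({z} : Finset V) then w else x)) (by
      intro x hx
      have : x ≠ z := by rintro rfl; exact hz hx
      simp [this, hφ x hx])
    rw [← SimpleGraph.comap_comap] at h2
    simp only [Finset.sum_singleton, Finset.card_singleton, Nat.cast_one] at h1
    rw [← hG₁] at h2
    nlinarith
  refine thmA_h3 hp₁ ?_ n ζ hn hn0 hζ hE₁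
  intro u v h
  by_contra hc
  push Not at hc
  obtain ⟨⟨z, hz, hz'⟩, ⟨y, hy, hy'⟩⟩ := hc
  exact hp₁.h3_of_deg h hz' hy' (by rw [← hn]; exact hdeg z hz) (by rw [← hn]; exact hdeg y hy)

end thmA
end EC5

namespace EC5
open Finset Classical

section tools
variable {V : Type*}

lemma card_nonadj (G : SimpleGraph V) (x : V) (Y : Finset V) :
    ((Y.filter (fun y => ¬ G.Adj x y)).card : ℝ) = Y.card - dg G x Y := by
  have := Finset.card_filter_add_card_filter_not (s := Y) (fun y => G.Adj x y)
  unfold dg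
  rw [← this]; push_cast; ring

lemma exists_one (G : SimpleGraph V) (x : V) (Y F : Finset V) (h : (F.card : ℝ) < dg G x Y) :
    ∃ w ∈ Y, w ∉ F ∧ G.Adj x w := by
  unfold dg at h
  obtain ⟨w, hw, hw'⟩ := Finset.exists_mem_notMem_of_card_lt_card (by exact_mod_cast h)
  rw [Finset.mem_filter] at hw
  exact ⟨w, hw.1, hw', hw.2⟩

lemma exists_common (G : SimpleGraph V) (x y : V) (Y F : Finset V)
    (h : (Y.card : ℝ) + F.card < dg G x Y + dg G y Y) :
    ∃ w ∈ Y, w ∉ F ∧ G.Adj x w ∧ G.Adj y w := by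
  have h1 := card_nonadj G x Y
  have h2 : (((Y.filter (fun w => ¬ G.Adj x w)) ∪ F).card : ℝ) <
      ((Y.filter (fun w => G.Adj y w)).card : ℝ) := by
    have : (((Y.filter (fun w => ¬ G.Adj x w)) ∪ F).card : ℝ) ≤
      (Y.filter (fun w => ¬ G.Adj x w)).card + F.card := by
      exact_mod_cast Finset.card_union_le _ _
    unfold dg at h h1
    linarith
  obtain ⟨w, hw, hw'⟩ := Finset.exists_mem_notMem_of_card_lt_card (by exact_mod_cast h2)
  simp only [Finset.mem_filter, Finset.mem_union, not_or, not_and, not_not] at hw hw'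
  exact ⟨w, hw.1, hw'.2, hw'.1 hw.1, hw.2⟩

lemma card_pair_le (x y : V) : (({x, y} : Finset V).card : ℝ) ≤ 2 := by
  exact_mod_cast Finset.card_le_two

lemma card_triple_le (x y z : V) : (({x, y, z} : Finset V).card : ℝ) ≤ 3 := by
  exact_mod_cast Finset.card_le_three

end tools

section nb
variable {V : Type*} [Fintype V]

/-- an almost complete almost balanced bipartite typical pair -/
structure BT (G : SimpleGraph V) (P Q : Finset V) (n : ℝ) : Prop where
  disj : Disjoint P Q
  cP : 0.49 * n ≤ P.card
  cQ : 0.49 * n ≤ Q.card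
  cP' : (P.card : ℝ) ≤ 0.502 * n
  cQ' : (Q.card : ℝ) ≤ 0.502 * n
  cov : n - P.card - Q.card ≤ 0.001 * n
  dP : ∀ p ∈ P, (Q.card : ℝ) - 0.01 * n ≤ dg G p Q
  dQ : ∀ q ∈ Q, (P.card : ℝ) - 0.01 * n ≤ dg G q P

variable {G : SimpleGraph V} {P Q : Finset V} {n : ℝ}

lemma BT.symm (h : BT G P Q n) : BT G Q P n :=
  ⟨h.disj.symm, h.cQ, h.cP, h.cQ', h.cP', by linarith [h.cov], h.dQ, h.dP⟩

lemma BT.inner (h : BT G P Q n) (hn : 100000 ≤ n) : E (Red G) P P = 0 := by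
  apply E_eq_zero
  intro x hx y hy hr
  obtain ⟨q, hq, hqF, hyq⟩ := exists_one G y Q {x} (by
    have := h.dP y hy; have := h.cQ; simp; linarith)
  obtain ⟨q', hq', hqF', hxq'⟩ := exists_one G x Q {y, q} (by
    have := h.dP x hx; have := h.cQ; have := card_pair_le y q; linarith)
  obtain ⟨p, hp, hpF, hp1, hp2⟩ := exists_common G q q' P {x, y} (by
    have := h.dQ q hq; have := h.dQ q' hq'; have := h.cP; have := card_pair_le x y; linarith)
  simp only [Finset.mem_insert, Finset.mem_singleton, not_or] at hqF hqF' hpF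
  exact hr.2 ⟨q, p, q', hyq, hp1, hp2.symm, hxq'.symm, hqF, hpF.1, hpF.2, hqF'.1,
    Ne.symm hqF'.2⟩

lemma BT.red_le (h : BT G P Q n) (hN : n = Fintype.card V) (hn : 100000 ≤ n) :
    E (Red G) univ univ ≤ 2 * E (Red G) P Q + 0.002 * n ^ 2 := by
  rw [E_split (Red G) (P ∪ Q), E_union_self _ h.disj, h.inner hn, h.symm.inner hn]
  have hX : ((P ∪ Q).card : ℝ) = P.card + Q.card := by
    rw [Finset.card_union_of_disjoint h.disj]; push_cast; ring
  have hZ : (((P ∪ Q)ᶜ).card : ℝ) = n - P.card - Q.card := by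
    have := card_S_add (S := P ∪ Q)
    rw [hN]; linarith
  have h1 := E_le (Red G) (P ∪ Q) (P ∪ Q)ᶜ
  have h2 := E_le (Red G) (P ∪ Q)ᶜ (P ∪ Q)ᶜ
  have hc := h.cov
  have h0 : (0 : ℝ) ≤ (((P ∪ Q)ᶜ).card : ℝ) := by positivity
  have h00 : (0 : ℝ) ≤ (((P ∪ Q)).card : ℝ) := by positivity
  set z := (((P ∪ Q)ᶜ).card : ℝ)
  have hx : ((P ∪ Q).card : ℝ) = n - z := by rw [hZ, hX]; ring
  rw [hx] at h1
  have : n * z ≤ n * (0.001 * n) := mul_le_mul_of_nonneg_left (by linarith) (by linarith)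
  nlinarith

lemma BT.claimA (h : BT G P Q n) (hN : n = Fintype.card V) (hn : 100000 ≤ n)
    (hR : 0.06 * n ^ 2 ≤ E (Red G) univ univ) {z p q : V} (hp : p ∈ P) (hq : q ∈ Q)
    (h1 : G.Adj z p) (h2 : G.Adj z q) : False := by
  set bad := P.filter (fun x => ¬ G.Adj q x) ∪ {z, p} with hbad
  have hbc : (bad.card : ℝ) ≤ 0.01 * n + 2 := by
    have e1 : (bad.card : ℝ) ≤ (P.filter (fun x => ¬ G.Adj q x)).card + ({z, p} : Finset V).card := by
      exact_mod_cast Finset.card_union_le _ _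
    rw [card_nonadj] at e1
    have := h.dQ q hq
    have := card_pair_le z p
    linarith
  have hpt : ∀ x ∈ P, dg (Red G) x Q ≤ (0.01 * n + 2) + (if x ∈ bad then (Q.card : ℝ) else 0) := by
    intro x hx
    by_cases hb : x ∈ bad
    · rw [if_pos hb]
      have := dg_le_card (Red G) x Q
      linarith
    · rw [if_neg hb, add_zero]
      simp only [hbad, Finset.mem_union, Finset.mem_filter, Finset.mem_insert,
        Finset.mem_singleton, not_or, not_and, not_not] at hb
      have hqx := hb.1 hx
      have hsub : Q.filter (fun y => (Red G).Adj x y) ⊆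
          Q.filter (fun y => ¬ G.Adj p y) ∪ {z, q} := by
        intro y hy
        rw [Finset.mem_filter] at hy
        simp only [Finset.mem_union, Finset.mem_filter, Finset.mem_insert, Finset.mem_singleton]
        by_contra hc
        simp only [not_or, not_and, not_not] at hc
        have hpy := hc.1 hy.1
        -- cycle x y p z q
        refine hy.2.2 ⟨p, z, q, hpy.symm, h1.symm, h2, hqx, ?_, ?_, ?_, ?_, ?_⟩
        · exact Ne.symm hb.2.2
        · exact Ne.symm hb.2.1
        · exact Ne.symm hc.2.1
        · exact Ne.symm hc.2.2
        · rintro rfl; exact Finset.disjoint_left.1 h.disj hp hq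
      have e1 : ((Q.filter (fun y => (Red G).Adj x y)).card : ℝ) ≤
          (Q.filter (fun y => ¬ G.Adj p y)).card + ({z, q} : Finset V).card := by
        exact_mod_cast (Finset.card_le_card hsub).trans (Finset.card_union_le _ _)
      rw [card_nonadj] at e1
      have := h.dP p hp
      have := card_pair_le z q
      unfold dg at *
      linarith
  have hsum : E (Red G) P Q ≤ P.card * (0.01 * n + 2) + (0.01 * n + 2) * Q.card := by
    calc E (Red G) P Q ≤ ∑ x ∈ P, ((0.01 * n + 2) + (if x ∈ bad then (Q.card : ℝ) else 0)) :=
          Finset.sum_le_sum hpt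
      _ = P.card * (0.01 * n + 2) + (P.filter (fun x => x ∈ bad)).card * Q.card := by
          rw [Finset.sum_add_distrib, Finset.sum_const, nsmul_eq_mul, ← Finset.sum_filter,
            Finset.sum_const, nsmul_eq_mul]
      _ ≤ _ := by
          have : ((P.filter (fun x => x ∈ bad)).card : ℝ) ≤ bad.card := by
            exact_mod_cast Finset.card_le_card (by intro x hx; exact (Finset.mem_filter.1 hx).2)
          have : ((P.filter (fun x => x ∈ bad)).card : ℝ) * Q.card ≤ (0.01 * n + 2) * Q.card :=
            mul_le_mul_of_nonneg_right (by linarith) (by positivity)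
          linarith
  have := h.red_le hN hn
  have := h.cP'
  have := h.cQ'
  nlinarith

lemma BT.claimB (h : BT G P Q n) (hN : n = Fintype.card V) (hn : 100000 ≤ n)
    (hR : 0.06 * n ^ 2 ≤ E (Red G) univ univ) {z z' : V} (hz : z ∉ P) (hz' : z' ∉ P)
    (hzQ : z ∉ Q) (hzQ' : z' ∉ Q)
    (hzz : G.Adj z z') (h1 : 0.48 * n < dg G z Q) (h2 : 0.48 * n < dg G z' Q) : False := by
  have hpt : ∀ x ∈ P, dg (Red G) x Q ≤ Q.card - 0.48 * n := by
    intro x hx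
    have hsub : Q.filter (fun y => (Red G).Adj x y) ⊆ Q.filter (fun y => ¬ G.Adj z y) := by
      intro y hy
      rw [Finset.mem_filter] at hy ⊢
      refine ⟨hy.1, fun hzy => ?_⟩
      obtain ⟨w, hw, hwF, hxw, hzw⟩ := exists_common G x z' Q {y} (by
        have := h.dP x hx; simp; linarith)
      rw [Finset.mem_singleton] at hwF
      -- cycle x y z z' w
      refine hy.2.2 ⟨z, z', w, hzy.symm, hzz, hzw, hxw.symm, ?_, ?_, ?_, hwF, ?_⟩
      · rintro rfl; exact hz hx
      · rintro rfl; exact hz' hx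
      · rintro rfl; exact hzQ' hy.1
      · rintro rfl; exact hzQ hw
    have e1 : ((Q.filter (fun y => (Red G).Adj x y)).card : ℝ) ≤
        (Q.filter (fun y => ¬ G.Adj z y)).card := by
      exact_mod_cast Finset.card_le_card hsub
    rw [card_nonadj] at e1
    unfold dg at *
    linarith
  have hsum : E (Red G) P Q ≤ P.card * (Q.card - 0.48 * n) := by
    calc E (Red G) P Q ≤ ∑ x ∈ P, (Q.card - 0.48 * n : ℝ) := Finset.sum_le_sum hpt
      _ = _ := by rw [Finset.sum_const, nsmul_eq_mul]
  have h3 := h.red_le hN hn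
  have h4 := h.cP'
  have h5 := h.cQ'
  have : (P.card : ℝ) * (Q.card - 0.48 * n) ≤ P.card * (0.022 * n) :=
    mul_le_mul_of_nonneg_left (by linarith) (by positivity)
  nlinarith

/-- inner edges are few -/
lemma inner_le {X L : Finset V} (hL : L ⊆ X) (Z : ℝ) (hZ0 : 0 ≤ Z)
    (h : ∀ x ∈ X, ∀ y ∈ X, G.Adj x y → x ∈ L ∨ y ∈ L)
    (hd : ∀ x ∈ L, dg G x X ≤ Z) : E G X X ≤ 2 * (L.card * Z) := by
  have h1 : E G (X \ L) (X \ L) = 0 := E_eq_zero G (by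
    intro x hx y hy hxy
    rw [Finset.mem_sdiff] at hx hy
    rcases h x hx.1 y hy.1 hxy with h | h
    · exact hx.2 h
    · exact hy.2 h)
  have e0 := E_union_self G (Finset.disjoint_sdiff (s := L) (t := X))
  have e1 := E_union_right G L (Finset.disjoint_sdiff (s := L) (t := X))
  rw [Finset.union_sdiff_of_subset hL] at e0 e1
  have e2 : E G L X ≤ L.card * Z := by
    calc E G L X ≤ ∑ x ∈ L, Z := Finset.sum_le_sum hd
      _ = _ := by rw [Finset.sum_const, nsmul_eq_mul]
  have := E_nonneg G L L
  linarith

set_option maxHeartbeats 1000000 in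
lemma BT.contra (h : BT G P Q n) (hN : n = Fintype.card V) (hn : 100000 ≤ n)
    (hE : n ^ 2 / 2 < E G univ univ)
    (hR : 0.06 * n ^ 2 ≤ E (Red G) univ univ) : False := by
  have hnbr : ∀ p ∈ P, ∃ q ∈ Q, G.Adj p q := by
    intro p hp
    obtain ⟨q, hq, -, h1⟩ := exists_one G p Q ∅ (by
      have := h.dP p hp; have := h.cQ; simp; linarith)
    exact ⟨q, hq, h1⟩
  have hnbr' : ∀ q ∈ Q, ∃ p ∈ P, G.Adj q p := by
    intro p hp
    obtain ⟨q, hq, -, h1⟩ := exists_one G p P ∅ (by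
      have := h.dQ p hp; have := h.cP; simp; linarith)
    exact ⟨q, hq, h1⟩
  set X := univ.filter (fun x => ∀ p ∈ P, ¬ G.Adj x p) with hX
  have hXQ : ∀ x ∈ Xᶜ, ∀ q ∈ Q, ¬ G.Adj x q := by
    intro x hx q hq hxq
    simp only [hX, Finset.mem_compl, Finset.mem_filter, Finset.mem_univ, true_and] at hx
    push Not at hx
    obtain ⟨p, hp, hxp⟩ := hx
    exact h.claimA hN hn hR hp hq hxp hxq
  have hXP : ∀ x ∈ X, ∀ p ∈ P, ¬ G.Adj x p := by
    intro x hx; simpa [hX] using hx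
  have hPX : P ⊆ X := by
    intro p hp
    by_contra hc
    obtain ⟨q, hq, hpq⟩ := hnbr p hp
    exact hXQ p (Finset.mem_compl.2 hc) q hq hpq
  have hQX : Q ⊆ Xᶜ := by
    intro q hq
    rw [Finset.mem_compl]
    intro hc
    obtain ⟨p, hp, hqp⟩ := hnbr' q hq
    exact hXP q hc p hp hqp
  have hXc : (X.card : ℝ) + (Xᶜ.card : ℝ) = n := by rw [hN]; exact card_S_add
  have cPX : (P.card : ℝ) ≤ X.card := by exact_mod_cast Finset.card_le_card hPX
  have cQX : (Q.card : ℝ) ≤ Xᶜ.card := by exact_mod_cast Finset.card_le_card hQX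
  have hcov := h.cov
  have zX : ((X \ P).card : ℝ) = X.card - P.card := by
    rw [Finset.card_sdiff_of_subset hPX, Nat.cast_sub (Finset.card_le_card hPX)]
  have zY : ((Xᶜ \ Q).card : ℝ) = Xᶜ.card - Q.card := by
    rw [Finset.card_sdiff_of_subset hQX, Nat.cast_sub (Finset.card_le_card hQX)]
  set L₁ := (X \ P).filter (fun x => dg G x Q ≤ 0.48 * n) with hL₁
  set L₂ := (Xᶜ \ Q).filter (fun x => dg G x P ≤ 0.48 * n) with hL₂
  have sL₁ : L₁ ⊆ X := (Finset.filter_subset _ _).trans Finset.sdiff_subset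
  have sL₂ : L₂ ⊆ Xᶜ := (Finset.filter_subset _ _).trans Finset.sdiff_subset
  have dX : ∀ x ∈ X, dg G x X ≤ 0.001 * n := by
    intro x hx
    have : dg G x X = dg G x P + dg G x (X \ P) := by
      rw [← dg_union G x Finset.disjoint_sdiff, Finset.union_sdiff_of_subset hPX]
    rw [this, dg_eq_zero G (hXP x hx)]
    have := dg_le_card G x (X \ P)
    linarith
  have dY : ∀ x ∈ Xᶜ, dg G x Xᶜ ≤ 0.001 * n := by
    intro x hx
    have : dg G x Xᶜ = dg G x Q + dg G x (Xᶜ \ Q) := by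
      rw [← dg_union G x Finset.disjoint_sdiff, Finset.union_sdiff_of_subset hQX]
    rw [this, dg_eq_zero G (hXQ x hx)]
    have := dg_le_card G x (Xᶜ \ Q)
    linarith
  have i1 := inner_le (G := G) sL₁ (0.001 * n) (by linarith) (by
    intro x hx y hy hxy
    have hxP : x ∉ P := fun hc => hXP y hy x hc hxy.symm
    have hyP : y ∉ P := fun hc => hXP x hx y hc hxy
    have hxQ : x ∉ Q := fun hc => (Finset.mem_compl.1 (hQX hc)) hx
    have hyQ : y ∉ Q := fun hc => (Finset.mem_compl.1 (hQX hc)) hy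
    by_contra hc
    simp only [hL₁, Finset.mem_filter, Finset.mem_sdiff, not_or, not_and, not_le] at hc
    exact h.claimB hN hn hR hxP hyP hxQ hyQ hxy (hc.1 ⟨hx, hxP⟩) (hc.2 ⟨hy, hyP⟩))
    (fun x hx => dX x (sL₁ hx))
  have i2 := inner_le (G := G) sL₂ (0.001 * n) (by linarith) (by
    intro x hx y hy hxy
    have hxP : x ∉ Q := fun hc => hXQ y hy x hc hxy.symm
    have hyP : y ∉ Q := fun hc => hXQ x hx y hc hxy
    have hxQ : x ∉ P := fun hc => (Finset.mem_compl.1 hx) (hPX hc)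
    have hyQ : y ∉ P := fun hc => (Finset.mem_compl.1 hy) (hPX hc)
    by_contra hc
    simp only [hL₂, Finset.mem_filter, Finset.mem_sdiff, not_or, not_and, not_le] at hc
    exact h.symm.claimB hN hn hR hxP hyP hxQ hyQ hxy (hc.1 ⟨hx, hxP⟩) (hc.2 ⟨hy, hyP⟩))
    (fun x hx => dY x (sL₂ hx))
  have d1 : ∀ x ∈ L₁, dg G x Xᶜ ≤ 0.481 * n := by
    intro x hx
    have : dg G x Xᶜ = dg G x Q + dg G x (Xᶜ \ Q) := by
      rw [← dg_union G x Finset.disjoint_sdiff, Finset.union_sdiff_of_subset hQX]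
    have h1 := dg_le_card G x (Xᶜ \ Q)
    have h2 := (Finset.mem_filter.1 hx).2
    linarith
  have d2 : ∀ x ∈ L₂, dg G x X ≤ 0.481 * n := by
    intro x hx
    have : dg G x X = dg G x P + dg G x (X \ P) := by
      rw [← dg_union G x Finset.disjoint_sdiff, Finset.union_sdiff_of_subset hPX]
    have h1 := dg_le_card G x (X \ P)
    have h2 := (Finset.mem_filter.1 hx).2
    linarith
  have c1 : (L₁.card : ℝ) ≤ 0.001 * n := by
    have : (L₁.card : ℝ) ≤ (X \ P).card := by exact_mod_cast Finset.card_filter_le _ _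
    linarith
  have c2 : (L₂.card : ℝ) ≤ 0.001 * n := by
    have : (L₂.card : ℝ) ≤ (Xᶜ \ Q).card := by exact_mod_cast Finset.card_filter_le _ _
    linarith
  have s1 : E G X Xᶜ = E G L₁ Xᶜ + E G (X \ L₁) Xᶜ := by
    rw [← E_union_left G _ Finset.disjoint_sdiff, Finset.union_sdiff_of_subset sL₁]
  have s2 : E G (X \ L₁) Xᶜ = E G (X \ L₁) L₂ + E G (X \ L₁) (Xᶜ \ L₂) := by
    rw [← E_union_right G _ Finset.disjoint_sdiff, Finset.union_sdiff_of_subset sL₂]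
  have b1 : E G L₁ Xᶜ ≤ L₁.card * (0.481 * n) := by
    calc E G L₁ Xᶜ ≤ ∑ x ∈ L₁, (0.481 * n) := Finset.sum_le_sum d1
      _ = _ := by rw [Finset.sum_const, nsmul_eq_mul]
  have b2 : E G (X \ L₁) L₂ ≤ L₂.card * (0.481 * n) := by
    rw [E_comm]
    refine (E_subset_right G L₂ Finset.sdiff_subset).trans ?_
    calc E G L₂ X ≤ ∑ x ∈ L₂, (0.481 * n) := Finset.sum_le_sum d2
      _ = _ := by rw [Finset.sum_const, nsmul_eq_mul]
  have b3 := E_le G (X \ L₁) (Xᶜ \ L₂)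
  rw [Finset.card_sdiff_of_subset sL₁, Finset.card_sdiff_of_subset sL₂,
    Nat.cast_sub (Finset.card_le_card sL₁), Nat.cast_sub (Finset.card_le_card sL₂)] at b3
  have l1 : (0 : ℝ) ≤ L₁.card := by positivity
  have l2 : (0 : ℝ) ≤ L₂.card := by positivity
  have hs := E_split G X
  have hcP := h.cP
  have hcQ := h.cQ
  have f1 : (L₁.card : ℝ) * (0.49 * n) ≤ L₁.card * Xᶜ.card :=
    mul_le_mul_of_nonneg_left (by linarith) l1
  have f2 : (L₂.card : ℝ) * (0.49 * n) ≤ L₂.card * X.card :=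
    mul_le_mul_of_nonneg_left (by linarith) l2
  have f3 : (L₁.card : ℝ) * L₂.card ≤ L₁.card * (0.001 * n) :=
    mul_le_mul_of_nonneg_left (by linarith) l1
  have f4 : (X.card : ℝ) * Xᶜ.card ≤ n ^ 2 / 4 := by
    rw [← hXc]; nlinarith [sq_nonneg ((X.card : ℝ) - Xᶜ.card)]
  have f5 : 0 ≤ (L₁.card : ℝ) * n := mul_nonneg l1 (by linarith)
  have f6 : 0 ≤ (L₂.card : ℝ) * n := mul_nonneg l2 (by linarith)
  have b3' : E G (X \ L₁) (Xᶜ \ L₂) ≤ (X.card : ℝ) * Xᶜ.card - L₁.card * Xᶜ.card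
      - L₂.card * X.card + L₁.card * L₂.card := b3.trans (le_of_eq (by ring))
  clear_value X L₁ L₂
  linarith

lemma markov_card (G : SimpleGraph V) (P Q : Finset V) (m t : ℝ) (ht : 0 < t)
    (h : (P.card : ℝ) * Q.card - m ≤ E G P Q) :
    ((P.filter (fun x => ¬ ((Q.card : ℝ) - t ≤ dg G x Q))).card : ℝ) * t ≤ m := by
  have h1 : ∀ x ∈ P, dg G x Q ≤ Q.card - (if ¬ ((Q.card : ℝ) - t ≤ dg G x Q) then t else 0) := by
    intro x _
    split_ifs with hc
    · have := dg_le_card G x Q; linarith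
    · linarith
  have h2 : E G P Q ≤ ∑ x ∈ P, (Q.card - (if ¬ ((Q.card : ℝ) - t ≤ dg G x Q) then t else 0)) :=
    Finset.sum_le_sum h1
  rw [Finset.sum_sub_distrib, Finset.sum_const, nsmul_eq_mul, ← Finset.sum_filter,
    Finset.sum_const, nsmul_eq_mul] at h2
  linarith

lemma NB (G G' : SimpleGraph V) (hle : G' ≤ G)
    (htri : ∀ x y z, G'.Adj x y → G'.Adj y z → G'.Adj z x → False)
    (n : ℝ) (hN : n = Fintype.card V) (hn : 100000 ≤ n)
    (hE : n ^ 2 / 2 < E G univ univ) (hR : 0.06 * n ^ 2 ≤ E (Red G) univ univ)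
    (hE' : (1 / 2 - 0.000002) * n ^ 2 ≤ E G' univ univ) : False := by
  obtain ⟨A, -, iA, hmax, hA⟩ := TF G' univ (fun v _ x _ y _ => htri v x y)
  rw [Finset.card_univ, ← hN] at hA
  have hc : (A.card : ℝ) + Aᶜ.card = n := by rw [hN]; exact card_S_add
  have hdeg : ∀ x, dg G' x univ ≤ A.card := by
    intro x
    have := hmax (univ.filter (fun y => G'.Adj x y)) (Finset.subset_univ _) (by
      intro y hy z hz hyz
      rw [Finset.mem_filter] at hy hz
      exact htri x y z hy.2 hyz hz.2.symm)
    unfold dg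
    exact_mod_cast this
  have e1 : E G' Aᶜ univ ≤ Aᶜ.card * A.card := by
    calc E G' Aᶜ univ ≤ ∑ x ∈ Aᶜ, (A.card : ℝ) := Finset.sum_le_sum fun x _ => hdeg x
      _ = _ := by rw [Finset.sum_const, nsmul_eq_mul]
  have e2 := E_compl_right G' Aᶜ A
  have e3 := E_split G' A
  rw [E_eq_zero G' iA, E_comm G' A] at e3
  have hsq : ((A.card : ℝ) - n / 2) ^ 2 ≤ (0.001 * n) ^ 2 := by nlinarith
  have hA1 := abs_le_of_sq_le_sq' hsq (by linarith)
  obtain ⟨hA1, hA2⟩ := hA1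
  have hm : (Aᶜ.card : ℝ) * A.card - 0.000002 * n ^ 2 ≤ E G Aᶜ A := by
    have : E G' Aᶜ A ≤ E G Aᶜ A := E_mono _ _ fun x _ y _ h => hle h
    nlinarith [sq_nonneg ((A.card : ℝ) - Aᶜ.card)]
  have hm' : (A.card : ℝ) * Aᶜ.card - 0.000002 * n ^ 2 ≤ E G A Aᶜ := by
    rw [E_comm]; linarith
  have k1 := markov_card G Aᶜ A _ (0.005 * n) (by linarith) hm
  have k2 := markov_card G A Aᶜ _ (0.005 * n) (by linarith) hm'
  set P := Aᶜ.filter (fun x => (A.card : ℝ) - 0.005 * n ≤ dg G x A) with hP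
  set Q := A.filter (fun x => (Aᶜ.card : ℝ) - 0.005 * n ≤ dg G x Aᶜ) with hQ
  have c1 : (P.card : ℝ) + (Aᶜ.filter (fun x => ¬ ((A.card : ℝ) - 0.005 * n ≤ dg G x A))).card
      = Aᶜ.card := by
    exact_mod_cast Finset.card_filter_add_card_filter_not _
  have c2 : (Q.card : ℝ) + (A.filter (fun x => ¬ ((Aᶜ.card : ℝ) - 0.005 * n ≤ dg G x Aᶜ))).card
      = A.card := by
    exact_mod_cast Finset.card_filter_add_card_filter_not _
  set u := ((Aᶜ.filter (fun x => ¬ ((A.card : ℝ) - 0.005 * n ≤ dg G x A))).card : ℝ)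
  set w := ((A.filter (fun x => ¬ ((Aᶜ.card : ℝ) - 0.005 * n ≤ dg G x Aᶜ))).card : ℝ)
  have hu : u ≤ 0.0004 * n := by
    by_contra hc; push Not at hc; nlinarith
  have hw : w ≤ 0.0004 * n := by
    by_contra hc; push Not at hc; nlinarith
  have u0 : 0 ≤ u := by positivity
  have w0 : 0 ≤ w := by positivity
  have hQA : Q ⊆ A := Finset.filter_subset _ _
  have hPA : P ⊆ Aᶜ := Finset.filter_subset _ _
  have hbt : BT G P Q n := by
    refine ⟨?_, by linarith, by linarith, by linarith, by linarith, by linarith, ?_, ?_⟩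
    · exact Finset.disjoint_of_subset_left (Finset.filter_subset _ _)
        (Finset.disjoint_of_subset_right (Finset.filter_subset _ _) disjoint_compl_left)
    · intro p hp
      have h1 := (Finset.mem_filter.1 hp).2
      have h2 : dg G p A = dg G p Q + dg G p (A \ Q) := by
        rw [← dg_union G p Finset.disjoint_sdiff, Finset.union_sdiff_of_subset hQA]
      have h3 := dg_le_card G p (A \ Q)
      rw [Finset.card_sdiff_of_subset hQA,
        Nat.cast_sub (Finset.card_le_card hQA)] at h3
      linarith
    · intro p hp
      have h1 := (Finset.mem_filter.1 hp).2
      have h2 : dg G p Aᶜ = dg G p P + dg G p (Aᶜ \ P) := by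
        rw [← dg_union G p Finset.disjoint_sdiff, Finset.union_sdiff_of_subset hPA]
      have h3 := dg_le_card G p (Aᶜ \ P)
      rw [Finset.card_sdiff_of_subset hPA,
        Nat.cast_sub (Finset.card_le_card hPA)] at h3
      linarith
  exact hbt.contra hN hn hE hR

end nb
end EC5

namespace EC5
open Finset Classical

lemma sqrt2_lo : (1.414213562373 : ℝ) < √2 := by rw [Real.lt_sqrt] <;> norm_num
lemma sqrt2_hi : √2 < (1.414213562374 : ℝ) := by rw [Real.sqrt_lt'] <;> norm_num

lemma num_pos {x σ : ℝ} (hx : (2 - √2) / 8 - 0.000000000000000000000000001 ≤ x) (h : x ≤ σ ^ 2 / 2) (h0 : 0 ≤ σ) :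
    0.3826 ≤ σ := by
  have s2 := sqrt2_hi
  by_contra hc
  push Not at hc
  nlinarith

lemma num_core_pq {σ p q : ℝ} (h1 : 0.3826 ≤ σ) (h2 : σ ≤ 1 / 2 - 0.0000001)
    (hp : p = √2 * (1 / 2 - σ)) (hq : q = σ - p) :
    0.00000014 ≤ p ∧ 0.05 ≤ q - p ∧ q ≤ 1 := by
  have s1 := sqrt2_lo
  have s2 := sqrt2_hi
  have p1 : p ≤ 1.414213562374 * (1 / 2 - σ) := by
    rw [hp]; exact mul_le_mul_of_nonneg_right s2.le (by linarith)
  have p2 : 1.414213562373 * (1 / 2 - σ) ≤ p := by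
    rw [hp]; exact mul_le_mul_of_nonneg_right s1.le (by linarith)
  refine ⟨by linarith, by linarith, by linarith⟩

lemma num_core1 {σ p q x h : ℝ} (h1 : 0.3826 ≤ σ) (h2 : σ ≤ 1 / 2 - 0.0000001)
    (hp : p = √2 * (1 / 2 - σ)) (hq : q = σ - p) (hx : 1 / 2 - 0.000000000000000000000000001 ≤ x)
    (hh : (2 - √2) / 8 - 0.000000000000000000000000001 ≤ h)
    (hc : (q - p) * x + p * h + σ * p ^ 2 ≤ (q - p) * (1 / 2) + 2 * p * (p * q)) : False := by
  obtain ⟨p1, qp, q1⟩ := num_core_pq h1 h2 hp hq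
  have e := pq_eq 1 σ
  have e' : p * q = (2 - √2) / 16 - (2 + √2) * (σ - (3 - √2) / 4) ^ 2 := by
    rw [hq, hp]; rw [e]; ring
  have m1 := mul_le_mul_of_nonneg_left hx (show 0 ≤ q - p by linarith)
  have m2 := mul_le_mul_of_nonneg_left hh (show 0 ≤ p by linarith)
  have m3 : p * (p * q) ≤ p * ((2 - √2) / 16) := by
    apply mul_le_mul_of_nonneg_left _ (by linarith)
    rw [e']
    have : 0 ≤ (2 + √2) * (σ - (3 - √2) / 4) ^ 2 := by positivity
    linarith
  have m4 : 0.38 * (0.00000014) ^ 2 ≤ σ * p ^ 2 := by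
    apply mul_le_mul (by linarith) _ (by positivity) (by linarith)
    exact pow_le_pow_left₀ (by norm_num) p1 2
  norm_num at m4
  linarith

lemma num_core2 {σ p q x h b c Δ : ℝ} (h1 : 0.3826 ≤ σ) (h2 : σ ≤ 1 / 2 - 0.0000001)
    (hp : p = √2 * (1 / 2 - σ)) (hq : q = σ - p) (hx : 1 / 2 - 0.000000000000000000000000001 ≤ x)
    (hh : (2 - √2) / 8 - 0.000000000000000000000000001 ≤ h) (hΔ : 0 ≤ Δ)
    (hc : (q - p) * x + p * h + σ * (b - q) ^ 2 + (q - p) * (b - c) ^ 2 + (q - p) * Δ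
      ≤ (q - p) * (1 / 2) + 2 * p * (p * q)) :
    0.3964466092 ≤ σ ∧ σ ≤ 0.3964466096 ∧ 0.2499999990 ≤ c ∧ c ≤ 0.2500000010 ∧ Δ ≤ 0.000000000000000000000001 := by
  have s1 := sqrt2_lo
  have s2 := sqrt2_hi
  have s0 : (√2) ^ 2 = 2 := Real.sq_sqrt (by norm_num)
  obtain ⟨p1, qp, q1⟩ := num_core_pq h1 h2 hp hq
  have e := pq_eq 1 σ
  have e' : p * q = (2 - √2) / 16 - (2 + √2) * (σ - (3 - √2) / 4) ^ 2 := by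
    rw [hq, hp]; rw [e]; ring
  have m1 := mul_le_mul_of_nonneg_left hx (show 0 ≤ q - p by linarith)
  have m2 := mul_le_mul_of_nonneg_left hh (show 0 ≤ p by linarith)
  obtain ⟨y, hy⟩ : ∃ y, y = σ - (3 - √2) / 4 := ⟨_, rfl⟩
  rw [← hy] at e'
  have m3 : p * (p * q) = p * ((2 - √2) / 16) - p * ((2 + √2) * y ^ 2) := by
    rw [e']; ring
  have n1 : 0 ≤ σ * (b - q) ^ 2 := by positivity
  have n2 : 0 ≤ (q - p) * (b - c) ^ 2 := mul_nonneg (by linarith) (by positivity)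
  have n3 : 0 ≤ (q - p) * Δ := mul_nonneg (by linarith) hΔ
  have n4 : 0.00000014 * (3 * y ^ 2) ≤ p * ((2 + √2) * y ^ 2) := by
    apply mul_le_mul p1 _ (by positivity) (by linarith)
    exact mul_le_mul_of_nonneg_right (by linarith) (by positivity)
  have n1' : 0.38 * (b - q) ^ 2 ≤ σ * (b - q) ^ 2 :=
    mul_le_mul_of_nonneg_right (by linarith) (by positivity)
  have n2' : 0.05 * (b - c) ^ 2 ≤ (q - p) * (b - c) ^ 2 :=
    mul_le_mul_of_nonneg_right (by linarith) (by positivity)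
  have n3' : 0.05 * Δ ≤ (q - p) * Δ := mul_le_mul_of_nonneg_right (by linarith) hΔ
  have n4' : 0 ≤ y ^ 2 := sq_nonneg y
  have y2 : y ^ 2 ≤ (0.0000000001) ^ 2 := by norm_num; linarith
  have bq : (b - q) ^ 2 ≤ (0.000000000001) ^ 2 := by norm_num; linarith
  have bc : (b - c) ^ 2 ≤ (0.000000000001) ^ 2 := by norm_num; linarith
  have y3 := abs_le_of_sq_le_sq' y2 (by norm_num)
  have bq3 := abs_le_of_sq_le_sq' bq (by norm_num)
  have bc3 := abs_le_of_sq_le_sq' bc (by norm_num)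
  have q2 : q - 1 / 4 = (1 + √2) * y := by
    rw [hq, hp, hy]; linear_combination (-1/4 : ℝ) * s0
  have q3 : (1 + √2) * y ≤ (1 + √2) * 0.0000000001 := mul_le_mul_of_nonneg_left y3.2 (by positivity)
  have q4 : (1 + √2) * (-0.0000000001) ≤ (1 + √2) * y := mul_le_mul_of_nonneg_left y3.1 (by positivity)
  refine ⟨by linarith, by linarith, by linarith, by linarith, by linarith⟩

/-- numeric lower bound for `b'` -/
lemma num_b' {σ τ c f g b' : ℝ} (h1 : 0.3964466092 ≤ σ) (h2 : σ ≤ 0.3964466096)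
    (h3 : 0.2499999990 ≤ c) (h4 : c ≤ 0.2500000010) (hτ : σ + τ = 1)
    (hK : 1 / 2 - 0.00000000000000000001 - (τ ^ 2 - c ^ 2) ≤ f + 2 * g)
    (hf : f ≤ σ ^ 2 / 2) (hg : g ≤ b' * (c + 0.0000000001)) (hb : 0 ≤ b') : 0.239 ≤ b' := by
  have ht : τ = 1 - σ := by linarith
  subst ht
  have k1 : b' * (c + 0.0000000001) ≤ b' * 0.250000002 := mul_le_mul_of_nonneg_left (by linarith) hb
  nlinarith

lemma num_alpha {σ α h b' : ℝ} (h1 : 0.3964466092 ≤ σ) (h2 : σ ≤ 0.3964466096)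
    (hh : (2 - √2) / 8 - 0.00000000000000000001 ≤ h) (hb : 0.239 ≤ b') (hba : b' ≤ α)
    (hα : h ≤ 2 * α * (σ - α)) : α ≤ 0.250000002 := by
  have s2 := sqrt2_hi
  by_contra hc
  push Not at hc
  nlinarith

lemma num_b2 {σ τ c f g b' b2 : ℝ} (h1 : 0.3964466092 ≤ σ) (h2 : σ ≤ 0.3964466096)
    (h3 : 0.2499999990 ≤ c) (h4 : c ≤ 0.2500000010) (hτ : σ + τ = 1)
    (hK : 1 / 2 - 0.00000000000000000001 - (τ ^ 2 - c ^ 2) ≤ f + 2 * g)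
    (hf : f ≤ σ ^ 2 / 2) (hg : g ≤ b2 * (c + 0.0000000001) + (b' - b2) * (c / 2 + 0.0000000001))
    (hb : 0 ≤ b2) (hb' : b' ≤ 0.250000002) : 0.22 ≤ b2 := by
  have ht : τ = 1 - σ := by linarith
  subst ht
  have k1 : b2 * c ≤ b2 * 0.250000002 := mul_le_mul_of_nonneg_left (by linarith) hb
  by_contra hc
  push Not at hc
  nlinarith

lemma num_b2' {σ τ c f g b' b2 α : ℝ} (h1 : 0.3964466092 ≤ σ) (h2 : σ ≤ 0.3964466096)
    (h3 : 0.2499999990 ≤ c) (h4 : c ≤ 0.2500000010) (hτ : σ + τ = 1)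
    (hK : 1 / 2 - 0.00000000000000000001 - (τ ^ 2 - c ^ 2) ≤ f + 2 * g)
    (hf : f ≤ 2 * α * (σ - α)) (hα : b2 ≤ α)
    (hg : g ≤ b2 * (c + 0.0000000001) + (b' - b2) * (c / 2 + 0.0000000001))
    (hb : 0.22 ≤ b2) (hb' : b' ≤ 0.250000002) : f ≤ 2 * b2 * (σ - b2) ∧ 0.2499999 ≤ b2 := by
  have ht : τ = 1 - σ := by linarith
  subst ht
  have hf2 : f ≤ 2 * b2 * (σ - b2) := by nlinarith
  refine ⟨hf2, ?_⟩
  by_contra hc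
  push Not at hc
  have k1 : g ≤ c * (b2 + b') / 2 + 0.0000000001 * b' := by nlinarith
  have k2 : c * (b2 + b') ≤ 0.250000001 * (b2 + 0.250000002) := by nlinarith
  nlinarith

lemma num_fin {σ τ c f g b' b2 h α eBC hAA hAB : ℝ}
    (h1 : 0.3964466092 ≤ σ) (h2 : σ ≤ 0.3964466096)
    (h3 : 0.2499999990 ≤ c) (h4 : c ≤ 0.2500000010) (hτ : σ + τ = 1)
    (hK : 1 / 2 - 0.00000000000000000001 - (τ ^ 2 - c ^ 2) ≤ f + 2 * g)
    (hf : f ≤ 2 * b2 * (σ - b2)) (hb2 : 0.2499999 ≤ b2) (hbb : b2 ≤ b')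
    (hb' : b' ≤ 0.250000002) (hg : g ≤ eBC + b2 * 0.0000000001 + (b' - b2) * (c + 0.0000000001))
    (hh : (2 - √2) / 8 - 0.00000000000000000001 ≤ h) (hα : α ≤ 0.250000002)
    (hA : hAA + hAB ≤ (σ - b2) * α) (hHs : h = hAA + 2 * hAB) :
    b2 * c - 0.0000005 ≤ eBC ∧ (σ - b2) * b2 - 0.0000005 ≤ hAB := by
  have s2 := sqrt2_hi
  have ht : τ = 1 - σ := by linarith
  subst ht
  have k3 : (b' - b2) * (c + 0.0000000001) ≤ (b' - b2) * 1 :=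
    mul_le_mul_of_nonneg_left (by linarith) (by linarith)
  have k4 : (σ - b2) * α ≤ (σ - b2) * 0.250000002 := mul_le_mul_of_nonneg_left hα (by linarith)
  constructor
  · nlinarith
  · nlinarith

end EC5

namespace EC5
open Finset Classical

lemma nrm {n : ℝ} (hn : 0 < n) (x : ℝ) : ∃ s, x = s * n := ⟨x / n, by field_simp⟩
lemma nrm2 {n : ℝ} (hn : 0 < n) (x : ℝ) : ∃ s, x = s * n ^ 2 := ⟨x / n ^ 2, by field_simp⟩

section stab
variable {V : Type*} [Fintype V] {G H : SimpleGraph V} {S : Finset V}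

lemma stab_core (hp : HP G H S)
    (h3 : ∀ u v, H.Adj u v → (∀ z ∈ Sᶜ, ¬ G.Adj u z) ∨ (∀ z ∈ Sᶜ, ¬ G.Adj v z))
    (n : ℝ) (hn : n = Fintype.card V) (hn0 : 0 < n)
    (hE : (1 / 2 - 0.000000000000000000000000001) * n ^ 2 ≤ E G univ univ)
    (hH : ((2 - √2) / 8 - 0.000000000000000000000000001) * n ^ 2 ≤ E H univ univ)
    (hσ : (S.card : ℝ) ≤ (1 / 2 - 0.0000001) * n) :
    ∃ C ⊆ Sᶜ, (∀ x ∈ C, ∀ y ∈ C, ¬ G.Adj x y) ∧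
      0.3964466092 * n ≤ S.card ∧ (S.card : ℝ) ≤ 0.3964466096 * n ∧
      0.2499999990 * n ≤ C.card ∧ (C.card : ℝ) ≤ 0.2500000010 * n ∧
      (Sᶜ.card : ℝ) ^ 2 - (C.card : ℝ) ^ 2 - E G Sᶜ Sᶜ ≤ 0.000000000000000000000001 * n ^ 2 := by
  have hn2 : 0 < n ^ 2 := by positivity
  have hn3 : 0 < n ^ 3 := by positivity
  obtain ⟨s, hs⟩ := nrm hn0 (S.card : ℝ)
  obtain ⟨x, hx⟩ := nrm2 hn0 (E G univ univ)
  obtain ⟨h, hh⟩ := nrm2 hn0 (E H univ univ)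
  have s0 : 0 ≤ s := by
    by_contra hc; push Not at hc
    have : (0 : ℝ) ≤ S.card := by positivity
    nlinarith
  have hx' : 1 / 2 - 0.000000000000000000000000001 ≤ x := by rw [hx] at hE; exact le_of_mul_le_mul_right hE hn2
  have hh' : (2 - √2) / 8 - 0.000000000000000000000000001 ≤ h := by rw [hh] at hH; exact le_of_mul_le_mul_right hH hn2
  have hhs : h ≤ s ^ 2 / 2 := by
    have := hp.H_le
    rw [hh, hs] at this
    exact le_of_mul_le_mul_right (by linarith [this]) hn2
  have s1 := num_pos hh' hhs s0
  have s2 : s ≤ 1 / 2 - 0.0000001 := by rw [hs] at hσ; exact le_of_mul_le_mul_right hσ hn0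
  have hS : S.Nonempty := by
    rw [← Finset.card_pos]
    have : (0 : ℝ) < S.card := by rw [hs]; positivity
    exact_mod_cast this
  obtain ⟨p, hpd⟩ : ∃ p : ℝ, p = √2 * (1 / 2 - s) := ⟨_, rfl⟩
  obtain ⟨q, hqd⟩ : ∃ q : ℝ, q = s - p := ⟨_, rfl⟩
  obtain ⟨p1, p2, p3⟩ := num_core_pq s1 s2 hpd hqd
  rcases core hp hS h3 n (s * n) (Sᶜ.card) (p * n) (q * n) hn hs.symm rfl
    (by rw [hpd]; ring) (by rw [hqd]; ring) (by apply mul_nonneg <;> linarith)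
    (mul_le_mul_of_nonneg_right (by linarith) hn0.le) with hc | hc
  · exfalso
    rw [hx, hh] at hc
    exact num_core1 s1 s2 hpd hqd hx' hh' (le_of_mul_le_mul_right (by linarith [hc]) hn3)
  · obtain ⟨C, hC, iC, b, hb, hbσ, hc⟩ := hc
    refine ⟨C, hC, iC, ?_⟩
    obtain ⟨c, hcc⟩ := nrm hn0 (C.card : ℝ)
    obtain ⟨b, rfl⟩ := nrm hn0 b
    obtain ⟨Δ, hΔ⟩ := nrm2 hn0 ((Sᶜ.card : ℝ) ^ 2 - (C.card : ℝ) ^ 2 - E G Sᶜ Sᶜ)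
    have hΔ0 : 0 ≤ Δ := by
      have := E_triangle_free_indep G hC iC
      by_contra hcon; push Not at hcon
      nlinarith
    rw [hΔ, hx, hh, hcc] at hc
    obtain ⟨r1, r2, r3, r4, r5⟩ := num_core2 (b := b) (c := c) s1 s2 hpd hqd hx' hh' hΔ0
      (le_of_mul_le_mul_right (by linarith [hc]) hn3)
    rw [hΔ, hs, hcc]
    exact ⟨mul_le_mul_of_nonneg_right r1 hn0.le, mul_le_mul_of_nonneg_right r2 hn0.le,
      mul_le_mul_of_nonneg_right r3 hn0.le, mul_le_mul_of_nonneg_right r4 hn0.le,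
      mul_le_mul_of_nonneg_right r5 hn2.le⟩

end stab
end EC5

namespace EC5
open Finset Classical

section stab
variable {V : Type*} [Fintype V] {G H : SimpleGraph V} {S : Finset V}

/-- upper bound for E by a bound on degrees -/
lemma E_le_of_dg {V : Type*} (G : SimpleGraph V) (X Y : Finset V) (t : ℝ)
    (h : ∀ x ∈ X, dg G x Y ≤ t) : E G X Y ≤ X.card * t := by
  calc E G X Y ≤ ∑ x ∈ X, t := Finset.sum_le_sum h
    _ = _ := by rw [Finset.sum_const, nsmul_eq_mul]

lemma card_sdiff_real {V : Type*} {X Y : Finset V} (h : Y ⊆ X) :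
    ((X \ Y).card : ℝ) = X.card - Y.card := by
  rw [Finset.card_sdiff_of_subset h, Nat.cast_sub (Finset.card_le_card h)]

lemma E_sub_left {V : Type*} (G : SimpleGraph V) {X Y : Finset V} (h : Y ⊆ X) (Z : Finset V) :
    E G X Z = E G Y Z + E G (X \ Y) Z := by
  rw [← E_union_left G _ Finset.disjoint_sdiff, Finset.union_sdiff_of_subset h]

lemma E_sub_right {V : Type*} (G : SimpleGraph V) {X Y : Finset V} (h : Y ⊆ X) (Z : Finset V) :
    E G Z X = E G Z Y + E G Z (X \ Y) := by
  rw [← E_union_right G _ Finset.disjoint_sdiff, Finset.union_sdiff_of_subset h]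

lemma dg_sub {V : Type*} (G : SimpleGraph V) {X Y : Finset V} (h : Y ⊆ X) (z : V) :
    dg G z X = dg G z Y + dg G z (X \ Y) := by
  rw [← dg_union G _ Finset.disjoint_sdiff, Finset.union_sdiff_of_subset h]

set_option maxHeartbeats 1000000 in
lemma stab_num {n S T C B P Am Bm A eSS eST hSS hAA hAB eBC eTT eBT ePBT : ℝ} (hn0 : 0 < n)
    (hn2 : 0 < n ^ 2) (hst : S + T = n)
    (σ1 : 0.3964466092 * n ≤ S) (σ2 : S ≤ 0.3964466096 * n)
    (c1 : 0.2499999990 * n ≤ C) (c2 : C ≤ 0.2500000010 * n) (hB0 : 0 ≤ B)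
    (hTT : eTT ≤ T ^ 2 - C ^ 2) (hE : (1 / 2 - 0.000000000000000000000000001) * n ^ 2 ≤ eSS + 2 * eST + eTT)
    (hH : ((2 - √2) / 8 - 0.000000000000000000000000001) * n ^ 2 ≤ hSS)
    (g0 : eST = eBT + ePBT) (g2 : eBT ≤ B * (C + 0.0000000001 * n))
    (g3 : ePBT ≤ (P - B) * (C / 2 + 0.0000000001 * n)) (bP : B ≤ P)
    (g4 : eBT ≤ eBC + B * (0.0000000001 * n)) (aP : P ≤ Am) (aB : B ≤ Bm)
    (hAm : hSS ≤ 2 * Am * (S - Am)) (hBm : eSS ≤ 2 * Bm * (S - Bm))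
    (cA : A = S - B) (hd : hAB + hAA ≤ A * Am) (h2 : hSS = hAA + 2 * hAB) :
    0.2499999 * n ≤ B ∧ B ≤ 0.250000002 * n ∧ B * C - 0.0000005 * n ^ 2 ≤ eBC ∧
      A * B - 0.0000005 * n ^ 2 ≤ hAB := by
  obtain ⟨s, hs⟩ := nrm hn0 S
  obtain ⟨t, ht⟩ := nrm hn0 T
  obtain ⟨c, hc⟩ := nrm hn0 C
  obtain ⟨b, hb⟩ := nrm hn0 B
  obtain ⟨b', hb'⟩ := nrm hn0 P
  obtain ⟨α, hα⟩ := nrm hn0 Am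
  obtain ⟨α', hα'⟩ := nrm hn0 Bm
  obtain ⟨f, hf⟩ := nrm2 hn0 eSS
  obtain ⟨g, hg⟩ := nrm2 hn0 eST
  obtain ⟨h, hh⟩ := nrm2 hn0 hSS
  obtain ⟨x, hx⟩ := nrm2 hn0 hAA
  obtain ⟨y, hy⟩ := nrm2 hn0 hAB
  obtain ⟨z, hz⟩ := nrm2 hn0 eBC
  have N1 : 0.3964466092 ≤ s := le_of_mul_le_mul_right (by linarith) hn0
  have N2 : s ≤ 0.3964466096 := le_of_mul_le_mul_right (by linarith) hn0
  have N3 : 0.2499999990 ≤ c := le_of_mul_le_mul_right (by linarith) hn0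
  have N4 : c ≤ 0.2500000010 := le_of_mul_le_mul_right (by linarith) hn0
  have N5 : s + t = 1 := by
    have : (s + t) * n = 1 * n := by linarith
    exact mul_right_cancel₀ hn0.ne' this
  have N6 : 1 / 2 - 0.00000000000000000001 - (t ^ 2 - c ^ 2) ≤ f + 2 * g := by
    apply le_of_mul_le_mul_right _ hn2
    rw [hf, hg] at hE
    rw [ht, hc] at hTT
    nlinarith
  have N7 : f ≤ 2 * α' * (s - α') := by
    apply le_of_mul_le_mul_right _ hn2
    rw [hf, hα', hs] at hBm
    linarith [hBm]
  have N7' : f ≤ s ^ 2 / 2 := by nlinarith [sq_nonneg (s - 2 * α')]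
  have N8 : h ≤ 2 * α * (s - α) := by
    apply le_of_mul_le_mul_right _ hn2
    rw [hh, hα, hs] at hAm
    linarith [hAm]
  have N9 : (2 - √2) / 8 - 0.00000000000000000001 ≤ h := by
    apply le_of_mul_le_mul_right _ hn2
    rw [hh] at hH
    nlinarith
  have N10 : b' ≤ α := le_of_mul_le_mul_right (by linarith) hn0
  have N11 : b ≤ α' := le_of_mul_le_mul_right (by linarith) hn0
  have N12 : b ≤ b' := le_of_mul_le_mul_right (by linarith) hn0
  have N13 : 0 ≤ b := by
    have : (0:ℝ) ≤ B := hB0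
    by_contra hc; push Not at hc; nlinarith
  have N14 : g ≤ b * (c + 0.0000000001) + (b' - b) * (c / 2 + 0.0000000001) := by
    apply le_of_mul_le_mul_right _ hn2
    rw [hb, hc] at g2
    rw [hb, hb', hc] at g3
    linarith
  have N15 : g ≤ b' * (c + 0.0000000001) := by nlinarith
  have N16 : g ≤ z + b * 0.0000000001 + (b' - b) * (c + 0.0000000001) := by
    have : (b' - b) * (c / 2 + 0.0000000001) ≤ (b' - b) * (c + 0.0000000001) :=
      mul_le_mul_of_nonneg_left (by linarith) (by linarith)
    have : g ≤ z + b * 0.0000000001 + (b' - b) * (c / 2 + 0.0000000001) := by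
      apply le_of_mul_le_mul_right _ hn2
      rw [hz, hb] at g4
      rw [hb, hb', hc] at g3
      linarith
    linarith
  have N17 : x + y ≤ (s - b) * α := by
    apply le_of_mul_le_mul_right _ hn2
    rw [cA, hx, hy, hs, hb, hα] at hd
    linarith
  have N18 : h = x + 2 * y := by
    have : h * n ^ 2 = (x + 2 * y) * n ^ 2 := by linarith
    exact mul_right_cancel₀ hn2.ne' this
  have M1 := num_b' N1 N2 N3 N4 N5 N6 N7' N15 (by linarith)
  have M2 := num_alpha N1 N2 N9 M1 N10 N8
  have M3 := num_b2 N1 N2 N3 N4 N5 N6 N7' N14 N13 (by linarith)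
  obtain ⟨M4, M5⟩ := num_b2' N1 N2 N3 N4 N5 N6 N7 N11 N14 M3 (by linarith)
  obtain ⟨M6, M7⟩ := num_fin N1 N2 N3 N4 N5 N6 M4 M5 N12 (by linarith) N16 N9 M2 N17 N18
  have M8 : b ≤ 0.250000002 := by linarith
  have R1 := mul_le_mul_of_nonneg_right M5 hn0.le
  have R2 := mul_le_mul_of_nonneg_right M8 hn0.le
  have R3 := mul_le_mul_of_nonneg_right M6 hn2.le
  have R4 := mul_le_mul_of_nonneg_right M7 hn2.le
  refine ⟨by linarith, by linarith, ?_, ?_⟩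
  · rw [hz, hb, hc]; linarith
  · rw [cA, hy, hs, hb]; linarith

set_option maxHeartbeats 1000000 in
lemma stab_struct (hp : HP G H S)
    (h3 : ∀ u v, H.Adj u v → (∀ z ∈ Sᶜ, ¬ G.Adj u z) ∨ (∀ z ∈ Sᶜ, ¬ G.Adj v z))
    (n : ℝ) (hn : n = Fintype.card V) (hn0 : 0 < n)
    (hE : (1 / 2 - 0.000000000000000000000000001) * n ^ 2 ≤ E G univ univ)
    (hH : ((2 - √2) / 8 - 0.000000000000000000000000001) * n ^ 2 ≤ E H univ univ)
    (hσ : (S.card : ℝ) ≤ (1 / 2 - 0.0000001) * n) :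
    ∃ A B C D : Finset V, Disjoint A B ∧ A ∪ B = S ∧ Disjoint C D ∧ C ∪ D = Sᶜ ∧
      0.1464 * n ≤ A.card ∧ (A.card : ℝ) ≤ 0.1465 * n ∧
      0.2499 * n ≤ B.card ∧ (B.card : ℝ) ≤ 0.2501 * n ∧
      0.2499 * n ≤ C.card ∧ (C.card : ℝ) ≤ 0.2501 * n ∧
      0.3535 * n ≤ D.card ∧ (D.card : ℝ) ≤ 0.3536 * n ∧
      (A.card : ℝ) * B.card - 0.0000005 * n ^ 2 ≤ E H A B ∧
      (B.card : ℝ) * C.card - 0.0000005 * n ^ 2 ≤ E G B C ∧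
      (C.card : ℝ) * D.card - 0.0000005 * n ^ 2 ≤ E G C D ∧
      (D.card : ℝ) * D.card - 0.0000005 * n ^ 2 ≤ E G D D := by
  obtain ⟨C, hCT, iC, σ1, σ2, c1, c2, hΔ⟩ := stab_core hp h3 n hn hn0 hE hH hσ
  have hn2 : 0 < n ^ 2 := by positivity
  have hst : (S.card : ℝ) + (Sᶜ.card : ℝ) = n := by rw [hn]; exact card_S_add
  obtain ⟨T, hT⟩ : ∃ T, T = Sᶜ := ⟨_, rfl⟩
  have hsplit := E_split G S
  rw [← hT] at hCT hΔ hst h3 hsplit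
  obtain ⟨D, hD⟩ : ∃ D, D = T \ C := ⟨_, rfl⟩
  have hdc : (D.card : ℝ) = T.card - C.card := by rw [hD]; exact card_sdiff_real hCT
  have eTT : E G T T = E G C C + 2 * E G C D + E G D D := by
    rw [hD, ← E_union_self G Finset.disjoint_sdiff, Finset.union_sdiff_of_subset hCT]
  rw [E_eq_zero G iC] at eTT
  have uCD := E_le G C D
  have uDD := E_le G D D
  have tc : (T.card : ℝ) = C.card + D.card := by linarith
  have lCD : (C.card : ℝ) * D.card - 0.000000000000000000000001 * n ^ 2 ≤ E G C D := by
    rw [eTT, tc] at hΔ; nlinarith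
  have lDD : (D.card : ℝ) * D.card - 0.000000000000000000000001 * n ^ 2 ≤ E G D D := by
    rw [eTT, tc] at hΔ; nlinarith
  have dD : ∀ x ∈ S, dg G x D ≤ 0.0000000001 * n := by
    intro x hx
    have h1 := E_triangle_free_indep G (Finset.filter_subset _ _) (hp.nbr_indep hx D)
    have h2 : (dg G x D) ^ 2 ≤ (0.0000000001 * n) ^ 2 := by unfold dg; nlinarith
    exact (abs_le_of_sq_le_sq' h2 (by positivity)).2
  have dT : ∀ x ∈ S, dg G x T ≤ dg G x C + 0.0000000001 * n := by
    intro x hx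
    have := dg_sub G hCT x
    rw [← hD] at this
    linarith [dD x hx]
  obtain ⟨P, hP⟩ : ∃ P, P = S.filter (fun x => ∃ z ∈ T, G.Adj x z) := ⟨_, rfl⟩
  obtain ⟨B, hB⟩ : ∃ B, B = S.filter (fun x => (C.card : ℝ) / 2 < dg G x C) := ⟨_, rfl⟩
  have PS : P ⊆ S := by rw [hP]; exact Finset.filter_subset _ _
  have BS : B ⊆ S := by rw [hB]; exact Finset.filter_subset _ _
  have BP : B ⊆ P := by
    intro x hx
    rw [hB, Finset.mem_filter] at hx
    rw [hP, Finset.mem_filter]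
    obtain ⟨z, hz, hz'⟩ := dg_pos G (lt_of_le_of_lt (div_nonneg (Nat.cast_nonneg _) (by norm_num)) hx.2)
    exact ⟨hx.1, z, hCT hz, hz'⟩
  have iP : ∀ x ∈ P, ∀ y ∈ P, ¬ H.Adj x y := by
    intro x hx y hy hxy
    rw [hP, Finset.mem_filter] at hx hy
    obtain ⟨-, z, hz, hz'⟩ := hx
    obtain ⟨-, w, hw, hw'⟩ := hy
    rcases h3 x y hxy with h | h
    · exact h z hz hz'
    · exact h w hw hw'
  have iB : ∀ x ∈ B, ∀ y ∈ B, ¬ G.Adj x y := by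
    intro x hx y hy hxy
    rw [hB, Finset.mem_filter] at hx hy
    obtain ⟨w, -, -, h1, h2⟩ := exists_common G x y C ∅ (by simp; linarith)
    exact hp.tri x hx.1 y w hxy h2 h1.symm
  -- bounds on E G S T
  have g0 : E G S T = E G P T := by
    rw [E_sub_left G PS T, E_eq_zero G (X := S \ P), add_zero]
    intro x hx y hy hxy
    rw [Finset.mem_sdiff, hP, Finset.mem_filter] at hx
    exact hx.2 ⟨hx.1, y, hy, hxy⟩
  have g1 : E G P T = E G B T + E G (P \ B) T := E_sub_left G BP T
  have g2 : E G B T ≤ B.card * (C.card + 0.0000000001 * n) := E_le_of_dg G B T _ fun x hx =>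
    (dT x (BS hx)).trans (by linarith [dg_le_card G x C])
  have g3 : E G (P \ B) T ≤ (P.card - B.card) * (C.card / 2 + 0.0000000001 * n) := by
    rw [← card_sdiff_real BP]
    refine E_le_of_dg G _ T _ fun x hx => ?_
    rw [Finset.mem_sdiff, hB, Finset.mem_filter] at hx
    have hxS := PS hx.1
    have : dg G x C ≤ C.card / 2 := by
      by_contra hc; push Not at hc; exact hx.2 ⟨hxS, hc⟩
    linarith [dT x hxS]
  have bP : (B.card : ℝ) ≤ P.card := by exact_mod_cast Finset.card_le_card BP
  have g4 : E G B T ≤ E G B C + B.card * (0.0000000001 * n) := by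
    rw [E_sub_right G hCT B, ← hD]
    have := E_le_of_dg G B D _ fun x hx => dD x (BS hx)
    linarith
  obtain ⟨Am, -, iAm, mAm, hAm⟩ := TF H S (fun v hv x _ y _ h1 h2 h3 =>
    hp.tri v hv x y (hp.le h1) (hp.le h2) (hp.le h3))
  obtain ⟨Bm, -, iBm, mBm, hBm⟩ := TF G S (fun v hv x _ y _ h1 h2 h3 => hp.tri v hv x y h1 h2 h3)
  have aP : (P.card : ℝ) ≤ Am.card := by exact_mod_cast mAm P PS iP
  have aB : (B.card : ℝ) ≤ Bm.card := by exact_mod_cast mBm B BS iB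
  obtain ⟨A, hA⟩ : ∃ A, A = S \ B := ⟨_, rfl⟩
  have cA : (A.card : ℝ) = S.card - B.card := by rw [hA]; exact card_sdiff_real BS
  have hAS : A ⊆ S := by rw [hA]; exact Finset.sdiff_subset
  have hd : E H A S ≤ A.card * Am.card := E_le_of_dg H A S _ fun x hx => by
    have := mAm (S.filter (fun y => H.Adj x y)) (Finset.filter_subset _ _) (by
      intro y hy z hz hyz
      rw [Finset.mem_filter] at hy hz
      exact hp.tri x (hAS hx) y z (hp.le hy.2) (hp.le hyz) (hp.le hz.2.symm))
    unfold dg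
    exact_mod_cast this
  have h1 : E H A S = E H A B + E H A A := by rw [E_sub_right H BS A, ← hA]
  have h2 : E H univ univ = E H A A + 2 * E H A B := by
    rw [hp.E_H]
    have := E_union_self H (X := B) (Y := S \ B) Finset.disjoint_sdiff
    rw [Finset.union_sdiff_of_subset BS, ← hA, E_comm H B A,
      E_eq_zero H (X := B) (fun x hx y hy h => iB x hx y hy (hp.le h))] at this
    linarith
  rw [hp.E_H] at h2 hH
  -- normalize
  have hTT : E G T T ≤ (T.card : ℝ) ^ 2 - (C.card : ℝ) ^ 2 := by
    have := E_triangle_free_indep G hCT iC; linarith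
  rw [hsplit] at hE
  rw [h1] at hd
  obtain ⟨R1, R2, R3, R4⟩ := stab_num hn0 hn2 hst σ1 σ2 c1 c2 (Nat.cast_nonneg B.card) hTT hE hH
    (g0.trans g1) g2 g3 bP g4 aP aB hAm hBm cA hd h2
  refine ⟨A, B, C, D, ?_, ?_, ?_, ?_, by linarith, by linarith, by linarith, by linarith,
    by linarith, by linarith, by linarith, by linarith, R4, R3, by linarith, by linarith⟩
  · rw [hA]; exact Finset.sdiff_disjoint
  · rw [hA]; exact Finset.sdiff_union_of_subset BS
  · rw [hD]; exact Finset.disjoint_sdiff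
  · rw [hD, ← hT]; exact Finset.union_sdiff_of_subset hCT

end stab
end EC5

namespace EC5
open Finset Classical

section stab
variable {V : Type*} [Fintype V]

lemma del_E (G : SimpleGraph V) (D : Finset V) (n : ℝ) (hn : n = Fintype.card V) :
    ∃ G' : SimpleGraph V, (∀ x y, G'.Adj x y ↔ G.Adj x y ∧ x ∉ D ∧ y ∉ D) ∧
      E G univ univ ≤ E G' univ univ + 2 * D.card * n := by
  obtain ⟨G', hG'⟩ : ∃ G' : SimpleGraph V, ∀ x y, G'.Adj x y ↔ G.Adj x y ∧ x ∉ D ∧ y ∉ D :=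
    ⟨{ Adj := fun x y => G.Adj x y ∧ x ∉ D ∧ y ∉ D
       symm := ⟨fun x y h => ⟨h.1.symm, h.2.2, h.2.1⟩⟩
       loopless := ⟨fun x h => G.loopless.irrefl x h.1⟩ }, fun x y => Iff.rfl⟩
  refine ⟨G', hG', ?_⟩
  have e1 := E_split G D
  have e2 := E_compl_right G D D
  have e3 := E_le G D univ
  rw [Finset.card_univ, ← hn] at e3
  have e4 := E_nonneg G D D
  have e5 : E G Dᶜ Dᶜ ≤ E G' Dᶜ Dᶜ := E_mono _ _ fun x hx y hy h =>
    (hG' x y).2 ⟨h, Finset.mem_compl.1 hx, Finset.mem_compl.1 hy⟩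
  have e6 : E G' Dᶜ Dᶜ ≤ E G' univ univ :=
    (E_subset_left G' _ (Finset.subset_univ _)).trans (E_subset_right G' _ (Finset.subset_univ _))
  linarith

lemma NBD (G G' : SimpleGraph V) (hle : G' ≤ G) (D : Finset V)
    (n : ℝ) (hN : n = Fintype.card V) (hn : 100000 ≤ n) (hD : (D.card : ℝ) ≤ 0.0000005 * n)
    (htri : ∀ x y z, x ∉ D → y ∉ D → z ∉ D → G'.Adj x y → G'.Adj y z → G'.Adj z x → False)
    (hE : n ^ 2 / 2 < E G univ univ) (hR : 0.06 * n ^ 2 ≤ E (Red G) univ univ)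
    (hE' : (1 / 2 - 0.000001) * n ^ 2 ≤ E G' univ univ) : False := by
  obtain ⟨G₂, h2, he⟩ := del_E G' D n hN
  refine NB G G₂ (fun x y h => hle ((h2 x y).1 h).1) ?_ n hN hn hE hR ?_
  · intro x y z h1 h3 h4
    rw [h2] at h1 h3 h4
    exact htri x y z h1.2.1 h1.2.2 h3.2.2 h1.1 h3.1 h4.1
  · have : (D.card : ℝ) * n ≤ 0.0000005 * n * n := mul_le_mul_of_nonneg_right hD (by linarith)
    nlinarith

variable {G G' H : SimpleGraph V} {S : Finset V}

/-- case 3 (a) -/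
lemma stab_a (hp : HP G' H S) (hle : G' ≤ G)
    (n : ℝ) (hN : n = Fintype.card V) (hn : 100000 ≤ n)
    (hE : n ^ 2 / 2 < E G univ univ) (hR : 0.06 * n ^ 2 ≤ E (Red G) univ univ)
    (hE' : (1 / 2 - 0.000000000000001) * n ^ 2 ≤ E G' univ univ)
    (hσ : (1 / 2 - 0.0000001) * n < S.card) : False := by
  have hS : S.Nonempty := by
    rw [← Finset.card_pos]
    have : (0 : ℝ) < S.card := by linarith
    exact_mod_cast this
  have hst : (S.card : ℝ) + (Sᶜ.card : ℝ) = n := by rw [hN]; exact card_S_add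
  obtain ⟨C₁, C₂, k1, k2, k3, i1, i2, h⟩ := lemM hp hS
  have h := h _ rfl
  rw [hst] at h
  have k4 : C₁ ∪ C₂ ⊆ Sᶜ := Finset.union_subset k1 k2
  have cD : ((Sᶜ \ (C₁ ∪ C₂)).card : ℝ) = Sᶜ.card - C₁.card - C₂.card := by
    rw [card_sdiff_real k4, Finset.card_union_of_disjoint k3]; push_cast; ring
  rw [← cD] at h
  refine NBD G G' hle (Sᶜ \ (C₁ ∪ C₂)) n hN hn ?_ ?_ hE hR (by nlinarith)
  · obtain ⟨d, hd⟩ : ∃ d : ℝ, d = ((Sᶜ \ (C₁ ∪ C₂)).card : ℝ) := ⟨_, rfl⟩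
    have hd0 : 0 ≤ d := by rw [hd]; positivity
    rw [← hd] at h ⊢
    by_contra hc
    push Not at hc
    have h5 : d * (Sᶜ.card - S.card) ≤ d * (0.0000002 * n) :=
      mul_le_mul_of_nonneg_left (by linarith) hd0
    nlinarith
  · intro x y z hx hy hz h1 h2 h3
    have hxS : x ∉ S := fun hc => hp.tri x hc y z h1 h2 h3
    have hyS : y ∉ S := fun hc => hp.tri y hc z x h2 h3 h1
    have hzS : z ∉ S := fun hc => hp.tri z hc x y h3 h1 h2
    simp only [Finset.mem_sdiff, Finset.mem_compl, Finset.mem_union, not_and, not_not] at hx hy hz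
    have hx := hx hxS
    have hy := hy hyS
    have hz := hz hzS
    rcases hx with hx | hx <;> rcases hy with hy | hy <;> rcases hz with hz | hz
    · exact i1 x hx y hy h1
    · exact i1 x hx y hy h1
    · exact i1 z hz x hx h3
    · exact i2 y hy z hz h2
    · exact i1 y hy z hz h2
    · exact i2 z hz x hx h3
    · exact i2 x hx y hy h1
    · exact i2 x hx y hy h1

/-- case 3 (b) -/
lemma stab_b (hp : HP G' H S) (hle : G' ≤ G)
    (n : ℝ) (hN : n = Fintype.card V) (hn : 100000 ≤ n)
    (hE : n ^ 2 / 2 < E G univ univ) (hR : 0.06 * n ^ 2 ≤ E (Red G) univ univ)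
    (hE' : (1 / 2 - 0.000000000000001) * n ^ 2 ≤ E G' univ univ)
    (hH : 0.07 * n ^ 2 ≤ E H univ univ)
    (hdeg : ∀ w, dg G' w univ < (1 / 2 + 0.00000000000002) * n) : False := by
  set Lo := univ.filter (fun x => dg G' x univ < (1 / 2 - 0.0000001) * n) with hLo
  have hn0 : 0 < n := by linarith
  have c1 : E G' univ univ ≤ n * ((1 / 2 + 0.00000000000002) * n) - Lo.card * (0.0000001 * n) := by
    have h1 : ∀ x ∈ (univ : Finset V), dg G' x univ ≤ (1 / 2 + 0.00000000000002) * n -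
        (if dg G' x univ < (1 / 2 - 0.0000001) * n then 0.0000001 * n else 0) := by
      intro x _
      split_ifs with h
      · linarith
      · linarith [hdeg x]
    have h2 : E G' univ univ ≤ ∑ x ∈ (univ : Finset V), ((1 / 2 + 0.00000000000002) * n -
        (if dg G' x univ < (1 / 2 - 0.0000001) * n then 0.0000001 * n else 0)) := Finset.sum_le_sum h1
    rw [Finset.sum_sub_distrib, Finset.sum_const, nsmul_eq_mul, ← Finset.sum_filter,
      Finset.sum_const, nsmul_eq_mul, Finset.card_univ, ← hN] at h2
    exact h2
  have c2 : (Lo.card : ℝ) ≤ 0.0000003 * n := by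
    by_contra hc
    push Not at hc
    have : 0.0000003 * n * (0.0000001 * n) ≤ Lo.card * (0.0000001 * n) :=
      mul_le_mul_of_nonneg_right hc.le (by positivity)
    nlinarith
  obtain ⟨H₂, h2, he⟩ := del_E H Lo n hN
  have hpos : 0 < E H₂ univ univ := by
    have : (Lo.card : ℝ) * n ≤ 0.0000003 * n * n := mul_le_mul_of_nonneg_right c2 hn0.le
    nlinarith
  have : ∃ u v, H₂.Adj u v := by
    by_contra hc
    push Not at hc
    rw [E_eq_zero H₂ (fun x _ y _ => hc x y)] at hpos
    exact lt_irrefl _ hpos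
  obtain ⟨u, v, huv⟩ := this
  rw [h2] at huv
  obtain ⟨huv, hu, hv⟩ := huv
  simp only [hLo, Finset.mem_filter, Finset.mem_univ, true_and, not_lt] at hu hv
  have hadj := hp.le huv
  have huS := hp.mem u v huv
  have hvS := hp.mem' huv
  have d1 := hp.nbr_disj huS hadj univ
  have i1 := hp.nbr_indep huS univ
  have i2 := hp.nbr_indep hvS univ
  obtain ⟨P, hP⟩ : ∃ P, P = univ.filter (fun y => G'.Adj u y) := ⟨_, rfl⟩
  obtain ⟨Q, hQ⟩ : ∃ Q, Q = univ.filter (fun y => G'.Adj v y) := ⟨_, rfl⟩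
  rw [← hP, ← hQ] at d1
  rw [← hP] at i1
  rw [← hQ] at i2
  unfold dg at hu hv
  rw [← hP] at hu
  rw [← hQ] at hv
  refine NBD G G' hle (P ∪ Q)ᶜ n hN hn ?_ ?_ hE hR (by nlinarith)
  · have := card_S_add (S := P ∪ Q)
    rw [← hN, Finset.card_union_of_disjoint d1] at this
    push_cast at this
    linarith
  · intro x y z hx hy hz h1 h2 h3
    simp only [Finset.mem_compl, Finset.mem_union, not_not] at hx hy hz
    rcases hx with hx | hx <;> rcases hy with hy | hy <;> rcases hz with hz | hz
    · exact i1 x hx y hy h1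
    · exact i1 x hx y hy h1
    · exact i1 z hz x hx h3
    · exact i2 y hy z hz h2
    · exact i1 y hy z hz h2
    · exact i2 z hz x hx h3
    · exact i2 x hx y hy h1
    · exact i2 x hx y hy h1

/-- case 3 (c) -/
lemma stab_c (hp : HP G' H S)
    (n : ℝ) (hN : n = Fintype.card V) (hn : 100000000000000000000000000000000000000000000000000 ≤ n)
    (hE' : (1 / 2 - 0.0000000000000000000000000000000000000000000001) * n ^ 2 ≤ E G' univ univ)
    (hH : ((2 - √2) / 8 - 0.0000000000000000000000000000000000000000000001) * n ^ 2 ≤ E H univ univ)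
    (w : V) (hw : (1 / 2 + 0.00000000000002) * n ≤ dg G' w univ)
    (Lo : Finset V) (hLS : Lo ⊆ Sᶜ) (hLo : ∀ z ∈ Lo, dg G' z univ ≤ (1 / 2 + 0.00000000000001) * n)
    (hc : 0.0000000000000000000000000004 * n ≤ Lo.card) : False := by
  have hn0 : 0 < n := by norm_num at hn; linarith
  obtain ⟨L, hL, hcard⟩ := Finset.exists_subset_card_eq (s := Lo) (n := ⌊0.0000000000000000000000000004 * n⌋₊) (by
    have : ((⌊0.0000000000000000000000000004 * n⌋₊ : ℕ) : ℝ) ≤ Lo.card := (Nat.floor_le (by positivity)).trans hc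
    exact_mod_cast this)
  have l1 : (L.card : ℝ) ≤ 0.0000000000000000000000000004 * n := by rw [hcard]; exact Nat.floor_le (by positivity)
  have l2 : 0.0000000000000000000000000002 * n ≤ L.card := by
    rw [hcard]
    have := Nat.lt_floor_add_one (0.0000000000000000000000000004 * n)
    norm_num at hn this ⊢
    linarith
  have h1 := clone_E G' L w
  have h2 : ∑ z ∈ L, (0.00000000000001 * n - 0.0000000000000000000000000004 * n) ≤
      ∑ z ∈ L, (dg G' w univ - L.card - dg G' z univ) :=
    Finset.sum_le_sum fun z hz => by linarith [hLo z (hL hz)]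
  rw [Finset.sum_const, nsmul_eq_mul] at h2
  have h3 : 0.0000000000000000000000000002 * n * (0.00000000000001 * n - 0.0000000000000000000000000004 * n) ≤ L.card * (0.00000000000001 * n - 0.0000000000000000000000000004 * n) :=
    mul_le_mul_of_nonneg_right l2 (by linarith)
  have hp2 := hp.comap (fun x => if x ∈ L then w else x) (by
    intro x hx
    have : x ∉ L := fun h => (Finset.mem_compl.1 (hLS (hL h))) hx
    simp [this])
  have h4 := thmA hp2 n (0.000000000000000000000000000000000000000001 / 2) hN hn0 (by norm_num) (by norm_num at hn ⊢; linarith) (by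
    nlinarith)
  have : 0 < n ^ 2 := by positivity
  nlinarith

end stab
end EC5

namespace EC5
open Finset Classical

/-- the typical structure -/
structure Typ {V : Type*} [Fintype V] (G : SimpleGraph V) (A B C D : Finset V) (n : ℝ) : Prop where
  dAB : Disjoint A B
  dAC : Disjoint A C
  dAD : Disjoint A D
  dBC : Disjoint B C
  dBD : Disjoint B D
  dCD : Disjoint C D
  cov : n - A.card - B.card - C.card - D.card ≤ 0.002 * n
  a1 : 0.145 * n ≤ A.card
  a2 : (A.card : ℝ) ≤ 0.147 * n
  b1 : 0.249 * n ≤ B.card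
  b2 : (B.card : ℝ) ≤ 0.251 * n
  c1 : 0.249 * n ≤ C.card
  c2 : (C.card : ℝ) ≤ 0.251 * n
  d1 : 0.352 * n ≤ D.card
  d2 : (D.card : ℝ) ≤ 0.354 * n
  rAB : ∀ x ∈ A, (B.card : ℝ) - 0.002 * n ≤ dg (Red G) x B
  rBA : ∀ x ∈ B, (A.card : ℝ) - 0.002 * n ≤ dg (Red G) x A
  gBC : ∀ x ∈ B, (C.card : ℝ) - 0.002 * n ≤ dg G x C
  gCB : ∀ x ∈ C, (B.card : ℝ) - 0.002 * n ≤ dg G x B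
  gCD : ∀ x ∈ C, (D.card : ℝ) - 0.002 * n ≤ dg G x D
  gDC : ∀ x ∈ D, (C.card : ℝ) - 0.002 * n ≤ dg G x C
  gDD : ∀ x ∈ D, (D.card : ℝ) - 0.002 * n ≤ dg G x D

section stab
variable {V : Type*} [Fintype V] {G G' H : SimpleGraph V} {S : Finset V}

/-- passing to a subset does not increase the number of non-neighbours -/
lemma dg_restrict {V : Type*} (G : SimpleGraph V) {X Y : Finset V} (h : Y ⊆ X) (z : V) (t : ℝ)
    (hz : (X.card : ℝ) - t ≤ dg G z X) : (Y.card : ℝ) - t ≤ dg G z Y := by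
  have h1 := dg_sub G h z
  have h2 := dg_le_card G z (X \ Y)
  rw [card_sdiff_real h] at h2
  linarith

/-- the good part with respect to two targets -/
lemma good2 {V : Type*} [Fintype V] (G₁ G₂ : SimpleGraph V) (P Q R : Finset V) (n : ℝ) (hn : 0 < n)
    (h1 : (P.card : ℝ) * Q.card - 0.0000005 * n ^ 2 ≤ E G₁ P Q)
    (h2 : (P.card : ℝ) * R.card - 0.0000005 * n ^ 2 ≤ E G₂ P R) :
    ∃ P' ⊆ P, (P.card : ℝ) - 0.0005 * n ≤ P'.card ∧
      (∀ x ∈ P', (Q.card : ℝ) - 0.002 * n ≤ dg G₁ x Q) ∧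
      (∀ x ∈ P', (R.card : ℝ) - 0.002 * n ≤ dg G₂ x R) := by
  have k1 := markov_card G₁ P Q _ (0.002 * n) (by positivity) h1
  have k2 := markov_card G₂ P R _ (0.002 * n) (by positivity) h2
  obtain ⟨X, hX⟩ : ∃ X, X = P.filter (fun x => ¬ ((Q.card : ℝ) - 0.002 * n ≤ dg G₁ x Q)) :=
    ⟨_, rfl⟩
  obtain ⟨Y, hY⟩ : ∃ Y, Y = P.filter (fun x => ¬ ((R.card : ℝ) - 0.002 * n ≤ dg G₂ x R)) :=
    ⟨_, rfl⟩
  rw [← hX] at k1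
  rw [← hY] at k2
  have hXY : X ∪ Y ⊆ P := by
    rw [hX, hY]; exact Finset.union_subset (Finset.filter_subset _ _) (Finset.filter_subset _ _)
  have x1 : (X.card : ℝ) ≤ 0.00025 * n := by
    by_contra hc; push Not at hc
    have : 0.00025 * n * (0.002 * n) < X.card * (0.002 * n) :=
      mul_lt_mul_of_pos_right hc (by positivity)
    nlinarith
  have y1 : (Y.card : ℝ) ≤ 0.00025 * n := by
    by_contra hc; push Not at hc
    have : 0.00025 * n * (0.002 * n) < Y.card * (0.002 * n) :=
      mul_lt_mul_of_pos_right hc (by positivity)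
    nlinarith
  refine ⟨P \ (X ∪ Y), Finset.sdiff_subset, ?_, ?_, ?_⟩
  · rw [card_sdiff_real hXY]
    have : ((X ∪ Y).card : ℝ) ≤ X.card + Y.card := by exact_mod_cast Finset.card_union_le _ _
    linarith
  · intro x hx
    rw [Finset.mem_sdiff, Finset.mem_union, not_or, hX, Finset.mem_filter] at hx
    by_contra hc
    exact hx.2.1 ⟨hx.1, hc⟩
  · intro x hx
    rw [Finset.mem_sdiff, Finset.mem_union, not_or, hY, Finset.mem_filter] at hx
    by_contra hc
    exact hx.2.2 ⟨hx.1, hc⟩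

lemma typ_of (n : ℝ) (hn : n = Fintype.card V) (hn0 : 0 < n) (A B C D : Finset V)
    (hAB : Disjoint A B) (hS : A ∪ B = S) (hCD : Disjoint C D) (hT : C ∪ D = Sᶜ)
    (a1 : 0.1464 * n ≤ A.card) (a2 : (A.card : ℝ) ≤ 0.1465 * n)
    (b1 : 0.2499 * n ≤ B.card) (b2 : (B.card : ℝ) ≤ 0.2501 * n)
    (c1 : 0.2499 * n ≤ C.card) (c2 : (C.card : ℝ) ≤ 0.2501 * n)
    (d1 : 0.3535 * n ≤ D.card) (d2 : (D.card : ℝ) ≤ 0.3536 * n)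
    (e1 : (A.card : ℝ) * B.card - 0.0000005 * n ^ 2 ≤ E (Red G) A B)
    (e2 : (B.card : ℝ) * C.card - 0.0000005 * n ^ 2 ≤ E G B C)
    (e3 : (C.card : ℝ) * D.card - 0.0000005 * n ^ 2 ≤ E G C D)
    (e4 : (D.card : ℝ) * D.card - 0.0000005 * n ^ 2 ≤ E G D D) :
    ∃ A B C D : Finset V, Typ G A B C D n := by
  obtain ⟨A', sA, cA, A1, -⟩ := good2 (Red G) (Red G) A B B n hn0 e1 e1
  obtain ⟨B', sB, cB, B1, B2⟩ := good2 (Red G) G B A C n hn0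
    (by rw [E_comm, mul_comm (B.card : ℝ)]; exact e1) e2
  obtain ⟨C', sC, cC, C1, C2⟩ := good2 G G C B D n hn0
    (by rw [E_comm, mul_comm (C.card : ℝ)]; exact e2) e3
  obtain ⟨D', sD, cD, D1, D2⟩ := good2 G G D C D n hn0
    (by rw [E_comm, mul_comm (D.card : ℝ)]; exact e3) e4
  have uA : (A'.card : ℝ) ≤ A.card := by exact_mod_cast Finset.card_le_card sA
  have uB : (B'.card : ℝ) ≤ B.card := by exact_mod_cast Finset.card_le_card sB
  have uC : (C'.card : ℝ) ≤ C.card := by exact_mod_cast Finset.card_le_card sC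
  have uD : (D'.card : ℝ) ≤ D.card := by exact_mod_cast Finset.card_le_card sD
  have tot := card_S_add (S := S)
  rw [← hT, ← hS, Finset.card_union_of_disjoint hAB, Finset.card_union_of_disjoint hCD, ← hn] at tot
  push_cast at tot
  have dis : ∀ X Y : Finset V, X ⊆ S → Y ⊆ Sᶜ → Disjoint X Y := fun X Y h1 h2 =>
    Finset.disjoint_of_subset_left h1 (Finset.disjoint_of_subset_right h2 disjoint_compl_right)
  have SA : A' ⊆ S := sA.trans (by rw [← hS]; exact Finset.subset_union_left)
  have SB : B' ⊆ S := sB.trans (by rw [← hS]; exact Finset.subset_union_right)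
  have SC : C' ⊆ Sᶜ := sC.trans (by rw [← hT]; exact Finset.subset_union_left)
  have SD : D' ⊆ Sᶜ := sD.trans (by rw [← hT]; exact Finset.subset_union_right)
  refine ⟨A', B', C', D', ?_⟩
  constructor
  · exact Finset.disjoint_of_subset_left sA (Finset.disjoint_of_subset_right sB hAB)
  · exact dis _ _ SA SC
  · exact dis _ _ SA SD
  · exact dis _ _ SB SC
  · exact dis _ _ SB SD
  · exact Finset.disjoint_of_subset_left sC (Finset.disjoint_of_subset_right sD hCD)
  · linarith
  · linarith
  · linarith
  · linarith
  · linarith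
  · linarith
  · linarith
  · linarith
  · linarith
  · exact fun x hx => dg_restrict _ sB x _ (A1 x hx)
  · exact fun x hx => dg_restrict _ sA x _ (B1 x hx)
  · exact fun x hx => dg_restrict _ sC x _ (B2 x hx)
  · exact fun x hx => dg_restrict _ sB x _ (C1 x hx)
  · exact fun x hx => dg_restrict _ sD x _ (C2 x hx)
  · exact fun x hx => dg_restrict _ sC x _ (D1 x hx)
  · exact fun x hx => dg_restrict _ sD x _ (D2 x hx)

lemma stab_main (hp : HP G' H S) (hle : G' ≤ G) (hHR : H ≤ Red G)
    (n : ℝ) (hN : n = Fintype.card V) (hn : 100000000000000000000000000000000000000000000000000 ≤ n)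
    (hE : n ^ 2 / 2 < E G univ univ)
    (hE' : (1 / 2 - 0.0000000000000000000000000000000000000000000001) * n ^ 2 ≤ E G' univ univ)
    (hH : ((2 - √2) / 8 - 0.0000000000000000000000000000000000000000000001) * n ^ 2 ≤ E H univ univ) :
    ∃ A B C D : Finset V, Typ G A B C D n := by
  have hn5 : 100000 ≤ n := by norm_num at hn ⊢; linarith
  have hn0 : 0 < n := by linarith
  have hn2 : 0 < n ^ 2 := by positivity
  have s2 := sqrt2_hi
  have hH7 : 0.07 * n ^ 2 ≤ E H univ univ :=
    (mul_le_mul_of_nonneg_right (by norm_num; linarith) hn2.le).trans hH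
  have hR : 0.06 * n ^ 2 ≤ E (Red G) univ univ := by
    have : E H univ univ ≤ E (Red G) univ univ := E_mono _ _ fun x _ y _ h => hHR h
    linarith
  have hE15 : (1 / 2 - 0.000000000000001) * n ^ 2 ≤ E G' univ univ :=
    (mul_le_mul_of_nonneg_right (by norm_num) hn2.le).trans hE'
  have hσ : (S.card : ℝ) ≤ (1 / 2 - 0.0000001) * n := by
    by_contra hc
    push Not at hc
    exact stab_a hp hle n hN hn5 hE hR hE15 hc
  have hw : ∃ w, (1 / 2 + 0.00000000000002) * n ≤ dg G' w univ := by
    by_contra hc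
    push Not at hc
    exact stab_b hp hle n hN hn5 hE hR hE15 hH7 hc
  obtain ⟨w, hw⟩ := hw
  obtain ⟨Lo, hLo⟩ : ∃ Lo, Lo = Sᶜ.filter (fun z => dg G' z univ ≤ (1 / 2 + 0.00000000000001) * n) := ⟨_, rfl⟩
  have hc : (Lo.card : ℝ) ≤ 0.0000000000000000000000000004 * n := by
    by_contra hc
    push Not at hc
    refine stab_c hp n hN hn hE' hH w hw Lo (by rw [hLo]; exact Finset.filter_subset _ _) ?_ hc.le
    intro z hz
    rw [hLo, Finset.mem_filter] at hz
    exact hz.2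
  obtain ⟨G₂, h2, he⟩ := del_E G' Lo n hN
  have hLS : ∀ x ∈ S, x ∉ Lo := by
    intro x hx h
    rw [hLo, Finset.mem_filter, Finset.mem_compl] at h
    exact h.1 hx
  have hle2 : G₂ ≤ G' := fun x y h => ((h2 x y).1 h).1
  have hp2 : HP G₂ H S := by
    refine ⟨fun v hv x y h1 h3 h4 => hp.tri v hv x y (hle2 h1) (hle2 h3) (hle2 h4), hp.mem, ?_, ?_⟩
    · intro u v h
      exact (h2 u v).2 ⟨hp.le h, hLS u (hp.mem u v h), hLS v (hp.mem' h)⟩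
    · intro u v h x y z h1 h3 h4 h5
      exact hp.walk u v h x y z (hle2 h1) (hle2 h3) (hle2 h4) (hle2 h5)
  have h3 : ∀ u v, H.Adj u v → (∀ z ∈ Sᶜ, ¬ G₂.Adj u z) ∨ (∀ z ∈ Sᶜ, ¬ G₂.Adj v z) := by
    intro u v h
    by_contra hcon
    push Not at hcon
    obtain ⟨⟨z, hz, hz'⟩, ⟨y, hy, hy'⟩⟩ := hcon
    rw [h2] at hz' hy'
    have big : ∀ x ∈ Sᶜ, x ∉ Lo → (Fintype.card V : ℝ) / 2 < dg G' x univ := by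
      intro x hx hx'
      rw [hLo, Finset.mem_filter, not_and, not_le] at hx'
      rw [← hN]
      have := hx' hx
      linarith
    exact hp.h3_of_deg h hz'.1 hy'.1 (big z hz hz'.2.2) (big y hy hy'.2.2)
  have hcn : (Lo.card : ℝ) * n ≤ 0.0000000000000000000000000004 * n * n := mul_le_mul_of_nonneg_right hc hn0.le
  have hE2 : (1 / 2 - 0.000000000000000000000000001) * n ^ 2 ≤ E G₂ univ univ := by nlinarith
  have hH2 : ((2 - √2) / 8 - 0.000000000000000000000000001) * n ^ 2 ≤ E H univ univ :=
    (mul_le_mul_of_nonneg_right (by linarith) hn2.le).trans hH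
  obtain ⟨A, B, C, D, q1, q2, q3, q4, a1, a2, b1, b2, c1, c2, d1, d2, e1, e2, e3, e4⟩ :=
    stab_struct hp2 h3 n hN hn0 hE2 hH2 hσ
  have mG : ∀ X Y, E G₂ X Y ≤ E G X Y := fun X Y => E_mono _ _ fun x _ y _ h => hle (hle2 h)
  have mH : ∀ X Y, E H X Y ≤ E (Red G) X Y := fun X Y => E_mono _ _ fun x _ y _ h => hHR h
  exact typ_of n hN hn0 A B C D q1 q2 q3 q4 a1 a2 b1 b2 c1 c2 d1 d2 (e1.trans (mH _ _))
    (e2.trans (mG _ _)) (e3.trans (mG _ _)) (e4.trans (mG _ _))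

end stab
end EC5

namespace EC5
open Finset Classical

section ph2a
variable {V : Type*}

lemma ex1 (G : SimpleGraph V) (x : V) (Y : Finset V) (p q r : V) (h : 3 < dg G x Y) :
    ∃ w ∈ Y, G.Adj x w ∧ w ≠ p ∧ w ≠ q ∧ w ≠ r := by
  obtain ⟨w, h1, h2, h3⟩ := exists_one G x Y {p, q, r} ((card_triple_le p q r).trans_lt h)
  simp only [Finset.mem_insert, Finset.mem_singleton, not_or] at h2
  exact ⟨w, h1, h3, h2⟩

lemma ex2 (G₁ G₂ : SimpleGraph V) (x y : V) (Y : Finset V) (p q r : V) (t : ℝ)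
    (hx : (Y.card : ℝ) - t ≤ dg G₁ x Y) (hy : (Y.card : ℝ) - t ≤ dg G₂ y Y)
    (ht : 2 * t + 3 < Y.card) :
    ∃ w ∈ Y, G₁.Adj x w ∧ G₂.Adj y w ∧ w ≠ p ∧ w ≠ q ∧ w ≠ r := by
  have h1 := card_nonadj G₁ x Y
  have h0 := card_triple_le p q r
  have h2 : (((Y.filter (fun w => ¬ G₁.Adj x w)) ∪ {p, q, r}).card : ℝ) <
      ((Y.filter (fun w => G₂.Adj y w)).card : ℝ) := by
    have : (((Y.filter (fun w => ¬ G₁.Adj x w)) ∪ {p, q, r}).card : ℝ) ≤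
      (Y.filter (fun w => ¬ G₁.Adj x w)).card + ({p, q, r} : Finset V).card := by
      exact_mod_cast Finset.card_union_le _ _
    unfold dg at hx hy h1
    linarith
  obtain ⟨w, hw, hw'⟩ := Finset.exists_mem_notMem_of_card_lt_card (by exact_mod_cast h2)
  simp only [Finset.mem_filter, Finset.mem_union, not_or, not_and, not_not, Finset.mem_insert,
    Finset.mem_singleton] at hw hw'
  exact ⟨w, hw.1, hw'.1 hw.1, hw.2, hw'.2⟩

/-- at most one neighbour if two neighbours are impossible -/
lemma dg_le_one (G : SimpleGraph V) (x : V) (Y : Finset V)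
    (h : ∀ y ∈ Y, ∀ y' ∈ Y, G.Adj x y → G.Adj x y' → y = y') : dg G x Y ≤ 1 := by
  unfold dg
  have : (Y.filter (fun y => G.Adj x y)).card ≤ 1 := by
    rw [Finset.card_le_one]
    intro a ha b hb
    rw [Finset.mem_filter] at ha hb
    exact h a ha.1 b hb.1 ha.2 hb.2
  exact_mod_cast this

end ph2a

section ph2
variable {V : Type*} [Fintype V] {G : SimpleGraph V} {A B C D : Finset V} {n : ℝ}

namespace Typ

lemma f1 (h : Typ G A B C D n) (hn : 100000 ≤ n) {z a b : V} (ha : a ∈ A) (hb : b ∈ B)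
    (za : G.Adj z a) (zb : G.Adj z b) : False := by
  have := h.a1
  have := h.b1
  obtain ⟨a', ha', r, n1, n2, -⟩ := ex1 (Red G) b A a z z (by linarith [h.rBA b hb])
  obtain ⟨b', hb', r1, r2, n3, n4, -⟩ := ex2 (Red G) (Red G) a a' B b z z _ (h.rAB a ha)
    (h.rAB a' ha') (by linarith)
  exact r.2 ⟨b', a, z, r2.1, r1.1.symm, za.symm, zb, n3, Finset.disjoint_iff_ne.1 h.dAB a ha b hb,
    n1.symm, n2.symm, n4⟩

lemma f2 (h : Typ G A B C D n) (hn : 100000 ≤ n) {z a d : V} (ha : a ∈ A) (hd : d ∈ D)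
    (za : G.Adj z a) (zd : G.Adj z d) : False := by
  have := h.c1
  have := h.b1
  obtain ⟨b, hb, r, n1, -⟩ := ex1 (Red G) a B z z z (by linarith [h.rAB a ha])
  obtain ⟨c, hc, r1, r2, n3, -⟩ := ex2 G G b d C z z z _ (h.gBC b hb)
    (h.gDC d hd) (by linarith)
  exact r.2 ⟨c, d, z, r1, r2.symm, zd.symm, za, (Finset.disjoint_iff_ne.1 h.dAC a ha c hc).symm,
    (Finset.disjoint_iff_ne.1 h.dAD a ha d hd).symm, (Finset.disjoint_iff_ne.1 h.dBD b hb d hd).symm,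
    n1.symm, n3⟩

lemma f3 (h : Typ G A B C D n) (hn : 100000 ≤ n) {z b c : V} (hb : b ∈ B) (hc : c ∈ C)
    (zb : G.Adj z b) (zc : G.Adj z c) : False := by
  have := h.a1
  have := h.b1
  obtain ⟨a, ha, r, n1, -⟩ := ex1 (Red G) b A z z z (by linarith [h.rBA b hb])
  obtain ⟨b', hb', r1, r2, n3, n4, -⟩ := ex2 G (Red G) c a B b z z _ (h.gCB c hc)
    (h.rAB a ha) (by linarith)
  exact r.symm.2 ⟨z, c, b', zb.symm, zc, r1, r2.1.symm, n1.symm,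
    (Finset.disjoint_iff_ne.1 h.dAC a ha c hc).symm, (Finset.disjoint_iff_ne.1 h.dBC b hb c hc).symm,
    n3, n4.symm⟩

lemma g1 (h : Typ G A B C D n) (hn : 100000 ≤ n) {z b d : V} (hb : b ∈ B) (hd : d ∈ D)
    (zb : (Red G).Adj z b) (zd : G.Adj z d) : False := by
  have := h.c1
  have := h.d1
  obtain ⟨c, hc, r, n1, -⟩ := ex1 G b C z z z (by linarith [h.gBC b hb])
  obtain ⟨d', hd', r1, r2, n3, -⟩ := ex2 G G c d D z z z _ (h.gCD c hc)
    (h.gDD d hd) (by linarith)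
  exact zb.2 ⟨c, d', d, r, r1, r2.symm, zd.symm, n1, n3,
    (Finset.disjoint_iff_ne.1 h.dBD b hb d' hd').symm,
    (Finset.disjoint_iff_ne.1 h.dBD b hb d hd).symm, (Finset.disjoint_iff_ne.1 h.dCD c hc d hd)⟩

lemma g5 (h : Typ G A B C D n) (hn : 100000 ≤ n) {z c c' : V} (hc : c ∈ C) (hc' : c' ∈ C)
    (zc : (Red G).Adj z c) (zc' : G.Adj z c') : c = c' := by
  by_contra hne
  have := h.d1
  obtain ⟨d, hd, r, n1, -⟩ := ex1 G c D z z z (by linarith [h.gCD c hc])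
  obtain ⟨d', hd', r1, r2, n3, -⟩ := ex2 G G d c' D z z z _ (h.gDD d hd)
    (h.gCD c' hc') (by linarith)
  exact zc.2 ⟨d, d', c', r, r1, r2.symm, zc'.symm, n1, n3,
    (Finset.disjoint_iff_ne.1 h.dCD c hc d' hd').symm, Ne.symm hne,
    (Finset.disjoint_iff_ne.1 h.dCD c' hc' d hd).symm⟩

lemma g6 (h : Typ G A B C D n) (hn : 100000 ≤ n) {z d d' : V} (hd : d ∈ D) (hd' : d' ∈ D)
    (zd : (Red G).Adj z d) (zd' : G.Adj z d') : d = d' := by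
  by_contra hne
  have := h.d1
  obtain ⟨x, hx, r, n1, n2, -⟩ := ex1 G d D z d' z (by linarith [h.gDD d hd])
  obtain ⟨y, hy, r1, r2, n3, n4, -⟩ := ex2 G G x d' D z d z _ (h.gDD x hx)
    (h.gDD d' hd') (by linarith)
  exact zd.2 ⟨x, y, d', r, r1, r2.symm, zd'.symm, n1, n3, n4, Ne.symm hne, n2⟩

end Typ

/-- the four kinds of vertices -/
def PA (G : SimpleGraph V) (B : Finset V) (n : ℝ) (z : V) : Prop :=
  0.24 * n ≤ dg G z B ∧ 0.14 * n ≤ dg (Red G) z B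
def PB (G : SimpleGraph V) (A C : Finset V) (n : ℝ) (z : V) : Prop :=
  0.14 * n ≤ dg G z A ∧ 0.09 * n ≤ dg G z C
def PC (G : SimpleGraph V) (B D : Finset V) (n : ℝ) (z : V) : Prop :=
  0.03 * n ≤ dg G z B ∧ 0.03 * n ≤ dg G z D
def PD (G : SimpleGraph V) (C D : Finset V) (n : ℝ) (z : V) : Prop :=
  0.03 * n ≤ dg G z C ∧ 0.03 * n ≤ dg G z D

namespace Typ

lemma not_AB (h : Typ G A B C D n) (hn : 100000 ≤ n) {z : V} (h1 : PA G B n z)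
    (h2 : PB G A C n z) : False := by
  obtain ⟨b, hb, zb⟩ := dg_pos G (show 0 < dg G z B by linarith [h1.1])
  obtain ⟨a, ha, za⟩ := dg_pos G (show 0 < dg G z A by linarith [h2.1])
  exact h.f1 hn ha hb za zb

lemma not_AC (h : Typ G A B C D n) (hn : 100000 ≤ n) {z : V} (h1 : PA G B n z)
    (h2 : PC G B D n z) : False := by
  obtain ⟨b, hb, zb⟩ := dg_pos (Red G) (show 0 < dg (Red G) z B by linarith [h1.2])
  obtain ⟨d, hd, zd⟩ := dg_pos G (show 0 < dg G z D by linarith [h2.2])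
  exact h.g1 hn hb hd zb zd

lemma not_AD (h : Typ G A B C D n) (hn : 100000 ≤ n) {z : V} (h1 : PA G B n z)
    (h2 : PD G C D n z) : False := by
  obtain ⟨b, hb, zb⟩ := dg_pos G (show 0 < dg G z B by linarith [h1.1])
  obtain ⟨c, hc, zc⟩ := dg_pos G (show 0 < dg G z C by linarith [h2.1])
  exact h.f3 hn hb hc zb zc

lemma not_BC (h : Typ G A B C D n) (hn : 100000 ≤ n) {z : V} (h1 : PB G A C n z)
    (h2 : PC G B D n z) : False := by
  obtain ⟨a, ha, za⟩ := dg_pos G (show 0 < dg G z A by linarith [h1.1])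
  obtain ⟨b, hb, zb⟩ := dg_pos G (show 0 < dg G z B by linarith [h2.1])
  exact h.f1 hn ha hb za zb

lemma not_BD (h : Typ G A B C D n) (hn : 100000 ≤ n) {z : V} (h1 : PB G A C n z)
    (h2 : PD G C D n z) : False := by
  obtain ⟨a, ha, za⟩ := dg_pos G (show 0 < dg G z A by linarith [h1.1])
  obtain ⟨d, hd, zd⟩ := dg_pos G (show 0 < dg G z D by linarith [h2.2])
  exact h.f2 hn ha hd za zd

lemma not_CD (h : Typ G A B C D n) (hn : 100000 ≤ n) {z : V} (h1 : PC G B D n z)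
    (h2 : PD G C D n z) : False := by
  obtain ⟨b, hb, zb⟩ := dg_pos G (show 0 < dg G z B by linarith [h1.1])
  obtain ⟨c, hc, zc⟩ := dg_pos G (show 0 < dg G z C by linarith [h2.1])
  exact h.f3 hn hb hc zb zc

/-- two vertices with many `B`-neighbours are not adjacent -/
lemma ee1 (h : Typ G A B C D n) (hn : 100000 ≤ n) {z z' : V} (h1 : 0.03 * n ≤ dg G z B)
    (h2 : 0.03 * n ≤ dg G z' B) (hz : G.Adj z z') : False := by
  have := h.a1
  obtain ⟨b, hb, zb, n1, -⟩ := ex1 G z B z' z' z' (by linarith)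
  obtain ⟨b', hb', zb', n2, n3, -⟩ := ex1 G z' B z b b (by linarith)
  obtain ⟨a, ha, r1, r2, n4, n5, -⟩ := ex2 (Red G) (Red G) b b' A z z' z _ (h.rBA b hb)
    (h.rBA b' hb') (by linarith)
  exact r1.2 ⟨b', z', z, r2.1.symm, zb'.symm, hz.symm, zb, n3, n1.symm, n5.symm, n4.symm, n2⟩

lemma ee2 (h : Typ G A B C D n) (hn : 100000 ≤ n) {z z' : V} (h1 : 0.03 * n ≤ dg G z A)
    (h2 : 0.03 * n ≤ dg G z' A) (hz : G.Adj z z') : False := by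
  have := h.b1
  obtain ⟨b, hb, zb, n1, -⟩ := ex1 G z A z' z' z' (by linarith)
  obtain ⟨b', hb', zb', n2, n3, -⟩ := ex1 G z' A z b b (by linarith)
  obtain ⟨a, ha, r1, r2, n4, n5, -⟩ := ex2 (Red G) (Red G) b b' B z z' z _ (h.rAB b hb)
    (h.rAB b' hb') (by linarith)
  exact r1.2 ⟨b', z', z, r2.1.symm, zb'.symm, hz.symm, zb, n3, n1.symm, n5.symm, n4.symm, n2⟩

lemma ee3 (h : Typ G A B C D n) (hn : 100000 ≤ n) {z z' : V} (h1 : 0.03 * n ≤ dg G z A)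
    (h2 : 0.03 * n ≤ dg G z' C) (hz : G.Adj z z') : False := by
  have := h.b1
  obtain ⟨a, ha, za, n1, -⟩ := ex1 G z A z' z' z' (by linarith)
  obtain ⟨c, hc, zc, n2, -⟩ := ex1 G z' C z z z (by linarith)
  obtain ⟨b, hb, r1, r2, n4, n5, -⟩ := ex2 (Red G) G a c B z z' z _ (h.rAB a ha)
    (h.gCB c hc) (by linarith)
  exact r1.2 ⟨c, z', z, r2.symm, zc.symm, hz.symm, za,
    (Finset.disjoint_iff_ne.1 h.dAC a ha c hc).symm, n1.symm, n5.symm, n4.symm, n2⟩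

lemma ee4 (h : Typ G A B C D n) (hn : 100000 ≤ n) {z z' : V} (h1 : 0.03 * n ≤ dg (Red G) z B)
    (h2 : 0.03 * n ≤ dg G z' D) (hz : G.Adj z z') : False := by
  have := h.c1
  obtain ⟨b, hb, zb, n1, -⟩ := ex1 (Red G) z B z' z' z' (by linarith)
  obtain ⟨d, hd, zd, n2, -⟩ := ex1 G z' D z z z (by linarith)
  obtain ⟨c, hc, r1, r2, n4, n5, -⟩ := ex2 G G b d C z z' z _ (h.gBC b hb)
    (h.gDC d hd) (by linarith)
  exact zb.2 ⟨c, d, z', r1, r2.symm, zd.symm, hz.symm, n4, n2,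
    (Finset.disjoint_iff_ne.1 h.dBD b hb d hd).symm, n1.symm, n5⟩

lemma rr (h : Typ G A B C D n) (hn : 100000 ≤ n) {x y : V} (h1 : 0.03 * n ≤ dg G x D)
    (h2 : 0.03 * n ≤ dg G y C) : ¬ (Red G).Adj x y := by
  intro hz
  have := h.d1
  obtain ⟨d, hd, xd, n1, -⟩ := ex1 G x D y y y (by linarith)
  obtain ⟨c, hc, yc, n2, -⟩ := ex1 G y C x x x (by linarith)
  obtain ⟨d', hd', r1, r2, n4, n5, -⟩ := ex2 G G c d D x y x _ (h.gCD c hc)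
    (h.gDD d hd) (by linarith)
  exact hz.2 ⟨c, d', d, yc, r1, r2.symm, xd.symm, n2, n4, n5, n1,
    (Finset.disjoint_iff_ne.1 h.dCD c hc d hd)⟩

/-- degrees in terms of the typical classes -/
lemma deg_le (h : Typ G A B C D n) (hN : n = Fintype.card V) (K : SimpleGraph V) (z : V) :
    dg K z univ ≤ dg K z A + dg K z B + dg K z C + dg K z D + 0.002 * n := by
  have k1 : Disjoint (A ∪ B) C := Finset.disjoint_union_left.2 ⟨h.dAC, h.dBC⟩
  have k2 : Disjoint (A ∪ B ∪ C) D :=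
    Finset.disjoint_union_left.2 ⟨Finset.disjoint_union_left.2 ⟨h.dAD, h.dBD⟩, h.dCD⟩
  have e1 := dg_sub K (Finset.subset_univ (A ∪ B ∪ C ∪ D)) z
  have e2 := dg_le_card K z (univ \ (A ∪ B ∪ C ∪ D))
  rw [card_sdiff_real (Finset.subset_univ _), Finset.card_union_of_disjoint k2,
    Finset.card_union_of_disjoint k1, Finset.card_union_of_disjoint h.dAB, Finset.card_univ] at e2
  push_cast at e2
  have e3 := dg_union K z k2
  have e4 := dg_union K z k1
  have e5 := dg_union K z h.dAB
  have := h.cov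
  linarith

lemma classify (h : Typ G A B C D n) (hN : n = Fintype.card V) (hn : 100000 ≤ n) (z : V) :
    PA G B n z ∨ PB G A C n z ∨ PC G B D n z ∨ PD G C D n z ∨ dg G z univ < B.card ∨
    (dg G z univ ≤ A.card + C.card ∧ dg (Red G) z univ < A.card) := by
  have e := h.deg_le hN G z
  have r := h.deg_le hN (Red G) z
  have mA : dg (Red G) z A ≤ dg G z A := dg_mono _ _ fun y _ hy => hy.1
  have mB : dg (Red G) z B ≤ dg G z B := dg_mono _ _ fun y _ hy => hy.1
  have mC : dg (Red G) z C ≤ dg G z C := dg_mono _ _ fun y _ hy => hy.1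
  have mD : dg (Red G) z D ≤ dg G z D := dg_mono _ _ fun y _ hy => hy.1
  have oC : dg (Red G) z C ≤ 1 := dg_le_one _ _ _ fun y hy y' hy' k k' => h.g5 hn hy hy' k k'.1
  have oD : dg (Red G) z D ≤ 1 := dg_le_one _ _ _ fun y hy y' hy' k k' => h.g6 hn hy hy' k k'.1
  have cA := dg_le_card G z A
  have cB := dg_le_card G z B
  have cC := dg_le_card G z C
  have cD := dg_le_card G z D
  have := h.a1
  have := h.a2
  have := h.b1
  have := h.b2
  have := h.c1
  have := h.c2
  have := h.d1
  have := h.d2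
  by_cases hA : ∃ a ∈ A, G.Adj z a
  · obtain ⟨a, ha, za⟩ := hA
    have zB : dg G z B = 0 := dg_eq_zero G fun b hb zb => h.f1 hn ha hb za zb
    have zD : dg G z D = 0 := dg_eq_zero G fun d hd zd => h.f2 hn ha hd za zd
    by_cases q : 0.14 * n ≤ dg G z A
    · by_cases q2 : 0.09 * n ≤ dg G z C
      · exact Or.inr (Or.inl ⟨q, q2⟩)
      · exact Or.inr (Or.inr (Or.inr (Or.inr (Or.inl (by linarith)))))
    · exact Or.inr (Or.inr (Or.inr (Or.inr (Or.inr ⟨by linarith, by linarith⟩))))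
  push Not at hA
  have zA : dg G z A = 0 := dg_eq_zero G hA
  by_cases hB : ∃ b ∈ B, G.Adj z b
  · obtain ⟨b, hb, zb⟩ := hB
    have zC : dg G z C = 0 := dg_eq_zero G fun c hc zc => h.f3 hn hb hc zb zc
    by_cases hD : ∃ d ∈ D, G.Adj z d
    · obtain ⟨d, hd, zd⟩ := hD
      have zB : dg (Red G) z B = 0 := dg_eq_zero _ fun b hb zb => h.g1 hn hb hd zb zd
      by_cases q : 0.03 * n ≤ dg G z B
      · by_cases q2 : 0.03 * n ≤ dg G z D
        · exact Or.inr (Or.inr (Or.inl ⟨q, q2⟩))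
        · exact Or.inr (Or.inr (Or.inr (Or.inr (Or.inr ⟨by linarith, by linarith⟩))))
      · exact Or.inr (Or.inr (Or.inr (Or.inr (Or.inr ⟨by linarith, by linarith⟩))))
    · push Not at hD
      have zD : dg G z D = 0 := dg_eq_zero G hD
      by_cases q : 0.24 * n ≤ dg G z B
      · by_cases q2 : 0.14 * n ≤ dg (Red G) z B
        · exact Or.inl ⟨q, q2⟩
        · exact Or.inr (Or.inr (Or.inr (Or.inr (Or.inr ⟨by linarith, by linarith⟩))))
      · exact Or.inr (Or.inr (Or.inr (Or.inr (Or.inl (by linarith)))))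
  push Not at hB
  have zB : dg G z B = 0 := dg_eq_zero G hB
  by_cases q : 0.03 * n ≤ dg G z C
  · by_cases q2 : 0.03 * n ≤ dg G z D
    · exact Or.inr (Or.inr (Or.inr (Or.inl ⟨q, q2⟩)))
    · exact Or.inr (Or.inr (Or.inr (Or.inr (Or.inr ⟨by linarith, by linarith⟩))))
  · exact Or.inr (Or.inr (Or.inr (Or.inr (Or.inr ⟨by linarith, by linarith⟩))))

end Typ
end ph2
end EC5

namespace EC5
open Finset Classical

section ph3
variable {V : Type*} [Fintype V] {G : SimpleGraph V} {A B C D : Finset V} {n : ℝ}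

lemma E_four {V : Type*} (G : SimpleGraph V) {A B C D : Finset V}
    (h1 : Disjoint A B) (h2 : Disjoint (A ∪ B) C) (h3 : Disjoint (A ∪ B ∪ C) D) :
    E G (A ∪ B ∪ C ∪ D) (A ∪ B ∪ C ∪ D) = E G A A + E G B B + E G C C + E G D D
      + 2 * (E G A B + E G A C + E G A D + E G B C + E G B D + E G C D) := by
  rw [E_union_self G h3, E_union_self G h2, E_union_self G h1, E_union_left G _ h2,
    E_union_left G _ h1, E_union_left G _ h1]
  ring

lemma cnt1 (K : SimpleGraph V) (U : Finset V) :
    E K univ univ ≤ E K U U + 2 * E K Uᶜ univ := by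
  have h1 := E_split K U
  have h2 := E_compl_right K Uᶜ U
  have h3 := E_comm K U Uᶜ
  have h4 := E_nonneg K Uᶜ Uᶜ
  linarith

lemma E_lt_of_dg {V : Type*} (K : SimpleGraph V) (X Y : Finset V) (t : ℝ) (hX : X.Nonempty)
    (h : ∀ x ∈ X, dg K x Y < t) : E K X Y < X.card * t := by
  unfold E
  rw [← nsmul_eq_mul, ← Finset.sum_const]
  exact Finset.sum_lt_sum_of_nonempty hX h

lemma E_le_of_dg2 {V : Type*} (K : SimpleGraph V) (X Y : Finset V) (t : ℝ)
    (h : ∀ x ∈ X, dg K x Y ≤ t) : E K X Y ≤ X.card * t := by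
  unfold E
  rw [← nsmul_eq_mul, ← Finset.sum_const]
  exact Finset.sum_le_sum h

/-- full density means complete -/
lemma full_of_E {V : Type*} (K : SimpleGraph V) (X Y : Finset V)
    (h : (X.card : ℝ) * Y.card ≤ E K X Y) : ∀ x ∈ X, ∀ y ∈ Y, K.Adj x y := by
  intro x hx y hy
  by_contra hc
  have h1 : dg K x Y < Y.card := by
    unfold dg
    have : (Y.filter (fun y => K.Adj x y)).card < Y.card :=
      Finset.card_lt_card (Finset.filter_ssubset.2 ⟨y, hy, hc⟩)
    exact_mod_cast this
  have h2 : E K X Y < X.card * (Y.card : ℝ) := by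
    unfold E
    rw [← nsmul_eq_mul, ← Finset.sum_const]
    exact Finset.sum_lt_sum (fun x _ => dg_le_card K x Y) ⟨x, hx, h1⟩
  linarith

/-- the counting bound on the set of dominated vertices -/
lemma cntZ (K R : SimpleGraph V) (hRK : R ≤ K) (Z : Finset V) (a b c : ℝ)
    (h : ∀ z ∈ Z, dg K z univ < b ∨ (dg K z univ ≤ a + c ∧ dg R z univ < a)) :
    ∃ p q : ℕ, p + q = Z.card ∧ E K Z univ ≤ p * b + q * (a + c) ∧
      E R Z univ ≤ p * b + q * a ∧ (Z.Nonempty → E R Z univ < p * b + q * a) := by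
  obtain ⟨X, hX⟩ : ∃ X, X = Z.filter (fun z => dg K z univ < b) := ⟨_, rfl⟩
  obtain ⟨Y, hY⟩ : ∃ Y, Y = Z.filter (fun z => ¬ dg K z univ < b) := ⟨_, rfl⟩
  have hd : Disjoint X Y := by rw [hX, hY]; exact Finset.disjoint_filter_filter_not _ _ _
  have hu : X ∪ Y = Z := by rw [hX, hY]; exact Finset.filter_union_filter_not_eq _ _
  have mX : ∀ z ∈ X, dg K z univ < b := fun z hz => by
    rw [hX, Finset.mem_filter] at hz; exact hz.2
  have mY : ∀ z ∈ Y, dg K z univ ≤ a + c ∧ dg R z univ < a := fun z hz => by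
    rw [hY, Finset.mem_filter] at hz; exact (h z hz.1).resolve_left hz.2
  have mR : ∀ z, dg R z univ ≤ dg K z univ := fun z => dg_mono _ _ fun y _ hy => hRK hy
  refine ⟨X.card, Y.card, ?_, ?_, ?_, ?_⟩
  · rw [← Finset.card_union_of_disjoint hd, hu]
  · rw [← hu, E_union_left K _ hd]
    exact add_le_add (E_le_of_dg2 K X univ b fun z hz => (mX z hz).le)
      (E_le_of_dg2 K Y univ _ fun z hz => (mY z hz).1)
  · rw [← hu, E_union_left R _ hd]
    exact add_le_add (E_le_of_dg2 R X univ b fun z hz => (mR z).trans (mX z hz).le)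
      (E_le_of_dg2 R Y univ _ fun z hz => (mY z hz).2.le)
  · intro hne
    rw [← hu] at hne
    rw [← hu, E_union_left R _ hd]
    rcases Finset.union_nonempty.1 hne with hne | hne
    · exact add_lt_add_of_lt_of_le (E_lt_of_dg R X univ b hne fun z hz => (mR z).trans_lt (mX z hz))
        (E_le_of_dg2 R Y univ _ fun z hz => (mY z hz).2.le)
    · exact add_lt_add_of_le_of_lt
        (E_le_of_dg2 R X univ b fun z hz => (mR z).trans (mX z hz).le)
        (E_lt_of_dg R Y univ _ hne fun z hz => (mY z hz).2)

/-- from the structure to the conclusion -/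
lemma phase2 (h : Typ G A B C D n) (hN : n = Fintype.card V) (hn : 100000 ≤ n)
    (N : ℕ) (hNV : Fintype.card V = N) (he : N ^ 2 / 4 < G.edgeSet.ncard)
    (hr : F5tilde N ≤ (Red G).edgeSet.ncard) :
    ∃ P Q R T : Finset V, (∀ z, z ∈ P ∨ z ∈ Q ∨ z ∈ R ∨ z ∈ T) ∧
      Disjoint P Q ∧ Disjoint P R ∧ Disjoint P T ∧ Disjoint Q R ∧ Disjoint Q T ∧ Disjoint R T ∧
      nExtremal N P.card Q.card R.card T.card ∧
      (∀ x ∈ P, ∀ y ∈ P, ¬ G.Adj x y) ∧ (∀ x ∈ Q, ∀ y ∈ Q, ¬ G.Adj x y) ∧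
      (∀ x ∈ R, ∀ y ∈ R, ¬ G.Adj x y) ∧ (∀ x ∈ P, ∀ y ∈ Q, G.Adj x y) ∧
      (∀ x ∈ P, ∀ y ∈ R, ¬ G.Adj x y) ∧ (∀ x ∈ P, ∀ y ∈ T, ¬ G.Adj x y) ∧
      (∀ x ∈ Q, ∀ y ∈ T, ¬ G.Adj x y) := by
  obtain ⟨P, hP⟩ : ∃ P : Finset V, ∀ z, z ∈ P ↔ PA G B n z :=
    ⟨univ.filter (fun z => PA G B n z), fun z => by simp⟩
  obtain ⟨Q, hQ⟩ : ∃ P : Finset V, ∀ z, z ∈ P ↔ PB G A C n z :=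
    ⟨univ.filter (fun z => PB G A C n z), fun z => by simp⟩
  obtain ⟨R, hR⟩ : ∃ P : Finset V, ∀ z, z ∈ P ↔ PC G B D n z :=
    ⟨univ.filter (fun z => PC G B D n z), fun z => by simp⟩
  obtain ⟨T, hT⟩ : ∃ P : Finset V, ∀ z, z ∈ P ↔ PD G C D n z :=
    ⟨univ.filter (fun z => PD G C D n z), fun z => by simp⟩
  have dPQ : Disjoint P Q := Finset.disjoint_left.2 fun z h1 h2 =>
    h.not_AB hn ((hP z).1 h1) ((hQ z).1 h2)
  have dPR : Disjoint P R := Finset.disjoint_left.2 fun z h1 h2 =>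
    h.not_AC hn ((hP z).1 h1) ((hR z).1 h2)
  have dPT : Disjoint P T := Finset.disjoint_left.2 fun z h1 h2 =>
    h.not_AD hn ((hP z).1 h1) ((hT z).1 h2)
  have dQR : Disjoint Q R := Finset.disjoint_left.2 fun z h1 h2 =>
    h.not_BC hn ((hQ z).1 h1) ((hR z).1 h2)
  have dQT : Disjoint Q T := Finset.disjoint_left.2 fun z h1 h2 =>
    h.not_BD hn ((hQ z).1 h1) ((hT z).1 h2)
  have dRT : Disjoint R T := Finset.disjoint_left.2 fun z h1 h2 =>
    h.not_CD hn ((hR z).1 h1) ((hT z).1 h2)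
  have k1 : Disjoint (P ∪ Q) R := Finset.disjoint_union_left.2 ⟨dPR, dQR⟩
  have k2 : Disjoint (P ∪ Q ∪ R) T :=
    Finset.disjoint_union_left.2 ⟨Finset.disjoint_union_left.2 ⟨dPT, dQT⟩, dRT⟩
  -- non-adjacency
  have sPB : ∀ x ∈ P, 0.03 * n ≤ dg G x B := fun x hx => by linarith [((hP x).1 hx).1]
  have sPB' : ∀ x ∈ P, 0.03 * n ≤ dg (Red G) x B := fun x hx => by linarith [((hP x).1 hx).2]
  have sQA : ∀ x ∈ Q, 0.03 * n ≤ dg G x A := fun x hx => by linarith [((hQ x).1 hx).1]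
  have sQC : ∀ x ∈ Q, 0.03 * n ≤ dg G x C := fun x hx => by linarith [((hQ x).1 hx).2]
  have sRB : ∀ x ∈ R, 0.03 * n ≤ dg G x B := fun x hx => ((hR x).1 hx).1
  have sRD : ∀ x ∈ R, 0.03 * n ≤ dg G x D := fun x hx => ((hR x).1 hx).2
  have sTC : ∀ x ∈ T, 0.03 * n ≤ dg G x C := fun x hx => ((hT x).1 hx).1
  have sTD : ∀ x ∈ T, 0.03 * n ≤ dg G x D := fun x hx => ((hT x).1 hx).2
  have nPP : ∀ x ∈ P, ∀ y ∈ P, ¬ G.Adj x y := fun x hx y hy => h.ee1 hn (sPB x hx) (sPB y hy)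
  have nPR : ∀ x ∈ P, ∀ y ∈ R, ¬ G.Adj x y := fun x hx y hy => h.ee1 hn (sPB x hx) (sRB y hy)
  have nRR : ∀ x ∈ R, ∀ y ∈ R, ¬ G.Adj x y := fun x hx y hy => h.ee1 hn (sRB x hx) (sRB y hy)
  have nQQ : ∀ x ∈ Q, ∀ y ∈ Q, ¬ G.Adj x y := fun x hx y hy => h.ee2 hn (sQA x hx) (sQA y hy)
  have nQT : ∀ x ∈ Q, ∀ y ∈ T, ¬ G.Adj x y := fun x hx y hy => h.ee3 hn (sQA x hx) (sTC y hy)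
  have nPT : ∀ x ∈ P, ∀ y ∈ T, ¬ G.Adj x y := fun x hx y hy => h.ee4 hn (sPB' x hx) (sTD y hy)
  have rQR : ∀ x ∈ Q, ∀ y ∈ R, ¬ (Red G).Adj x y := fun x hx y hy hxy =>
    h.rr hn (sRD y hy) (sQC x hx) hxy.symm
  have rRT : ∀ x ∈ R, ∀ y ∈ T, ¬ (Red G).Adj x y := fun x hx y hy => h.rr hn (sRD x hx) (sTC y hy)
  have rTT : ∀ x ∈ T, ∀ y ∈ T, ¬ (Red G).Adj x y := fun x hx y hy => h.rr hn (sTD x hx) (sTC y hy)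
  -- sizes
  have iA : (A.card : ℝ) ≤ P.card := by
    have : A ⊆ P := fun x hx => (hP x).2 (by
      have h1 := h.rAB x hx
      have h2 : dg (Red G) x B ≤ dg G x B := dg_mono _ _ fun y _ hy => hy.1
      have := h.b1
      exact ⟨by linarith, by linarith⟩)
    exact_mod_cast Finset.card_le_card this
  have iB : (B.card : ℝ) ≤ Q.card := by
    have : B ⊆ Q := fun x hx => (hQ x).2 (by
      have h1 := h.rBA x hx
      have h2 : dg (Red G) x A ≤ dg G x A := dg_mono _ _ fun y _ hy => hy.1
      have := h.a1
      have := h.c1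
      have := h.gBC x hx
      exact ⟨by linarith, by linarith⟩)
    exact_mod_cast Finset.card_le_card this
  have iC : (C.card : ℝ) ≤ R.card := by
    have : C ⊆ R := fun x hx => (hR x).2 (by
      have := h.b1
      have := h.d1
      have := h.gCB x hx
      have := h.gCD x hx
      exact ⟨by linarith, by linarith⟩)
    exact_mod_cast Finset.card_le_card this
  -- counting inside
  obtain ⟨U, hU⟩ : ∃ U, U = P ∪ Q ∪ R ∪ T := ⟨_, rfl⟩
  have cU : U.card = P.card + Q.card + R.card + T.card := by
    rw [hU, Finset.card_union_of_disjoint k2, Finset.card_union_of_disjoint k1,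
      Finset.card_union_of_disjoint dPQ]
  have eU : E G U U ≤ 2 * ((P.card : ℝ) * Q.card + Q.card * R.card + R.card * T.card)
      + T.card * (T.card - 1) := by
    rw [hU, E_four G dPQ k1 k2, E_eq_zero G nPP, E_eq_zero G nQQ, E_eq_zero G nRR,
      E_eq_zero G nPR, E_eq_zero G nPT, E_eq_zero G nQT]
    linarith [E_le G P Q, E_le G Q R, E_le G R T, E_self_le G T]
  have mm : ∀ {X Y : Finset V}, (∀ x ∈ X, ∀ y ∈ Y, ¬ G.Adj x y) →
      ∀ x ∈ X, ∀ y ∈ Y, ¬ (Red G).Adj x y := fun h x hx y hy hxy => h x hx y hy hxy.1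
  have rU : E (Red G) U U = 2 * E (Red G) P Q := by
    rw [hU, E_four (Red G) dPQ k1 k2, E_eq_zero _ (mm nPP), E_eq_zero _ (mm nQQ),
      E_eq_zero _ (mm nRR), E_eq_zero _ (mm nPR), E_eq_zero _ (mm nPT), E_eq_zero _ (mm nQT),
      E_eq_zero _ rQR, E_eq_zero _ rRT, E_eq_zero _ rTT]
    ring
  have rPQ := E_le (Red G) P Q
  -- dominated
  have hZ : ∀ z ∈ Uᶜ, dg G z univ < Q.card ∨
      (dg G z univ ≤ P.card + R.card ∧ dg (Red G) z univ < P.card) := by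
    intro z hz
    rw [hU] at hz
    simp only [Finset.mem_compl, Finset.mem_union, not_or, hP, hQ, hR, hT] at hz
    rcases h.classify hN hn z with q | q | q | q | q | q
    · exact absurd q hz.1.1.1
    · exact absurd q hz.1.1.2
    · exact absurd q hz.1.2
    · exact absurd q hz.2
    · exact Or.inl (by linarith)
    · exact Or.inr ⟨by linarith [q.1], by linarith [q.2]⟩
  obtain ⟨p, q, hpq, z1, z2, z3⟩ := cntZ G (Red G) (fun _ _ hxy => hxy.1) Uᶜ
    P.card Q.card R.card hZ
  have t1 := cnt1 G U
  have t2 := cnt1 (Red G) U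
  rw [E_univ] at t1 t2
  have hsum : (P.card + p) + (Q.card + q) + R.card + T.card = N := by
    have := Finset.card_add_card_compl U
    omega
  have hval : N ^ 2 / 4 < (P.card + p) * (Q.card + q) + (Q.card + q) * R.card + R.card * T.card
      + T.card.choose 2 := by
    refine lt_of_lt_of_le he ?_
    have hpq0 : (0 : ℝ) ≤ (p : ℝ) * q := by positivity
    have : (G.edgeSet.ncard : ℝ) ≤ (((P.card + p) * (Q.card + q) + (Q.card + q) * R.card
        + R.card * T.card + T.card.choose 2 : ℕ) : ℝ) := by
      push_cast [choose_two_real]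
      linarith
    exact_mod_cast this
  have hF := (F1 N _ _ _ _ hsum hval).trans hr
  have hF' : ((P.card : ℝ) + p) * (Q.card + q) ≤ (Red G).edgeSet.ncard := by exact_mod_cast hF
  have hpq0 : (0 : ℝ) ≤ (p : ℝ) * q := by positivity
  have hne : ¬ (Uᶜ).Nonempty := by
    intro hne
    have := z3 hne
    linarith
  rw [Finset.not_nonempty_iff_eq_empty] at hne
  have h0 : p + q = 0 := by rw [hpq, hne, Finset.card_empty]
  have p0 : p = 0 := by omega
  have q0 : q = 0 := by omega
  rw [p0, q0] at z1 z2 hF' hsum hval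
  rw [p0, q0] at hF
  simp only [Nat.cast_zero, add_zero, zero_mul] at z1 z2 hF' hsum hval hF
  have hcomp := full_of_E (Red G) P Q (by linarith)
  refine ⟨P, Q, R, T, ?_, dPQ, dPR, dPT, dQR, dQT, dRT, ⟨hsum, ?_, hval⟩, nPP, nQQ, nRR,
    fun x hx y hy => (hcomp x hx y hy).1, nPR, nPT, nQT⟩
  · intro z
    have : z ∈ U := by
      by_contra hc
      have : z ∈ Uᶜ := Finset.mem_compl.2 hc
      rw [hne] at this
      exact absurd this (Finset.notMem_empty z)
    rw [hU] at this
    simp only [Finset.mem_union] at this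
    tauto
  · refine le_antisymm (F1 N _ _ _ _ hsum hval) (hr.trans ?_)
    have : ((Red G).edgeSet.ncard : ℝ) ≤ ((P.card * Q.card : ℕ) : ℝ) := by
      push_cast
      linarith
    exact_mod_cast this

end ph3

/-- assembly -/
lemma assembly : ∃ n₀ : ℕ, ∀ N : ℕ, n₀ ≤ N → ∀ G : SimpleGraph (Fin N),
    N ^ 2 / 4 + 1 ≤ G.edgeSet.ncard → countEdgesInC G 5 = F5 N →
    ∃ A B C D : Finset (Fin N), Typ G A B C D (N : ℝ) := by
  obtain ⟨M, hM⟩ := F3 0.000000000000000000000000000000000000000000000001 (by norm_num)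
  obtain ⟨k, hk⟩ := exists_nat_ge (2 / (0.000000000000000000000000000000000000000000000001 : ℝ))
  obtain ⟨K, hK⟩ := exists_nat_ge ((3 * k * 1000000000000000000000000000000000000000000000000 : ℝ) + k ^ 2 + 100000000000000000000000000000000000000000000000000 + 1)
  refine ⟨M + K, fun N hN G he hc => ?_⟩
  have hNK : (K : ℝ) ≤ N := by exact_mod_cast (by omega : K ≤ N)
  have hk0 : (0 : ℝ) ≤ k := Nat.cast_nonneg k
  have hk2 : (0 : ℝ) ≤ (k : ℝ) ^ 2 := by positivity
  have hcard : (Fintype.card (Fin N) : ℝ) = N := by simp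
  have hn : (100000000000000000000000000000000000000000000000000 : ℝ) ≤ N := by linarith
  have hn0 : (0 : ℝ) < N := by linarith
  have e1 : (3 * k : ℝ) ≤ 0.000000000000000000000000000000000000000000000001 * N := by linarith
  have e2 : 3 * (k : ℝ) * N ≤ 0.000000000000000000000000000000000000000000000001 * (N : ℝ) ^ 2 := by
    have := mul_le_mul_of_nonneg_right e1 hn0.le
    linarith
  obtain ⟨S, G', H, hp, hle, hHR, c1, c2⟩ := cleaning G 0.000000000000000000000000000000000000000000000001 k
    ((div_le_iff₀ (by norm_num)).1 hk) (by norm_num) (by rw [hcard]; linarith)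
  rw [hcard] at c1 c2
  have hE : (N : ℝ) ^ 2 / 2 < E G univ univ := by
    rw [E_univ]
    have h4 : N ^ 2 < 4 * G.edgeSet.ncard := by omega
    have : (N : ℝ) ^ 2 < 4 * G.edgeSet.ncard := by exact_mod_cast h4
    linarith
  have hr : ((2 - √2) / 16 - 0.000000000000000000000000000000000000000000000001) * (N : ℝ) ^ 2 ≤ ((Red G).edgeSet.ncard : ℝ) :=
    (hM N (by omega)).trans (by exact_mod_cast F2 N G he hc)
  have hr2 := E_univ (Red G)
  have hN2 : (0 : ℝ) ≤ (N : ℝ) ^ 2 := by positivity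
  exact stab_main hp hle hHR (N : ℝ) hcard.symm hn hE (by linarith) (by linarith)

lemma final : ∃ n₀ : ℕ, ∀ N : ℕ, n₀ ≤ N → ∀ G : SimpleGraph (Fin N),
    N ^ 2 / 4 + 1 ≤ G.edgeSet.ncard → countEdgesInC G 5 = F5 N →
    ∃ P Q R T : Finset (Fin N), (∀ z, z ∈ P ∨ z ∈ Q ∨ z ∈ R ∨ z ∈ T) ∧
      Disjoint P Q ∧ Disjoint P R ∧ Disjoint P T ∧ Disjoint Q R ∧ Disjoint Q T ∧ Disjoint R T ∧
      nExtremal N P.card Q.card R.card T.card ∧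
      (∀ x ∈ P, ∀ y ∈ P, ¬ G.Adj x y) ∧ (∀ x ∈ Q, ∀ y ∈ Q, ¬ G.Adj x y) ∧
      (∀ x ∈ R, ∀ y ∈ R, ¬ G.Adj x y) ∧ (∀ x ∈ P, ∀ y ∈ Q, G.Adj x y) ∧
      (∀ x ∈ P, ∀ y ∈ R, ¬ G.Adj x y) ∧ (∀ x ∈ P, ∀ y ∈ T, ¬ G.Adj x y) ∧
      (∀ x ∈ Q, ∀ y ∈ T, ¬ G.Adj x y) := by
  obtain ⟨n₀, h⟩ := assembly
  refine ⟨n₀ + 100000, fun N hN G he hc => ?_⟩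
  obtain ⟨A, B, C, D, hT⟩ := h N (by omega) G he hc
  exact phase2 hT (by simp) (by exact_mod_cast (by omega : 100000 ≤ N)) N (by simp) (by omega)
    (F2 N G he hc)

end EC5

theorem stmt10 :
    ∃ n₀ : ℕ, ∀ n : ℕ, n₀ ≤ n → ∀ G : SimpleGraph (Fin n),
      n ^ 2 / 4 + 1 ≤ G.edgeSet.ncard →
      countEdgesInC G 5 = F5 n →
      ∃ A B C D : Finset (Fin n),
        A ∪ B ∪ C ∪ D = Finset.univ ∧
        Disjoint A B ∧ Disjoint A C ∧ Disjoint A D ∧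
        Disjoint B C ∧ Disjoint B D ∧ Disjoint C D ∧
        nExtremal n A.card B.card C.card D.card ∧
        (∀ u ∈ A, ∀ v ∈ A, ¬ G.Adj u v) ∧
        (∀ u ∈ B, ∀ v ∈ B, ¬ G.Adj u v) ∧
        (∀ u ∈ C, ∀ v ∈ C, ¬ G.Adj u v) ∧
        (∀ u ∈ A, ∀ v ∈ B, G.Adj u v) ∧
        (∀ u ∈ A, ∀ v ∈ C ∪ D, ¬ G.Adj u v) ∧
        (∀ u ∈ B, ∀ v ∈ D, ¬ G.Adj u v) := by
  obtain ⟨n₀, h⟩ := EC5.final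
  refine ⟨n₀, fun n hn G he hc => ?_⟩
  obtain ⟨A, B, C, D, hu, h1, h2, h3, h4, h5, h6, h7, h8, h9, h10, h11, h12, h13, h14⟩ :=
    h n hn G he hc
  refine ⟨A, B, C, D, ?_, h1, h2, h3, h4, h5, h6, h7, h8, h9, h10, h11, ?_, h14⟩
  · ext z
    have := hu z
    simp only [Finset.mem_union, Finset.mem_univ, iff_true]
    tauto
  · intro u hu v hv
    rcases Finset.mem_union.1 hv with hv | hv
    · exact h12 u hu v hv
    · exact h13 u hu v hv
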